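/- Let n ≥ 1. Let g be a random 2n×2n real matrix whose law has a factorizing density P_G with weight σ, let h be the determinant density of σ with 0 < Mh(2j−1) < ∞ for j = 1,…,n, and let ã ∈ (0,∞)ⁿ have pairwise distinct entries. Then, for every invariant test function φ, E[φ(g · D(ã) · gᵀ)] = ∫_{(0,∞)ⁿ} φ(D(a)) · p(a) da, where p(a) = [1/(n! · ∏_{j=1}^n Mh(2j−1))] · (Δ_n(a²)/Δ_n(ã²)) · det[(1/ã_c)·h(a_b/ã_c)]_{b,c=1,…,n}. -/

import Mathlib

open MeasureTheory Matrix
open scoped BigOperators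

noncomputable section

instance matrixMeasurableSpace {l : Type*} [Fintype l] : MeasurableSpace (Matrix l l ℝ) :=
  inferInstanceAs (MeasurableSpace (l → l → ℝ))

/-- The orthogonal group `O(m)` as a subtype of `m × m` real matrices. -/
abbrev OG (m : ℕ) := Matrix.orthogonalGroup (Fin m) ℝ

/-- `t ^ w` for a real `t ≥ 0` and complex `w`, with the convention `0 ^ w = 0`. -/
def cpw (t : ℝ) (w : ℂ) : ℂ := if t = 0 then 0 else Complex.exp (w * Real.log t)

/-- The `2n × 2n` real antisymmetric matrix `D(a) = diag(a₁ J, …, aₙ J)`,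
`J = [[0,1],[-1,0]]`. -/
def Dmat {n : ℕ} (a : Fin n → ℝ) : Matrix (Fin (2 * n)) (Fin (2 * n)) ℝ :=
  Matrix.of fun i j =>
    if i.val / 2 = j.val / 2 then
      a ⟨i.val / 2, by have := i.isLt; omega⟩ *
        (if i.val % 2 = 0 ∧ j.val % 2 = 1 then 1
          else if i.val % 2 = 1 ∧ j.val % 2 = 0 then -1 else 0)
    else 0

/-- `s_{n+1} := -n-1` convention: the `j`-th exponent `(s_j - s_{j+1})/2 - 1`. -/
def expo (n : ℕ) (s : Fin n → ℂ) (j : Fin n) : ℂ :=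
  (s j - (if h : j.val + 1 < n then s ⟨j.val + 1, h⟩ else -(n : ℂ) - 1)) / 2 - 1

/-- The spherical-type group integral
`f_n(s,X) = ∫_{O(2n)} ∏_j det((kXkᵀ)_{[2j]})^{(s_j-s_{j+1})/2-1} d*k`. -/
def sphInt (n : ℕ) (μ : Measure (OG (2 * n))) (s : Fin n → ℂ)
    (X : Matrix (Fin (2 * n)) (Fin (2 * n)) ℝ) : ℂ :=
  ∫ k : OG (2 * n), ∏ j : Fin n,
    cpw ((((k : Matrix (Fin (2 * n)) (Fin (2 * n)) ℝ) * X *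
        (k : Matrix (Fin (2 * n)) (Fin (2 * n)) ℝ)ᵀ).submatrix
          (Fin.castLE (by have := j.isLt; omega : 2 * (j.val + 1) ≤ 2 * n))
          (Fin.castLE (by have := j.isLt; omega : 2 * (j.val + 1) ≤ 2 * n))).det)
      (expo n s j) ∂μ


/-- The block lower-triangular matrix in `T` with `2×2` identity diagonal blocks
built from its strictly-lower `2×2` blocks. -/
def Tmat {n : ℕ} (c : {ij : Fin n × Fin n // ij.2 < ij.1} → Fin 2 → Fin 2 → ℝ) :
    Matrix (Fin (2 * n)) (Fin (2 * n)) ℝ :=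
  Matrix.of fun i j =>
    if h : j.val / 2 < i.val / 2 then
      c ⟨(⟨i.val / 2, by have := i.isLt; omega⟩, ⟨j.val / 2, by have := j.isLt; omega⟩),
          Fin.mk_lt_mk.mpr h⟩ ⟨i.val % 2, by omega⟩ ⟨j.val % 2, by omega⟩
    else if i.val / 2 = j.val / 2 then (if i.val % 2 = j.val % 2 then 1 else 0) else 0

/-- The `2×2` block-diagonal matrix `diag(z₁,…,zₙ)` built from its blocks. -/
def Zmat {n : ℕ} (zc : Fin n → Fin 2 → Fin 2 → ℝ) : Matrix (Fin (2 * n)) (Fin (2 * n)) ℝ :=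
  Matrix.of fun i j =>
    if i.val / 2 = j.val / 2 then
      zc ⟨i.val / 2, by have := i.isLt; omega⟩ ⟨i.val % 2, by omega⟩ ⟨j.val % 2, by omega⟩
    else 0

/-- A factorizing ensemble on `Gl_ℝ(2n)`: a `K`-bi-invariant probability density whose
block-triangular decomposition density factorizes with weight `σw`. -/
structure IsFactorizing (n : ℕ) (P : Matrix (Fin (2 * n)) (Fin (2 * n)) ℝ → ℝ)
    (σw : Matrix (Fin 2) (Fin 2) ℝ → ℝ) : Prop where
  nonneg : ∀ g, 0 ≤ P g
  integrable : Integrable (fun u : Fin (2 * n) → Fin (2 * n) → ℝ => P (Matrix.of u))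
  prob : (∫ u : Fin (2 * n) → Fin (2 * n) → ℝ, P (Matrix.of u)) = 1
  invariant : ∀ g, ∀ k₁ ∈ Matrix.orthogonalGroup (Fin (2 * n)) ℝ,
      ∀ k₂ ∈ Matrix.orthogonalGroup (Fin (2 * n)) ℝ, P (k₁ * g * k₂) = P g
  wnonneg : ∀ z, 0 ≤ σw z
  factor : ∀ᵐ zc : Fin n → Fin 2 → Fin 2 → ℝ,
    (∏ j : Fin n, ((Matrix.of (zc j)) * (Matrix.of (zc j))ᵀ).det ^ (n - 1 - j.val)) *
        (∫ c : {ij : Fin n × Fin n // ij.2 < ij.1} → Fin 2 → Fin 2 → ℝ,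
          P (Tmat c * Zmat zc)) =
      ∏ j : Fin n, σw (Matrix.of (zc j))

/-- Vandermonde product `Δ_m(x) = ∏_{j<k} (x_k - x_j)`. -/
def vdm {m : ℕ} {R : Type*} [CommRing R] (x : Fin m → R) : R :=
  ∏ p ∈ Finset.univ.filter (fun p : Fin m × Fin m => p.1 < p.2), (x p.2 - x p.1)

/-- A bounded measurable `O(m)`-invariant test function on antisymmetric matrices. -/
def IsInvTest (m : ℕ) (φ : Matrix (Fin m) (Fin m) ℝ → ℝ) : Prop :=
  Measurable φ ∧ (∃ C, ∀ X, |φ X| ≤ C) ∧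
    ∀ X : Matrix (Fin m) (Fin m) ℝ, Xᵀ = -X →
      ∀ k ∈ Matrix.orthogonalGroup (Fin m) ℝ, φ (k * X * kᵀ) = φ X

/-- `h` is the density of `|det z|` under the weight `σw` on `M₂(ℝ)`. -/
def IsDetDensity (σw : Matrix (Fin 2) (Fin 2) ℝ → ℝ) (h : ℝ → ℝ) : Prop :=
  (∀ t : ℝ, 0 < t → 0 ≤ h t) ∧
    ∀ ψ : ℝ → ℝ, Measurable ψ → (∃ C, ∀ t, |ψ t| ≤ C) →
      (∫ z : Fin 2 → Fin 2 → ℝ, σw (Matrix.of z) * ψ |(Matrix.of z).det|) =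
        ∫ t in Set.Ioi (0 : ℝ), h t * ψ t

/-- Mellin transform `Mh(u) = ∫₀^∞ h(t) t^{u-1} dt`. -/
def mellH (h : ℝ → ℝ) (u : ℝ) : ℝ := ∫ t in Set.Ioi (0 : ℝ), h t * t ^ (u - 1)

/-- Mellin convolution `(h ⊛ w)(y) = ∫₀^∞ h(t) w(y/t) dt/t`. -/
def mconv (h w : ℝ → ℝ) (y : ℝ) : ℝ := ∫ t in Set.Ioi (0 : ℝ), h t * w (y / t) / t

section
open Finset Set Fin Complex MeasureTheory.Measure Equiv ENNReal
variable {n m : ℕ}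
local notation:max "oR" => ENNReal.ofReal
local notation:max "Vc" n:max => (Fin n → ℝ)
local notation:max "Fz" n:max => (Fin (2 * n))
local notation:max "Vz" n:max => (Fin (2 * n) → ℝ)

def e2 (n : ℕ) : Fin n × Fin 2 ≃ Fz n where
  toFun p := ⟨2 * p.1.val + p.2.val, by have := p.1.isLt; have := p.2.isLt; omega⟩
  invFun i := (⟨i.val / 2, by have := i.isLt; omega⟩, ⟨i.val % 2, by omega⟩)
  left_inv p := by
    have := p.2.isLt
    ext <;> simp <;> omega
  right_inv i := by ext; simp; omega

lemma e2_div (i : Fin n) (b : Fin 2) : (e2 n (i, b)).val / 2 = i.val := by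
  have := b.isLt; simp [e2]; omega
lemma e2_mod (i : Fin n) (b : Fin 2) : (e2 n (i, b)).val % 2 = b.val := by
  have := b.isLt; simp [e2]; omega

lemma Dmat_e2 (a : Vc n) (i j : Fin n) (b c : Fin 2) :
    Dmat a (e2 n (i, b)) (e2 n (j, c)) =
      if i = j then a i * (!![0, 1; -1, 0] : Matrix (Fin 2) (Fin 2) ℝ) b c else 0 := by
  have h1 := e2_div i b
  have h2 := e2_div j c
  have h3 := e2_mod i b
  have h4 := e2_mod j c
  unfold Dmat
  simp only [of_apply, h1, h2, h3, h4, ← Fin.ext_iff]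
  by_cases hij : i = j
  · simp only [hij, if_true]
    fin_cases b <;> fin_cases c <;> simp
  · simp [hij]

lemma Dmat_transpose (a : Vc n) : (Dmat a)ᵀ = -Dmat a := by
  ext i j
  obtain ⟨⟨i, b⟩, rfl⟩ := (e2 n).surjective i
  obtain ⟨⟨j, c⟩, rfl⟩ := (e2 n).surjective j
  simp only [transpose_apply, Matrix.neg_apply, Dmat_e2]
  by_cases hij : i = j
  · subst hij; fin_cases b <;> fin_cases c <;> simp
  · simp [hij, Ne.symm hij]

lemma sum_e2 {M : Type*} [AddCommMonoid M] (f : Fz n → M) :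
    ∑ i, f i = ∑ j : Fin n, (f (e2 n (j, 0)) + f (e2 n (j, 1))) := by
  rw [← (e2 n).sum_comp, Fintype.sum_prod_type]
  simp [sum_univ_two]
def border (M : Matrix (Fin m) (Fin m) ℝ) (v : Vc m) :
    Matrix (Fin (m + 1)) (Fin (m + 1)) ℝ :=
  of (snoc (fun i => snoc (M i) (v i)) (snoc (fun i => -v i) 0))

section border
variable {m : ℕ} (M : Matrix (Fin m) (Fin m) ℝ) (v : Vc m)
@[simp] lemma border_cc (i j : Fin m) : border M v i.castSucc j.castSucc = M i j := by
  simp [border]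
@[simp] lemma border_cl (i : Fin m) : border M v i.castSucc (last m) = v i := by
  simp [border]
@[simp] lemma border_lc (j : Fin m) : border M v (last m) j.castSucc = -v j := by
  simp [border]
@[simp] lemma border_ll : border M v (last m) (last m) = 0 := by
  simp [border]

lemma border_transpose (h : Mᵀ = -M) : (border M v)ᵀ = -border M v := by
  have h' : ∀ i j, M j i = - M i j := fun i j => by
    have := congrFun (congrFun h i) j; simpa using this
  ext i j
  refine lastCases ?_ (fun i => ?_) i <;> refine lastCases ?_ (fun j => ?_) j
  · simp
  · simp
  · simp
  · simp [h' i j]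

lemma border_mulVec (q : Vc m) (t : ℝ) :
    border M v *ᵥ (snoc q t : Vc (m+1)) =
      snoc (M *ᵥ q + t • v) (-(v ⬝ᵥ q)) := by
  ext i
  refine lastCases ?_ (fun i => ?_) i
  · simp [mulVec, dotProduct, sum_univ_castSucc]
  · simp [mulVec, dotProduct, sum_univ_castSucc, mul_comm]

end border

def ext1 (k : Matrix (Fin m) (Fin m) ℝ) : Matrix (Fin (m + 1)) (Fin (m + 1)) ℝ :=
  of (snoc (fun i => snoc (k i) 0) (snoc (fun _ => 0) 1))

section
variable {m : ℕ} (k : Matrix (Fin m) (Fin m) ℝ)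
@[simp] lemma ext1_cc (i j : Fin m) : ext1 k i.castSucc j.castSucc = k i j := by simp [ext1]
@[simp] lemma ext1_cl (i : Fin m) : ext1 k i.castSucc (last m) = 0 := by simp [ext1]
@[simp] lemma ext1_lc (j : Fin m) : ext1 k (last m) j.castSucc = 0 := by simp [ext1]
@[simp] lemma ext1_ll : ext1 k (last m) (last m) = 1 := by simp [ext1]

lemma mem_orth_iff (k : Matrix (Fin m) (Fin m) ℝ) :
    k ∈ orthogonalGroup (Fin m) ℝ ↔ k * kᵀ = 1 := by
  rw [mem_orthogonalGroup_iff]; first | done | rfl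
lemma ext1_mem (h : k ∈ orthogonalGroup (Fin m) ℝ) :
    ext1 k ∈ orthogonalGroup (Fin (m + 1)) ℝ := by
  rw [mem_orth_iff] at *
  have h' : ∀ i j, ∑ l, k i l * k j l = if i = j then 1 else 0 := fun i j => by
    have := congrFun (congrFun h i) j
    simpa [Matrix.mul_apply, Matrix.one_apply] using this
  ext i j
  refine lastCases ?_ (fun i => ?_) i <;> refine lastCases ?_ (fun j => ?_) j <;>
    simp [Matrix.mul_apply, sum_univ_castSucc, Matrix.one_apply, h', (castSucc_ne_last _).symm]

lemma ext1_conj (M : Matrix (Fin m) (Fin m) ℝ) (v : Vc m) :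
    ext1 k * border M v * (ext1 k)ᵀ = border (k * M * kᵀ) (k *ᵥ v) := by
  ext i j
  refine lastCases ?_ (fun i => ?_) i <;> refine lastCases ?_ (fun j => ?_) j <;>
    simp [Matrix.mul_apply, sum_univ_castSucc, mulVec, dotProduct, mul_comm]
end

section eig
variable {m : ℕ} (X : Matrix (Fin m) (Fin m) ℝ)

lemma skew_dot (hX : Xᵀ = -X) (u w : Vc m) : u ⬝ᵥ (X *ᵥ w) = -((X *ᵥ u) ⬝ᵥ w) := by
  rw [dotProduct_mulVec, ← mulVec_transpose, hX, neg_mulVec]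
  simp

lemma eig_orth (hX : Xᵀ = -X) (u w : Vc m) (a b : ℝ) (hab : a ≠ b)
    (hu : X *ᵥ (X *ᵥ u) = a • u) (hw : X *ᵥ (X *ᵥ w) = b • w) : u ⬝ᵥ w = 0 := by
  have h1 : u ⬝ᵥ (X *ᵥ (X *ᵥ w)) = (X *ᵥ (X *ᵥ u)) ⬝ᵥ w := by
    rw [skew_dot X hX, skew_dot X hX]; simp
  rw [hu, hw] at h1
  simp only [dotProduct_smul, smul_dotProduct, smul_eq_mul] at h1
  have : (a - b) * (u ⬝ᵥ w) = 0 := by linarith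
  rcases mul_eq_zero.1 this with h | h
  · exact absurd (sub_eq_zero.1 h) hab
  · exact h

lemma orth_core (hX : Xᵀ = -X) (a : Vc n) (ha : ∀ j, 0 < a j)
    (hinj : Function.Injective a) (U W : Fin n → Vc m)
    (hU : ∀ j, X *ᵥ U j = -(a j) • W j) (hW : ∀ j, X *ᵥ W j = a j • U j)
    (hne : ∀ j, W j ≠ 0) :
    ∃ R : Matrix (Fz n) (Fin m) ℝ, R * Rᵀ = 1 ∧ X * Rᵀ = Rᵀ * Dmat a ∧
      ∀ N : Vc m, X *ᵥ N = 0 → R *ᵥ N = 0 := by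
  have hUU : ∀ j, X *ᵥ (X *ᵥ U j) = (-(a j)^2) • U j := fun j => by
    rw [hU, mulVec_smul, hW, smul_smul]; congr 1; ring
  have hWW : ∀ j, X *ᵥ (X *ᵥ W j) = (-(a j)^2) • W j := fun j => by
    rw [hW, mulVec_smul, hU, smul_smul]; congr 1; ring
  have hd : ∀ i j, i ≠ j → -(a i)^2 ≠ -(a j)^2 := fun i j hij h => hij (hinj (by
    have := ha i; have := ha j; nlinarith))
  have hz : ∀ i, -(a i)^2 ≠ 0 := fun i => by have := ha i; have : 0 < (a i)^2 := by positivity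
                                             linarith
  have hUW : ∀ j, U j ⬝ᵥ W j = 0 := fun j => by
    have := skew_dot X hX (U j) (U j)
    rw [dotProduct_comm (X *ᵥ U j), hU] at this
    simp only [dotProduct_smul, smul_eq_mul] at this
    have h2 : a j * (U j ⬝ᵥ W j) = 0 := by linarith
    exact (mul_eq_zero.1 h2).resolve_left (ha j).ne'
  have hnorm : ∀ j, U j ⬝ᵥ U j = W j ⬝ᵥ W j := fun j => by
    have := skew_dot X hX (U j) (W j)
    rw [hU, hW] at this
    simpa [(ha j).ne'] using this
  have hpos : ∀ j, 0 < W j ⬝ᵥ W j := fun j => by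
    have h0 : 0 ≤ W j ⬝ᵥ W j := sum_nonneg fun i _ => mul_self_nonneg _
    rcases h0.lt_or_eq with h | h
    · exact h
    · exact absurd (dotProduct_self_eq_zero.1 h.symm) (hne j)
  let c : Vc n := fun j => (Real.sqrt (W j ⬝ᵥ W j))⁻¹
  have hc : ∀ j, c j * c j * (W j ⬝ᵥ W j) = 1 := fun j => by
    have h := hpos j
    have : c j * c j = (W j ⬝ᵥ W j)⁻¹ := by
      simp only [c]; rw [← mul_inv, Real.mul_self_sqrt h.le]
    rw [this, inv_mul_cancel₀ h.ne']
  let r : Fin n × Fin 2 → Vc m := fun p => if p.2 = 0 then c p.1 • U p.1 else c p.1 • W p.1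
  let R : Matrix (Fz n) (Fin m) ℝ := of fun i => r ((e2 n).symm i)
  have hR : ∀ p, R (e2 n p) = r p := fun p => by ext; simp [R]
  have hr0 : ∀ j, r (j, 0) = c j • U j := fun j => by simp [r]
  have hr1 : ∀ j, r (j, 1) = c j • W j := fun j => by simp [r]
  refine ⟨R, ?_, ?_, ?_⟩
  · ext i j
    obtain ⟨⟨i, b⟩, rfl⟩ := (e2 n).surjective i
    obtain ⟨⟨j, d⟩, rfl⟩ := (e2 n).surjective j
    have : (R * Rᵀ) (e2 n (i, b)) (e2 n (j, d)) = r (i, b) ⬝ᵥ r (j, d) := by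
      rw [← hR, ← hR]; rfl
    rw [this, Matrix.one_apply]
    simp only [EmbeddingLike.apply_eq_iff_eq, Prod.mk.injEq]
    by_cases hij : i = j
    · subst hij
      fin_cases b <;> fin_cases d
      · simp only [zero_eta, hr0, mk_one, hr1, smul_dotProduct, dotProduct_smul, smul_eq_mul, hnorm]
        simp [← mul_assoc, hc]
      · simp [hr0, hr1, hUW]
      · simp [hr0, hr1, dotProduct_comm (W i), hUW]
      · simp only [zero_eta, hr0, mk_one, hr1, smul_dotProduct, dotProduct_smul, smul_eq_mul, hnorm]
        simp [← mul_assoc, hc]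
    · have e1 := eig_orth X hX _ _ _ _ (hd i j hij) (hUU i) (hUU j)
      have e2 := eig_orth X hX _ _ _ _ (hd i j hij) (hUU i) (hWW j)
      have e3 := eig_orth X hX _ _ _ _ (hd i j hij) (hWW i) (hUU j)
      have e4 := eig_orth X hX _ _ _ _ (hd i j hij) (hWW i) (hWW j)
      fin_cases b <;> fin_cases d <;> simp [hr0, hr1, e1, e2, e3, e4, hij]
  · ext x j
    obtain ⟨⟨j, d⟩, rfl⟩ := (e2 n).surjective j
    have h1 : (X * Rᵀ) x (e2 n (j, d)) = (X *ᵥ r (j, d)) x := by rw [← hR]; rfl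
    have h2 : (Rᵀ * Dmat a) x (e2 n (j, d)) = ∑ i, R i x * Dmat a i (e2 n (j, d)) := rfl
    rw [h1, h2, sum_e2]
    simp only [Dmat_e2, hR]
    fin_cases d
    · simp [hr0, hr1, mulVec_smul, hU, sum_ite_eq]; ring
    · simp [hr0, hr1, mulVec_smul, hW, sum_ite_eq]; ring
  · intro N hN
    ext i
    obtain ⟨⟨i, b⟩, rfl⟩ := (e2 n).surjective i
    have : (R *ᵥ N) (e2 n (i, b)) = r (i, b) ⬝ᵥ N := by rw [← hR]; rfl
    rw [this]
    have h0 : X *ᵥ (X *ᵥ N) = (0:ℝ) • N := by simp [hN]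
    have e1 := eig_orth X hX _ _ _ _ (hz i) (hUU i) h0
    have e2 := eig_orth X hX _ _ _ _ (hz i) (hWW i) h0
    fin_cases b <;> simp [hr0, hr1, e1, e2]
end eig

lemma orth_even (X : Matrix (Fz n) (Fz n) ℝ) (hX : Xᵀ = -X)
    (a : Vc n) (ha : ∀ j, 0 < a j)
    (hinj : Function.Injective a) (U W : Fin n → Vz n)
    (hU : ∀ j, X *ᵥ U j = -(a j) • W j) (hW : ∀ j, X *ᵥ W j = a j • U j)
    (hne : ∀ j, W j ≠ 0) :
    ∃ k ∈ orthogonalGroup (Fz n) ℝ, k * X * kᵀ = Dmat a := by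
  obtain ⟨R, h1, h2, -⟩ := orth_core X hX a ha hinj U W hU hW hne
  refine ⟨R, (mem_orth_iff R).2 h1, ?_⟩
  rw [Matrix.mul_assoc, h2, ← Matrix.mul_assoc, h1, Matrix.one_mul]

lemma orth_odd (X : Matrix (Fin (2*n+1)) (Fin (2*n+1)) ℝ) (hX : Xᵀ = -X)
    (a : Vc n) (ha : ∀ j, 0 < a j)
    (hinj : Function.Injective a) (U W : Fin n → Vc (2*n+1))
    (hU : ∀ j, X *ᵥ U j = -(a j) • W j) (hW : ∀ j, X *ᵥ W j = a j • U j)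
    (hne : ∀ j, W j ≠ 0) :
    ∃ k ∈ orthogonalGroup (Fin (2*n+1)) ℝ, k * X * kᵀ = border (Dmat a) 0 := by
  obtain ⟨R, h1, h2, h3⟩ := orth_core X hX a ha hinj U W hU hW hne
  have hdet : X.det = 0 := by
    have := congrArg det hX
    rw [det_transpose, det_neg] at this
    simp [pow_add, pow_mul] at this
    linarith
  obtain ⟨N, hN0, hN⟩ := exists_mulVec_eq_zero_iff.2 hdet
  have hpos : 0 < N ⬝ᵥ N := by
    have h0 : 0 ≤ N ⬝ᵥ N := sum_nonneg fun i _ => mul_self_nonneg _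
    rcases h0.lt_or_eq with h | h
    · exact h
    · exact absurd (dotProduct_self_eq_zero.1 h.symm) hN0
  set N' : Vc (2*n+1) := (Real.sqrt (N ⬝ᵥ N))⁻¹ • N with hN'
  have hn1 : N' ⬝ᵥ N' = 1 := by
    simp only [hN', smul_dotProduct, dotProduct_smul, smul_eq_mul]
    rw [← mul_assoc, ← mul_inv, Real.mul_self_sqrt hpos.le, inv_mul_cancel₀ hpos.ne']
  have hn2 : X *ᵥ N' = 0 := by rw [hN', mulVec_smul, hN, smul_zero]
  have hn3 := h3 _ hn2
  let K : Matrix (Fin (2*n+1)) (Fin (2*n+1)) ℝ := of (snoc (fun i => R i) N')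
  have hKc : ∀ i : Fz n, K i.castSucc = R i := fun i => by ext; simp [K]
  have hKl : K (last _) = N' := by ext; simp [K]
  have hK : K * Kᵀ = 1 := by
    ext i j
    have : (K * Kᵀ) i j = K i ⬝ᵥ K j := rfl
    rw [this]
    have e1 : ∀ i, R i ⬝ᵥ N' = 0 := fun i => congrFun hn3 i
    have e2 : ∀ i j, R i ⬝ᵥ R j = (1 : Matrix (Fz n) (Fz n) ℝ) i j := fun i j => by
      rw [← h1]; rfl
    refine lastCases ?_ (fun i => ?_) i <;> refine lastCases ?_ (fun j => ?_) j <;>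
      simp only [hKc, hKl, hn1, e1, e2, dotProduct_comm N', Matrix.one_apply] <;>
      simp [(castSucc_ne_last _).symm]
  refine ⟨K, (mem_orth_iff K).2 hK, ?_⟩
  have : X * Kᵀ = Kᵀ * border (Dmat a) 0 := by
    ext x j
    have h5 : (X * Kᵀ) x j = (X *ᵥ (K j)) x := rfl
    rw [h5, Matrix.mul_apply, sum_univ_castSucc]
    refine lastCases ?_ (fun j => ?_) j
    · simp [hKl, hn2]
    · simp only [hKc, transpose_apply, border_cc, border_lc]
      have := congrFun (congrFun h2 x) j
      rw [Matrix.mul_apply, Matrix.mul_apply] at this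
      simpa [mulVec, dotProduct] using this
  rw [Matrix.mul_assoc, this, ← Matrix.mul_assoc, hK, Matrix.one_mul]

lemma eig_border (M : Matrix (Fin m) (Fin m) ℝ) (hM : Mᵀ = -M) (v q : Vc m) (a : ℝ)
    (hv : v = -(M *ᵥ (M *ᵥ q)) - a^2 • q) (hq : v ⬝ᵥ q = -1) :
    border M v *ᵥ (snoc (M *ᵥ q) 1 : Vc (m+1)) = -a • (snoc (a • q) 0 : Vc (m+1)) ∧
    border M v *ᵥ (snoc (a • q) 0 : Vc (m+1)) = a • (snoc (M *ᵥ q) 1 : Vc (m+1)) ∧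
    (0 < a → (snoc (a • q) 0 : Vc (m+1)) ≠ 0) := by
  have h0 : ∀ w : Vc m, w ⬝ᵥ (M *ᵥ w) = 0 := fun w => by
    have := skew_dot M hM w w
    rw [dotProduct_comm (M *ᵥ w)] at this; linarith
  refine ⟨?_, ?_, ?_⟩
  · rw [border_mulVec]
    ext i
    refine lastCases ?_ (fun i => ?_) i
    · have : v ⬝ᵥ (M *ᵥ q) = 0 := by
        rw [hv]
        simp only [sub_dotProduct, neg_dotProduct, smul_dotProduct, h0, dotProduct_comm (M *ᵥ (M *ᵥ q))]
        simp
      simp [this]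
    · simp [hv]; ring
  · rw [border_mulVec]
    ext i
    refine lastCases ?_ (fun i => ?_) i
    · simp [hq]
    · simp [mulVec_smul]
  · intro ha h
    have hq0 : q = 0 := by
      ext i
      have := congrFun h i.castSucc
      simpa [ha.ne'] using this
    rw [hq0] at hq; simp at hq

lemma Dmat_mulVec_sq (a : Vc n) (q : Vz n) :
    Dmat a *ᵥ (Dmat a *ᵥ q) = fun i => -(a ((e2 n).symm i).1)^2 * q i := by
  have key : ∀ (w : Vz n) j, (Dmat a *ᵥ w) (e2 n (j, 0)) = a j * w (e2 n (j, 1)) ∧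
      (Dmat a *ᵥ w) (e2 n (j, 1)) = -a j * w (e2 n (j, 0)) := fun w j => by
    simp only [mulVec, dotProduct]
    rw [sum_e2, sum_e2]
    simp [Dmat_e2]
  ext i
  obtain ⟨⟨i, b⟩, rfl⟩ := (e2 n).surjective i
  fin_cases b
  · simp only [zero_eta, (key _ _).1, (key _ _).2, symm_apply_apply]; ring
  · simp only [mk_one, (key _ _).1, (key _ _).2, symm_apply_apply]; ring

lemma border_zero_mulVec_sq (a : Vc n) (q : Vz n) (t : ℝ) :
    border (Dmat a) 0 *ᵥ (border (Dmat a) 0 *ᵥ (snoc q t : Vc (2*n+1))) =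
     (snoc (fun i => -(a ((e2 n).symm i).1)^2 * q i) 0 : Vc (2*n+1)) := by
  rw [border_mulVec, border_mulVec]
  simp only [smul_zero, add_zero, Dmat_mulVec_sq]
  simp

lemma diag1 (a b : Vc n) (hb : ∀ j, 0 < b j) (hbi : Function.Injective b)
    (hab : ∀ i j, b i ^ 2 ≠ a j ^ 2) (v : Vz n)
    (hs : ∀ k, ∑ j, (v (e2 n (j,0))^2 + v (e2 n (j,1))^2) / (b k ^2 - a j ^2) = 1) :
    ∃ k ∈ orthogonalGroup (Fin (2*n+1)) ℝ,
      k * border (Dmat a) v * kᵀ = border (Dmat b) 0 := by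
  let q : Fin n → Vz n := fun k i => v i / (a ((e2 n).symm i).1 ^2 - b k ^2)
  have key := fun k => eig_border (Dmat a) (Dmat_transpose a) v (q k) (b k) (by
      rw [Dmat_mulVec_sq]
      ext i
      have : a ((e2 n).symm i).1 ^2 - b k ^2 ≠ 0 := sub_ne_zero.2 (hab _ _).symm
      simp [q]; field_simp) (by
      rw [dotProduct, sum_e2, ← hs k, ← sum_neg_distrib]
      refine Finset.sum_congr rfl fun j _ => ?_
      have : a j ^2 - b k ^2 ≠ 0 := sub_ne_zero.2 (hab _ _).symm
      have : b k ^2 - a j ^2 ≠ 0 := sub_ne_zero.2 (hab _ _)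
      simp [q]; field_simp; ring)
  exact orth_odd _ (border_transpose _ _ (Dmat_transpose a)) b hb hbi _ _
    (fun k => (key k).1) (fun k => (key k).2.1) (fun k => (key k).2.2 (hb k))

lemma diag2 (b : Vc n) (a : Vc (n+1)) (ha : ∀ j, 0 < a j)
    (hai : Function.Injective a)
    (hab : ∀ i j, a i ^ 2 ≠ b j ^ 2) (u : Vc (2*n+1))
    (hs : ∀ k, u (last _)^2 / a k ^2 +
      ∑ j, (u (e2 n (j,0)).castSucc^2 + u (e2 n (j,1)).castSucc^2) / (a k ^2 - b j ^2) = 1) :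
    ∃ k ∈ orthogonalGroup (Fz (n+1)) ℝ,
      k * (border (border (Dmat b) 0) u : Matrix (Fz (n+1)) (Fz (n+1)) ℝ) * kᵀ = Dmat a := by
  let q : Fin (n+1) → Vc (2*n+1) := fun k => snoc
    (fun i : Fz n => u i.castSucc / (b ((e2 n).symm i).1 ^2 - a k ^2)) (-u (last _) / a k ^2)
  have hb0 : (border (Dmat b) 0)ᵀ = -border (Dmat b) 0 := border_transpose _ _ (Dmat_transpose b)
  have key := fun k => eig_border (border (Dmat b) 0) hb0 u (q k) (a k) (by
      simp only [q]
      rw [border_zero_mulVec_sq]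
      ext i
      refine lastCases ?_ (fun i => ?_) i
      · have := (ha k).ne'
        simp; field_simp
      · have : b ((e2 n).symm i).1 ^2 - a k ^2 ≠ 0 := sub_ne_zero.2 (hab _ _).symm
        simp; field_simp) (by
      rw [dotProduct, sum_univ_castSucc, sum_e2, ← hs k, neg_add_rev, ← sum_neg_distrib]
      congr 1
      · refine Finset.sum_congr rfl fun j _ => ?_
        have : b j ^2 - a k ^2 ≠ 0 := sub_ne_zero.2 (hab _ _).symm
        have : a k ^2 - b j ^2 ≠ 0 := sub_ne_zero.2 (hab _ _)
        simp [q]; field_simp; ring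
      · simp [q]; ring)
  exact orth_even (n := n+1) _ (border_transpose _ _ hb0) a ha hai _ _
    (fun k => (key k).1) (fun k => (key k).2.1) (fun k => (key k).2.2 (ha k))

lemma vdm_eq_det {R : Type*} [CommRing R] (x : Fin m → R) :
    vdm x = (vandermonde x).det := by
  rw [det_vandermonde, vdm, prod_filter, ← univ_product_univ,
    prod_product]
  refine prod_congr rfl fun i _ => ?_
  rw [← prod_filter]
  refine prod_congr ?_ fun _ _ => rfl
  ext; simp

lemma vdm_pos {x : Vc m} (hx : StrictMono x) : 0 < vdm x := by
  refine prod_pos fun p hp => ?_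
  simp at hp
  exact sub_pos.2 (hx hp)

lemma prod_erase_abs (x : Vc m) :
    |∏ k, ∏ i ∈ Finset.univ.erase k, (x k - x i)| = (vdm x)^2 := by
  have h1 : ∏ k, ∏ i ∈ Finset.univ.erase k, |x k - x i| =
      ∏ p : Fin m × Fin m, if p.1 ≠ p.2 then |x p.1 - x p.2| else 1 := by
    rw [← univ_product_univ, prod_product]
    refine prod_congr rfl fun i _ => ?_
    rw [← prod_filter]
    refine prod_congr ?_ fun _ _ => rfl
    ext; simp [eq_comm]
  have h2 : ∏ p : Fin m × Fin m, (if p.1 ≠ p.2 then |x p.1 - x p.2| else 1) =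
      (∏ p : Fin m × Fin m, if p.1 < p.2 then |x p.1 - x p.2| else 1) *
      (∏ p : Fin m × Fin m, if p.2 < p.1 then |x p.1 - x p.2| else 1) := by
    rw [← prod_mul_distrib]
    refine prod_congr rfl fun p _ => ?_
    rcases lt_trichotomy p.1 p.2 with h | h | h
    · simp [h, h.ne, h.le]
    · simp [h]
    · simp [h, h.ne', h.le]
  have h3 : (∏ p : Fin m × Fin m, if p.2 < p.1 then |x p.1 - x p.2| else 1) =
      ∏ p : Fin m × Fin m, if p.1 < p.2 then |x p.1 - x p.2| else 1 := by
    rw [← (prodComm (Fin m) (Fin m)).prod_comp]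
    refine prod_congr rfl fun p _ => ?_
    simp [abs_sub_comm]
  simp only [abs_prod]
  rw [h1, h2, h3, ← sq, ← prod_filter, ← sq_abs (vdm x), vdm, abs_prod]
  simp only [abs_sub_comm]

lemma det_lagr (α β : Vc m) (hβ : vdm β ≠ 0) :
    |(of fun j k : Fin m => ∏ i ∈ Finset.univ.erase k, (α j - β i)).det| = |vdm α| * |vdm β| := by
  let p : Fin m → Polynomial ℝ := fun k => Lagrange.nodal (Finset.univ.erase k) β
  let C : Matrix (Fin m) (Fin m) ℝ := of fun l k => (p k).coeff l
  have hev : ∀ γ : Vc m, (of fun j k : Fin m => ∏ i ∈ Finset.univ.erase k, (γ j - β i)) =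
      vandermonde γ * C := fun γ => by
    ext j k
    rw [Matrix.mul_apply, of_apply, ← Lagrange.eval_nodal,
      Polynomial.eval_eq_sum_range' (n := m), ← sum_univ_eq_sum_range]
    · refine Finset.sum_congr rfl fun i _ => ?_
      simp [C, p, mul_comm]
    · rw [Lagrange.natDegree_nodal]
      have := k.isLt
      simp; omega
  have h1 : (of fun j k : Fin m => ∏ i ∈ Finset.univ.erase k, (β j - β i)).det =
      ∏ k, ∏ i ∈ Finset.univ.erase k, (β k - β i) := by
    have : (of fun j k : Fin m => ∏ i ∈ Finset.univ.erase k, (β j - β i)) =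
      Matrix.diagonal fun k => ∏ i ∈ Finset.univ.erase k, (β k - β i) := by
      ext j k
      by_cases hjk : j = k
      · subst hjk; simp
      · simp only [of_apply, diagonal_apply_ne _ hjk]
        exact prod_eq_zero (i := j) (by simp [hjk]) (by simp)
    rw [this, det_diagonal]
  rw [hev β, det_mul, ← vdm_eq_det] at h1
  have h2 := prod_erase_abs β
  rw [← h1, abs_mul, ← sq_abs (vdm β), sq] at h2
  have h3 : |C.det| = |vdm β| := mul_left_cancel₀ (abs_ne_zero.2 hβ) h2
  rw [hev α, det_mul, ← vdm_eq_det, abs_mul, h3]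

def Sc {k : ℕ} (α : Vc k) (a : Vc k) (j : Fin k) : ℝ :=
  -(∏ i, (α j - a i ^ 2)) / ∏ i ∈ Finset.univ.erase j, (α j - α i)

def Reg {k : ℕ} (α : Vc k) : Set Vc k :=
  {a | ∀ j, 0 < a j ∧ α j < a j ^ 2 ∧ ∀ i, j < i → a j ^ 2 < α i}

lemma Reg_meas {k : ℕ} (α : Vc k) : MeasurableSet (Reg α) := by
  unfold Reg
  simp only [setOf_forall, setOf_and]
  refine MeasurableSet.iInter fun j => ?_
  refine (measurableSet_lt (by fun_prop) (by fun_prop)).inter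
    ((measurableSet_lt (by fun_prop) (by fun_prop)).inter ?_)
  refine MeasurableSet.iInter fun i => MeasurableSet.iInter fun _ => ?_
  exact measurableSet_lt (by fun_prop) (by fun_prop)

lemma Reg_mono {k : ℕ} {α a : Vc k} (h : a ∈ Reg α) : StrictMono a := fun i j hij => by
  have h1 := (h i).2.2 j hij
  have h2 := (h j).2.1
  have h3 := (h i).1
  have h4 := (h j).1
  nlinarith

lemma sq_mono {k : ℕ} {a : Vc k} (ha : StrictMono a) (hp : ∀ j, 0 < a j) :
    StrictMono fun j => a j ^ 2 := fun i j hij => by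
  have := ha hij; have := hp i
  show a i ^ 2 < a j ^ 2
  nlinarith

lemma Sc_pos {k : ℕ} {α a : Vc k} (hα : StrictMono α) (h : a ∈ Reg α) (j : Fin k) :
    0 < Sc α a j := by
  have : Sc α a j = (a j ^ 2 - α j) * ∏ i ∈ Finset.univ.erase j, ((α j - a i ^ 2) / (α j - α i)) := by
    rw [Sc, ← mul_prod_erase _ _ (Finset.mem_univ j), Finset.prod_div_distrib]; ring
  rw [this]
  refine mul_pos (sub_pos.2 (h j).2.1) (prod_pos fun i hi => ?_)
  rcases lt_or_gt_of_ne (ne_of_mem_erase hi) with hij | hij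
  · exact div_pos (sub_pos.2 ((h i).2.2 j hij)) (sub_pos.2 (hα hij))
  · have h1 := hα hij
    have h2 := (h i).2.1
    exact div_pos_of_neg_of_neg (by linarith) (by linarith)

lemma agree_lemma {k : ℕ} (α β s γ : Vc k) (hγ : Function.Injective γ)
    (h : ∀ l, ∏ i, (γ l - β i) = ∏ i, (γ l - α i) - ∑ j, s j * ∏ i ∈ Finset.univ.erase j, (γ l - α i))
    (x : ℝ) : ∏ i, (x - β i) = ∏ i, (x - α i) - ∑ j, s j * ∏ i ∈ Finset.univ.erase j, (x - α i) := by
  classical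
  let f : Polynomial ℝ := Lagrange.nodal Finset.univ β
  let g : Polynomial ℝ := Lagrange.nodal Finset.univ α
  let r : Polynomial ℝ := ∑ j, Polynomial.C (s j) * Lagrange.nodal (Finset.univ.erase j) α
  have hr : r.degree < k := by
    rw [Polynomial.degree_lt_iff_coeff_zero] 
    intro m hm
    simp only [r, Polynomial.finset_sum_coeff]
    refine Finset.sum_eq_zero fun j _ => ?_
    rw [Polynomial.coeff_C_mul, Polynomial.coeff_eq_zero_of_natDegree_lt, mul_zero]
    rw [Lagrange.natDegree_nodal]
    have := j.isLt
    simp; omega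
  have hev : ∀ y, f.eval y = ∏ i, (y - β i) := fun y => Lagrange.eval_nodal
  have hev2 : ∀ y, (g - r).eval y = ∏ i, (y - α i) - ∑ j, s j * ∏ i ∈ Finset.univ.erase j, (y - α i) :=
    fun y => by
      simp [g, r, Lagrange.eval_nodal, Polynomial.eval_finset_sum]
  have key : f = g - r := by
    refine Polynomial.eq_of_degree_sub_lt_of_eval_finset_eq (Finset.univ.image γ) ?_ ?_
    · rw [Finset.card_image_of_injective _ hγ, card_univ, Fintype.card_fin, ← sub_add]
      refine (Polynomial.degree_add_le _ _).trans_lt (max_lt ?_ hr)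
      have : (f - g).degree < f.degree := Polynomial.degree_sub_lt (by simp [f, g, Lagrange.degree_nodal])
        (Lagrange.nodal_monic.ne_zero) (by rw [Lagrange.nodal_monic.leadingCoeff, Lagrange.nodal_monic.leadingCoeff])
      simpa [f, Lagrange.degree_nodal] using this
    · intro y hy
      obtain ⟨l, -, rfl⟩ := Finset.mem_image.1 hy
      rw [hev, hev2, h]
  rw [← hev, ← hev2, key]

lemma prod_erase_ne {k : ℕ} {α : Vc k} (hα : Function.Injective α) (j : Fin k) :
    ∏ i ∈ Finset.univ.erase j, (α j - α i) ≠ 0 :=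
  prod_ne_zero_iff.2 fun i hi => sub_ne_zero.2 fun h => (ne_of_mem_erase hi) (hα h).symm

lemma sum_erase_at {k : ℕ} (α s : Vc k) (l : Fin k) :
    ∏ i, (α l - α i) - ∑ j, s j * ∏ i ∈ Finset.univ.erase j, (α l - α i) =
    - (s l * ∏ i ∈ Finset.univ.erase l, (α l - α i)) := by
  rw [prod_eq_zero (Finset.mem_univ l) (by simp), zero_sub, sum_eq_single l]
  · intro j _ hj
    rw [prod_eq_zero (i := l) (by simp [hj.symm]) (by simp), mul_zero]
  · simp

lemma Sc_poly {k : ℕ} {α : Vc k} (hα : Function.Injective α) (a : Vc k) (x : ℝ) :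
    ∏ i, (x - a i ^ 2) = ∏ i, (x - α i) - ∑ j, Sc α a j * ∏ i ∈ Finset.univ.erase j, (x - α i) := by
  refine agree_lemma α (fun i => a i ^2) (Sc α a) α hα (fun l => ?_) x
  rw [sum_erase_at, Sc, div_mul_cancel₀ _ (prod_erase_ne hα l), neg_neg]

lemma Sc_sum {k : ℕ} {α : Vc k} (hα : Function.Injective α) (a : Vc k)
    (hne : ∀ i j, a i ^ 2 ≠ α j) (l : Fin k) : ∑ j, Sc α a j / (a l ^ 2 - α j) = 1 := by
  have h := Sc_poly hα a (a l ^ 2)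
  rw [prod_eq_zero (Finset.mem_univ l) (by simp)] at h
  have hP : ∏ i, (a l ^2 - α i) ≠ 0 := prod_ne_zero_iff.2 fun i _ => sub_ne_zero.2 (hne l i)
  have h2 : ∑ j, Sc α a j / (a l ^ 2 - α j) =
      (∑ j, Sc α a j * ∏ i ∈ Finset.univ.erase j, (a l ^ 2 - α i)) / ∏ i, (a l ^2 - α i) := by
    rw [sum_div]
    refine Finset.sum_congr rfl fun j _ => ?_
    rw [← mul_prod_erase _ _ (Finset.mem_univ j)]
    have h3 : ∏ i ∈ Finset.univ.erase j, (a l ^ 2 - α i) ≠ 0 :=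
      prod_ne_zero_iff.2 fun i _ => sub_ne_zero.2 (hne l i)
    have h4 := sub_ne_zero.2 (hne l j)
    field_simp
  rw [h2, div_eq_one_iff_eq hP]
  linarith

lemma poly_inj {k : ℕ} {a b : Vc k} (ha : StrictMono a) (hb : StrictMono b)
    (ha0 : ∀ j, 0 < a j) (hb0 : ∀ j, 0 < b j)
    (h : ∀ x : ℝ, ∏ i, (x - a i ^2) = ∏ i, (x - b i ^2)) : a = b := by
  rw [← StrictMono.range_inj ha hb]
  have aux : ∀ {a b : Vc k}, (∀ j, 0 < a j) → (∀ j, 0 < b j) →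
      (∀ x : ℝ, ∏ i, (x - a i ^2) = ∏ i, (x - b i ^2)) → Set.range a ⊆ Set.range b := by
    rintro a b ha0 hb0 h _ ⟨j, rfl⟩
    have := h (a j ^ 2)
    rw [prod_eq_zero (Finset.mem_univ j) (by simp)] at this
    obtain ⟨i, -, hi⟩ := prod_eq_zero_iff.1 this.symm
    refine ⟨i, ?_⟩
    have := ha0 j; have := hb0 i
    nlinarith
  exact Set.Subset.antisymm (aux ha0 hb0 h) (aux hb0 ha0 fun x => (h x).symm)

lemma Sc_injOn {k : ℕ} {α : Vc k} (hα : StrictMono α) : InjOn (Sc α) (Reg α) := by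
  intro a ha b hb hab
  refine poly_inj (Reg_mono ha) (Reg_mono hb) (fun j => (ha j).1) (fun j => (hb j).1) fun x => ?_
  rw [Sc_poly hα.injective, Sc_poly hα.injective, hab]

lemma ivt_neg {f : ℝ → ℝ} (hf : Continuous f) {x y : ℝ} (hxy : x < y) (h : f x * f y < 0) :
    ∃ z, x < z ∧ z < y ∧ f z = 0 := by
  rcases mul_neg_iff.1 h with ⟨h1, h2⟩ | ⟨h1, h2⟩
  · obtain ⟨z, hz, h0⟩ := intermediate_value_Ioo' hxy.le hf.continuousOn ⟨h2, h1⟩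
    exact ⟨z, hz.1, hz.2, h0⟩
  · obtain ⟨z, hz, h0⟩ := intermediate_value_Ioo hxy.le hf.continuousOn ⟨h1, h2⟩
    exact ⟨z, hz.1, hz.2, h0⟩

lemma Sc_surj {k : ℕ} {α : Vc k} (hα : StrictMono α) (h0 : ∀ j, 0 ≤ α j) (s : Vc k)
    (hs : ∀ j, 0 < s j) : ∃ a ∈ Reg α, Sc α a = s := by
  let Q : ℝ → ℝ := fun x => ∏ i, (x - α i) - ∑ j, s j * ∏ i ∈ Finset.univ.erase j, (x - α i)
  have hQc : Continuous Q := by fun_prop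
  have hQα : ∀ l, Q (α l) = - (s l * ∏ i ∈ Finset.univ.erase l, (α l - α i)) := sum_erase_at α s
  have hroot : ∀ j, ∃ z, α j < z ∧ (∀ i, j < i → z < α i) ∧ Q z = 0 := by
    intro j
    by_cases hj : j.val + 1 < k
    · let j' : Fin k := ⟨j.val + 1, hj⟩
      have hjj : j < j' := by simp [Fin.lt_def, j']
      obtain ⟨z, h1, h2, h3⟩ := ivt_neg hQc (hα hjj) (by
        rw [hQα, hQα]
        have e1 : ∏ i ∈ Finset.univ.erase j, (α j - α i) =
            (α j - α j') * ∏ i ∈ (Finset.univ.erase j).erase j', (α j - α i) :=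
          (mul_prod_erase _ _ (by simp [hjj.ne'])).symm
        have e2 : ∏ i ∈ Finset.univ.erase j', (α j' - α i) =
            (α j' - α j) * ∏ i ∈ (Finset.univ.erase j).erase j', (α j' - α i) := by
          rw [erase_right_comm]
          exact (mul_prod_erase _ _ (by simp [hjj.ne])).symm
        have e3 : 0 < (∏ i ∈ (Finset.univ.erase j).erase j', (α j - α i)) *
            ∏ i ∈ (Finset.univ.erase j).erase j', (α j' - α i) := by
          rw [← prod_mul_distrib]
          refine prod_pos fun i hi => ?_
          simp only [mem_erase, Finset.mem_univ, and_true] at hi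
          rcases lt_or_gt_of_ne hi.2 with h | h
          · exact mul_pos (sub_pos.2 (hα h)) (sub_pos.2 (hα (h.trans hjj)))
          · have : j' < i := lt_of_le_of_ne (by
              have : j.val < i.val := h
              show j.val + 1 ≤ i.val
              omega) hi.1.symm
            exact mul_pos_of_neg_of_neg (sub_neg.2 (hα h)) (sub_neg.2 (hα this))
        rw [e1, e2]
        have h5 := sub_pos.2 (hα hjj)
        have h6 := mul_pos (mul_pos (hs j) (hs j')) (mul_pos (mul_pos h5 h5) e3)
        nlinarith)
      refine ⟨z, h1, fun i hi => h2.trans_le (hα.monotone ?_), h3⟩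
      have : j.val < i.val := hi
      show j.val + 1 ≤ i.val
      omega
    · have hlast : ∀ i, i ≤ j := fun i => by
        have := i.isLt; show i.val ≤ j.val; omega
      let B : ℝ := α j + ∑ i, s i + 1
      have hS : 0 ≤ ∑ i, s i := sum_nonneg fun i _ => (hs i).le
      have hBi : ∀ i, (∑ i, s i) + 1 ≤ B - α i := fun i => by
        have := hα.monotone (hlast i); simp only [B]; linarith
      have hBpos : ∀ i, 0 < B - α i := fun i => by have := hBi i; linarith
      obtain ⟨z, h1, h2, h3⟩ := ivt_neg hQc (x := α j) (y := B) (by simp only [B]; linarith) (by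
        have e1 : Q (α j) < 0 := by
          rw [hQα]
          have : 0 < ∏ i ∈ Finset.univ.erase j, (α j - α i) := prod_pos fun i hi =>
            sub_pos.2 (hα (lt_of_le_of_ne (hlast i) (ne_of_mem_erase hi)))
          have := mul_pos (hs j) this
          linarith
        have e2 : 0 < Q B := by
          have hP : 0 < ∏ i, (B - α i) := prod_pos fun i _ => hBpos i
          have : ∑ i, s i * ∏ l ∈ Finset.univ.erase i, (B - α l) ≤
              (∑ i, s i) * ((∏ i, (B - α i)) / ((∑ i, s i) + 1)) := by
            rw [sum_mul]
            refine sum_le_sum fun i _ => mul_le_mul_of_nonneg_left ?_ (hs i).le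
            rw [le_div_iff₀ (by linarith), ← mul_prod_erase _ _ (Finset.mem_univ i), mul_comm]
            exact mul_le_mul_of_nonneg_right (hBi i) (prod_nonneg fun l _ => (hBpos l).le)
          have h7 : (∑ i, s i) * ((∏ i, (B - α i)) / ((∑ i, s i) + 1)) < ∏ i, (B - α i) := by
            rw [← mul_div_assoc, div_lt_iff₀ (by linarith)]; nlinarith
          simp only [Q]; linarith
        exact mul_neg_of_neg_of_pos e1 e2)
      exact ⟨z, h1, fun i hi => absurd hi (hlast i).not_gt, h3⟩
  choose β h1 h2 h3 using hroot
  have hβ0 : ∀ j, 0 < β j := fun j => (h0 j).trans_lt (h1 j)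
  have hβm : StrictMono β := fun i j hij => (h2 i j hij).trans (h1 j)
  have hsq : ∀ j, Real.sqrt (β j) ^ 2 = β j := fun j => Real.sq_sqrt (hβ0 j).le
  refine ⟨fun j => Real.sqrt (β j), fun j => ⟨Real.sqrt_pos.2 (hβ0 j), ?_, fun i hi => ?_⟩, ?_⟩
  · rw [hsq]; exact h1 j
  · rw [hsq]; exact h2 j i hi
  · have key := agree_lemma α β s β hβm.injective (fun l => by
      rw [prod_eq_zero (Finset.mem_univ l) (by simp)]
      exact (h3 l).symm)
    ext j
    rw [Sc]
    simp only [hsq]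
    rw [key, sum_erase_at, neg_neg, mul_div_cancel_right₀ _ (prod_erase_ne hα.injective j)]

def ScJ {k : ℕ} (α a : Vc k) : Matrix (Fin k) (Fin k) ℝ := of fun j l =>
  (∏ i ∈ Finset.univ.erase j, (α j - α i))⁻¹ *
    ((2 * a l) * ∏ i ∈ Finset.univ.erase l, (α j - a i ^ 2))

lemma Sc_deriv {k : ℕ} (α a : Vc k) :
    HasFDerivAt (Sc α) (LinearMap.toContinuousLinearMap (toLin' (ScJ α a))) a := by
  rw [hasFDerivAt_pi']
  intro j
  have h1 : HasFDerivAt (fun x : Vc k => ∏ i, (α j - x i ^ 2)) _ a :=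
    HasFDerivAt.finset_prod (u := Finset.univ) (g := fun i (x : Vc k) => α j - x i ^ 2)
      (g' := fun i => -((2 * a i) • ContinuousLinearMap.proj (R := ℝ) (φ := fun _ : Fin k => ℝ) i)) (fun i _ => by
        have := ((ContinuousLinearMap.proj (R := ℝ) (φ := fun _ : Fin k => ℝ) i).hasFDerivAt (x := a)).pow 2
        exact (this.const_sub (α j)).congr_fderiv (by ext l; simp))
  have h2 := h1.const_mul (-(∏ i ∈ Finset.univ.erase j, (α j - α i))⁻¹)
  have h3 : (fun x => Sc α x j) = fun x : Vc k =>
     (-(∏ i ∈ Finset.univ.erase j, (α j - α i))⁻¹) * ∏ i, (α j - x i ^ 2) := by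
    ext x; simp only [Sc]; ring
  rw [h3]
  refine h2.congr_fderiv ?_
  refine ContinuousLinearMap.ext fun l => ?_
  simp only [ScJ, ContinuousLinearMap.coe_comp', Function.comp_apply, ContinuousLinearMap.smul_apply,
    ContinuousLinearMap.sum_apply, ContinuousLinearMap.proj_apply, ContinuousLinearMap.neg_apply,
    LinearMap.coe_toContinuousLinearMap', toLin'_apply, mulVec, dotProduct,
    of_apply, smul_eq_mul, mul_sum]
  refine Finset.sum_congr rfl fun i _ => ?_
  ring

lemma ScJ_det {k : ℕ} {α a : Vc k} (hα : StrictMono α) (h : a ∈ Reg α) :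
    |(ScJ α a).det| = (∏ j, 2 * a j) * (vdm (fun j => a j ^ 2) / vdm α) := by
  have hv := vdm_pos hα
  have hva := vdm_pos (sq_mono (Reg_mono h) fun j => (h j).1)
  have h1 : ScJ α a = of fun j l => (∏ i ∈ Finset.univ.erase j, (α j - α i))⁻¹ *
      (of fun j l => (2 * a l) * 
        (of fun j k : Fin k => ∏ i ∈ Finset.univ.erase k, (α j - a i ^ 2)) j l) j l := rfl
  rw [h1, det_mul_column, det_mul_row, abs_mul, abs_mul,
    det_lagr α (fun i => a i ^2) hva.ne', Finset.prod_inv_distrib, abs_inv, prod_erase_abs,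
    abs_of_pos hv, abs_of_pos hva, abs_of_nonneg (prod_nonneg fun i _ => by have := (h i).1; positivity)]
  field_simp

def posO (k : ℕ) : Set Vc k := {a | ∀ j, 0 < a j}

lemma rootCoV {k : ℕ} {α : Vc k} (hα : StrictMono α) (h0 : ∀ j, 0 ≤ α j)
    (G : Vc k → ENNReal) :
    ∫⁻ s in posO k, G s = ∫⁻ a in Reg α,
      oR ((∏ j, 2 * a j) * (vdm (fun j => a j ^ 2) / vdm α)) * G (Sc α a) := by
  have him : Sc α '' Reg α = posO k := by
    ext s
    constructor
    · rintro ⟨a, ha, rfl⟩ j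
      exact Sc_pos hα ha j
    · intro hs
      obtain ⟨a, ha, h⟩ := Sc_surj hα h0 s hs
      exact ⟨a, ha, h⟩
  rw [← him, lintegral_image_eq_lintegral_abs_det_fderiv_mul volume (Reg_meas α)
    (fun x _ => (Sc_deriv α x).hasFDerivWithinAt) (Sc_injOn hα)]
  refine setLIntegral_congr_fun (Reg_meas α) fun a ha => ?_
  congr 2
  rw [← ScJ_det hα ha, ContinuousLinearMap.det]
  simp

lemma mp_reindex {α β : Type*} [Fintype α] [Fintype β] (e : α ≃ β) :
    MeasurePreserving (fun (x : β → ℝ) (i : α) => x (e i)) := by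
  have hm : Measurable (fun (x : β → ℝ) (i : α) => x (e i)) :=
    measurable_pi_lambda _ fun i => measurable_pi_apply _
  refine ⟨hm, ?_⟩
  refine (pi_eq fun s hs => ?_).symm
  rw [Measure.map_apply hm (MeasurableSet.univ_pi hs)]
  have : (fun (x : β → ℝ) (i : α) => x (e i)) ⁻¹' (Set.univ.pi s) =
      Set.univ.pi fun j => s (e.symm j) := by
    ext x
    simp only [Set.mem_preimage, mem_univ_pi]
    exact ⟨fun h j => by simpa using h (e.symm j), fun h i => by simpa using h (e i)⟩
  rw [this, volume_pi_pi, ← e.symm.prod_comp]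

lemma mp_uncurry {α β : Type*} [Fintype α] [Fintype β] :
    MeasurePreserving (fun (x : α → β → ℝ) (p : α × β) => x p.1 p.2) := by
  have hm : Measurable (fun (x : α → β → ℝ) (p : α × β) => x p.1 p.2) := by fun_prop
  refine ⟨hm, ?_⟩
  refine (pi_eq fun s hs => ?_).symm
  rw [Measure.map_apply hm (MeasurableSet.univ_pi hs)]
  have : (fun (x : α → β → ℝ) (p : α × β) => x p.1 p.2) ⁻¹' (Set.univ.pi s) =
      Set.univ.pi fun i => Set.univ.pi fun j => s (i, j) := by
    ext x; simp
  rw [this, volume_pi_pi, Fintype.prod_prod_type]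
  simp_rw [volume_pi_pi]

lemma mp_curry {α β : Type*} [Fintype α] [Fintype β] :
    MeasurePreserving (fun (y : α × β → ℝ) (i : α) (j : β) => y (i, j)) := by
  let e : (α → β → ℝ) ≃ᵐ (α × β → ℝ) :=
    { toFun := fun x p => x p.1 p.2
      invFun := fun y i j => y (i, j)
      left_inv := fun _ => rfl
      right_inv := fun _ => rfl
      measurable_toFun := by
        show Measurable (fun (x : α → β → ℝ) (p : α × β) => x p.1 p.2); fun_prop
      measurable_invFun := by
        show Measurable (fun (y : α × β → ℝ) (i : α) (j : β) => y (i, j)); fun_prop }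
  exact MeasurePreserving.symm e mp_uncurry

lemma lint_snoc (f : Vc (n+1) → ENNReal) (hf : Measurable f) :
    ∫⁻ u, f u = ∫⁻ x : ℝ, ∫⁻ w : Vc n, f (snoc w x) := by
  have h := (volume_preserving_piFinSuccAbove (fun _ : Fin (n+1) => ℝ) (last n)).symm
  rw [← h.lintegral_comp hf, volume_eq_prod]
  refine (lintegral_prod _ (hf.comp h.measurable).aemeasurable).trans ?_
  simp [MeasurableEquiv.piFinSuccAbove, snocEquiv, insertNthEquiv, insertNth_last']

lemma lint_cons (f : Vc (n+1) → ENNReal) (hf : Measurable f) :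
    ∫⁻ u, f u = ∫⁻ x : ℝ, ∫⁻ w : Vc n, f (Fin.cons x w) := by
  have h := (volume_preserving_piFinSuccAbove (fun _ : Fin (n+1) => ℝ) 0).symm
  rw [← h.lintegral_comp hf, volume_eq_prod]
  refine (lintegral_prod _ (hf.comp h.measurable).aemeasurable).trans ?_
  simp [MeasurableEquiv.piFinSuccAbove, insertNthEquiv]

lemma lint_sq_pos (G : ℝ → ENNReal) :
    ∫⁻ x in Set.Ioi (0:ℝ), oR (2 * x) * G (x^2) = ∫⁻ s in Set.Ioi (0:ℝ), G s := by
  have him : (fun x : ℝ => x^2) '' Set.Ioi 0 = Set.Ioi 0 := by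
    ext s; constructor
    · rintro ⟨x, hx, rfl⟩; exact pow_pos (show (0:ℝ) < x from hx) 2
    · intro hs; exact ⟨Real.sqrt s, Real.sqrt_pos.2 hs, Real.sq_sqrt (le_of_lt hs)⟩
  have h := lintegral_image_eq_lintegral_abs_deriv_mul (f := fun x : ℝ => x^2) measurableSet_Ioi
    (f' := fun x => 2 * x)
    (fun x (_ : x ∈ Set.Ioi 0) => by simpa using (hasDerivAt_pow 2 x).hasDerivWithinAt)
    (fun x hx y hy h => by
      have h1 : 0 < x := hx
      have h2 : 0 < y := hy
      have : x^2 = y^2 := h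
      nlinarith) G
  rw [him] at h
  rw [h]
  refine setLIntegral_congr_fun measurableSet_Ioi fun x hx => ?_
  have h1 : (0:ℝ) < x := hx
  rw [abs_of_pos (by positivity)]

lemma lint_sq (G : ℝ → ENNReal) :
    ∫⁻ x : ℝ, G (x^2) = ∫⁻ s in Set.Ioi (0:ℝ), oR ((Real.sqrt s)⁻¹) * G s := by
  have h1 : ∫⁻ x : ℝ, G (x^2) = 2 * ∫⁻ x in Set.Ioi (0:ℝ), G (x^2) := by
    rw [← lintegral_add_compl _ (measurableSet_Ioi (a := (0:ℝ))), two_mul]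
    congr 1
    rw [compl_Ioi, ← setLIntegral_congr (Iio_ae_eq_Iic (a := (0:ℝ)))]
    have := (measurePreserving_neg (volume : Measure ℝ)).setLIntegral_comp_preimage_emb
      (MeasurableEquiv.neg ℝ).measurableEmbedding (fun x => G (x^2)) (Set.Ioi 0)
    rw [← this]
    simp
  rw [h1]
  refine Eq.trans ?_ (lint_sq_pos fun s => oR ((Real.sqrt s)⁻¹) * G s)
  rw [← lintegral_const_mul' _ _ (by simp)]
  refine setLIntegral_congr_fun measurableSet_Ioi fun x hx => ?_
  have h1 : (0:ℝ) < x := hx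
  rw [Real.sqrt_sq h1.le, ← mul_assoc, ← ENNReal.ofReal_mul (by positivity), mul_assoc,
    mul_inv_cancel₀ h1.ne']
  simp

lemma lint_polar (G : ℝ → ENNReal) (hG : Measurable G) :
    ∫⁻ p : Vc 2, G (p 0 ^ 2 + p 1 ^ 2) =
      oR Real.pi * ∫⁻ s in Set.Ioi (0:ℝ), G s := by
  have h := (volume_preserving_finTwoArrow ℝ).symm
  rw [← h.lintegral_comp (by fun_prop)]
  simp only [MeasurableEquiv.finTwoArrow, MeasurableEquiv.piFinTwo, piFinTwoEquiv]
  simp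
  rw [← lintegral_comp_polarCoord_symm, polarCoord_target, volume_eq_prod,
    ← prod_restrict, lintegral_prod _ (by
      simp only [polarCoord_symm_apply]; fun_prop)]
  rw [← lint_sq_pos G, ← lintegral_const_mul' _ _ (by simp)]
  refine setLIntegral_congr_fun measurableSet_Ioi fun r hr => ?_
  have h1 : (0:ℝ) < r := hr
  have h2 : ∀ θ, (r * Real.cos θ)^2 + (r * Real.sin θ)^2 = r^2 := fun θ => by
    have := Real.sin_sq_add_cos_sq θ
    nlinarith
  simp only [polarCoord_symm_apply, h2, lintegral_const, restrict_apply_univ, Real.volume_Ioo,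
    smul_eq_mul]
  rw [mul_comm, ← mul_assoc, ← mul_assoc, ← ENNReal.ofReal_mul (by linarith [Real.pi_pos]),
    ← ENNReal.ofReal_mul Real.pi_pos.le]
  congr 2; ring

def sv (v : Vz n) (j : Fin n) : ℝ := v (e2 n (j,0))^2 + v (e2 n (j,1))^2

lemma sv_meas : Measurable (sv (n := n)) := by unfold sv; fun_prop

lemma posO_eq (k : ℕ) : posO k = Set.univ.pi fun _ => Set.Ioi 0 := by ext; simp [posO]
lemma posO_meas (k : ℕ) : MeasurableSet (posO k) := by
  rw [posO_eq]; exact MeasurableSet.univ_pi fun _ => measurableSet_Ioi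

lemma map_sv (n : ℕ) : Measure.map (sv (n := n)) volume =
    (oR Real.pi)^n • (volume.restrict (posO n)) := by
  have h1 : MeasurePreserving (fun (v : Vz n) (i : Fin n) (b : Fin 2) => v (e2 n (i, b))) :=
    mp_curry.comp (mp_reindex (e2 n))
  have hm : Measurable (fun p : Vc 2 => p 0 ^ 2 + p 1 ^ 2) := by fun_prop
  have h2 : Measure.map (fun p : Vc 2 => p 0 ^ 2 + p 1 ^ 2) volume =
      oR Real.pi • (volume.restrict (Set.Ioi (0:ℝ))) := by
    refine ext_of_lintegral _ fun G hG => ?_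
    rw [lintegral_map hG hm, lint_polar G hG, lintegral_smul_measure, smul_eq_mul]
  have h3 : sv (n := n) = (fun (x : Fin n → Vc 2) (i : Fin n) => x i 0 ^2 + x i 1 ^2) ∘
      (fun (v : Vz n) (i : Fin n) (b : Fin 2) => v (e2 n (i, b))) := rfl
  rw [h3, ← Measure.map_map (by fun_prop) h1.measurable, h1.map_eq]
  haveI : SigmaFinite (oR Real.pi • (volume.restrict (Set.Ioi (0:ℝ)))) := by
    rw [ENNReal.ofReal]; exact inferInstanceAs (SigmaFinite (Real.toNNReal Real.pi • _))
  have h4 := pi_map_pi (ι := Fin n) (μ := fun _ => (volume : Measure Vc 2))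
    (f := fun _ (p : Vc 2) => p 0 ^ 2 + p 1 ^ 2) (hμ := fun _ => by rw [h2]; infer_instance)
    (fun _ => hm.aemeasurable)
  refine h4.trans ?_
  simp only [h2]
  refine pi_eq fun s hs => ?_
  rw [posO_eq, Measure.smul_apply, volume_pi, restrict_pi_pi, pi_pi]
  simp [prod_mul_distrib]

def KInv {β : Type*} (f : Matrix (Fin m) (Fin m) ℝ → β) : Prop :=
  ∀ X : Matrix (Fin m) (Fin m) ℝ, Xᵀ = -X → ∀ k ∈ orthogonalGroup (Fin m) ℝ,
    f (k * X * kᵀ) = f X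

lemma meas_mat {β : Type*} [MeasurableSpace β] {f : β → Matrix (Fin m) (Fin m) ℝ}
    (h : ∀ i j, Measurable fun x => f x i j) : Measurable f :=
  measurable_pi_lambda _ fun i => measurable_pi_lambda _ fun j => h i j

lemma meas_entry (i j : Fin m) : Measurable fun X : Matrix (Fin m) (Fin m) ℝ => X i j :=
  (measurable_pi_apply j).comp (measurable_pi_apply i)

lemma border_meas : Measurable fun p : Matrix (Fin m) (Fin m) ℝ × Vc m =>
    border p.1 p.2 := by
  refine meas_mat fun i j => ?_
  refine lastCases ?_ (fun i => ?_) i <;> refine lastCases ?_ (fun j => ?_) j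
  · simp
  · simp only [border_lc]; fun_prop
  · simp only [border_cl]; fun_prop
  · simp only [border_cc]; exact (meas_entry i j).comp measurable_fst

lemma Dmat_meas : Measurable (Dmat : Vc n → _) := by
  refine meas_mat fun i j => ?_
  obtain ⟨⟨i, b⟩, rfl⟩ := (e2 n).surjective i
  obtain ⟨⟨j, c⟩, rfl⟩ := (e2 n).surjective j
  simp only [Dmat_e2]
  split_ifs <;> fun_prop

def Ch (n : ℕ) : Set Vc n := {a | (∀ j, 0 < a j) ∧ StrictMono a}

lemma Ch_meas (n : ℕ) : MeasurableSet (Ch n) := by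
  unfold Ch StrictMono
  simp only [setOf_and, setOf_forall]
  refine (MeasurableSet.iInter fun j => measurableSet_lt (by fun_prop) (by fun_prop)).inter ?_
  exact MeasurableSet.iInter fun i => MeasurableSet.iInter fun j => MeasurableSet.iInter fun _ =>
    measurableSet_lt (by fun_prop) (by fun_prop)

def cv (s : Vc n) (i : Fz n) : ℝ :=
  if ((e2 n).symm i).2 = 0 then Real.sqrt (s ((e2 n).symm i).1) else 0

lemma sv_cv {s : Vc n} (hs : ∀ j, 0 ≤ s j) : sv (cv s) = s := by
  ext j; simp [sv, cv, Real.sq_sqrt (hs j)]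

lemma cv_meas : Measurable (cv (n := n)) := by
  refine measurable_pi_lambda _ fun i => ?_
  unfold cv; split_ifs <;> fun_prop

lemma step1 (G : Matrix (Fin (2*n+1)) (Fin (2*n+1)) ℝ → ENNReal) (hG : Measurable G)
    (hK : KInv G) {a : Vc n} (ha : a ∈ Ch n) :
    ∫⁻ v, G (border (Dmat a) v) = (oR Real.pi)^n *
      ∫⁻ b in Reg (fun j => a j ^ 2),
        oR ((∏ j, 2 * b j) * (vdm (fun j => b j ^ 2) / vdm (fun j => a j ^ 2))) *
          G (border (Dmat b) 0) := by
  have hα : StrictMono fun j => a j ^ 2 := sq_mono ha.2 ha.1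
  have key : ∀ b ∈ Reg (fun j => a j ^ 2), ∀ v : Vz n, sv v = Sc (fun j => a j ^ 2) b →
      G (border (Dmat a) v) = G (border (Dmat b) 0) := by
    intro b hb v hv
    have hne : ∀ i j, b i ^ 2 ≠ a j ^ 2 := fun i j h => by
      rcases lt_or_ge i j with hij | hij
      · exact ((hb i).2.2 j hij).ne h
      · exact ((hα.monotone hij).trans_lt (hb i).2.1).ne' h
    obtain ⟨k, hk, hkk⟩ := diag1 a b (fun j => (hb j).1) (Reg_mono hb).injective hne v (fun l => by
      have := Sc_sum hα.injective b hne l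
      rw [← hv] at this; exact this)
    rw [← hkk]
    exact (hK _ (border_transpose _ _ (Dmat_transpose a)) k hk).symm
  let F : Vc n → ENNReal := fun s => G (border (Dmat a) (cv s))
  have hF : Measurable F := hG.comp (border_meas.comp (measurable_const.prodMk cv_meas))
  have hpos : ∀ᵐ v : Vz n, sv v ∈ posO n := by
    have : ∀ᵐ s ∂(Measure.map (sv (n := n)) volume), s ∈ posO n := by
      rw [map_sv]
      exact ae_smul_measure (ae_restrict_mem (posO_meas n)) _
    exact ae_of_ae_map sv_meas.aemeasurable this
  have h1 : ∫⁻ v, G (border (Dmat a) v) = ∫⁻ v, F (sv (n := n) v) := by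
    refine lintegral_congr_ae ?_
    filter_upwards [hpos] with v hv
    obtain ⟨b, hb, hS⟩ := Sc_surj hα (fun j => sq_nonneg _) (sv v) hv
    rw [key b hb v hS.symm, ← key b hb (cv (sv v)) (by rw [sv_cv fun j => (hv j).le, hS])]
  rw [h1, ← lintegral_map hF sv_meas, map_sv, lintegral_smul_measure, smul_eq_mul,
    rootCoV hα fun j => sq_nonneg _]
  congr 1
  refine setLIntegral_congr_fun (Reg_meas _) fun b hb => ?_
  rw [← key b hb (cv (Sc _ b)) (sv_cv fun j => (Sc_pos hα hb j).le)]

lemma vdm_cons {R : Type*} [CommRing R] (x : R) (y : Fin n → R) :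
    vdm (Fin.cons x y : Fin (n+1) → R) = (∏ j, (y j - x)) * vdm y := by
  rw [vdm_eq_det, vdm_eq_det, det_vandermonde, det_vandermonde, prod_univ_succ]
  congr 1
  · rw [prod_Ioi_zero]; simp
  · refine prod_congr rfl fun i _ => ?_
    rw [prod_Ioi_succ]; simp

def al0 (b : Vc n) : Vc (n+1) := Fin.cons 0 fun j => b j ^ 2

lemma al0_mono {b : Vc n} (hb : b ∈ Ch n) : StrictMono (al0 b) := by
  intro i j
  refine cases ?_ (fun i => ?_) i <;> refine cases ?_ (fun j => ?_) j
  · simp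
  · intro _; simp only [al0, cons_zero, cons_succ]; exact pow_pos (hb.1 j) 2
  · intro h; simp at h
  · intro h
    simp only [al0, cons_succ]; exact sq_mono hb.2 hb.1 (by simpa using h)

lemma al0_nonneg (b : Vc n) (j) : 0 ≤ al0 b j := by
  refine cases ?_ (fun i => ?_) j <;> simp [al0, sq_nonneg]

lemma Sc_al0 (b : Vc n) (a : Vc (n+1)) :
    Sc (al0 b) a 0 = (∏ j, a j ^ 2) / ∏ j, b j ^ 2 := by
  have h1 : (Finset.univ.erase (0 : Fin (n+1))) = Finset.univ.image succ := by
    ext i; refine cases ?_ (fun i => ?_) i <;> simp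
  rw [Sc, h1, prod_image (fun x _ y _ h => succ_injective _ h)]
  simp only [al0, cons_zero, cons_succ, zero_sub, sub_zero, prod_neg]
  rw [card_univ, card_univ, Fintype.card_fin, Fintype.card_fin, pow_succ]
  rw [show -((-1:ℝ)^n * -1 * ∏ i, a i ^ 2) = (-1)^n * ∏ i, a i ^ 2 by ring]
  exact mul_div_mul_left _ _ (pow_ne_zero _ (by norm_num))

lemma step2 (f : Matrix (Fz (n+1)) (Fz (n+1)) ℝ → ENNReal) (hf : Measurable f)
    (hK : KInv f) {b : Vc n} (hb : b ∈ Ch n) :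
    ∫⁻ u : Vc (2*n+1), f (border (border (Dmat b) 0) u) = (oR Real.pi)^n *
      ∫⁻ a in Reg (al0 b),
        oR (2^(n+1) * (vdm (fun j => a j ^ 2) / (vdm (fun j => b j ^ 2) * ∏ j, b j))) *
          f (Dmat a) := by
  have hα := al0_mono hb
  have key : ∀ a ∈ Reg (al0 b), ∀ (v : Vz n) (x : ℝ),
      (Fin.cons (x^2) (sv v) : Vc (n+1)) = Sc (al0 b) a →
      f (border (border (Dmat b) 0) (snoc v x : Vc (2*n+1))) = f (Dmat a) := by
    intro a ha v x hv
    have hne : ∀ i j, a i ^ 2 ≠ al0 b j := fun i j h => by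
      rcases lt_or_ge i j with hij | hij
      · exact ((ha i).2.2 j hij).ne h
      · exact ((hα.monotone hij).trans_lt (ha i).2.1).ne' h
    obtain ⟨k, hk, hkk⟩ := diag2 b a (fun j => (ha j).1) (Reg_mono ha).injective
      (fun i j => by simpa [al0] using hne i j.succ) (snoc v x : Vc (2*n+1)) (fun l => by
      have := Sc_sum hα.injective a hne l
      rw [← hv, sum_univ_succ] at this
      simpa [al0, sv] using this)
    rw [← hkk]
    exact (hK _ (border_transpose _ _ (border_transpose _ _ (Dmat_transpose b))) k hk).symm
  let F : Vc (n+1) → ENNReal := fun s =>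
    f (border (border (Dmat b) 0) (snoc (cv (tail s)) (Real.sqrt (s 0)) : Vc (2*n+1)))
  have hsn : Measurable fun p : ℝ × Vz n => (snoc p.2 p.1 : Vc (2*n+1)) := by
    refine measurable_pi_lambda _ fun i => ?_
    refine lastCases ?_ (fun i => ?_) i
    · simp; fun_prop
    · simp; fun_prop
  have hF : Measurable F := hf.comp (border_meas.comp (measurable_const.prodMk
    (hsn.comp ((by fun_prop : Measurable fun s : Vc (n+1) => Real.sqrt (s 0)).prodMk
      (cv_meas.comp (measurable_pi_lambda _ fun i => measurable_pi_apply _))))))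
  have hco : Measurable fun p : ℝ × Vc n => (Fin.cons p.1 p.2 : Vc (n+1)) := by
    refine measurable_pi_lambda _ fun i => ?_
    refine cases ?_ (fun i => ?_) i
    · simp; fun_prop
    · simp; fun_prop
  have hpos : ∀ᵐ v : Vz n, sv v ∈ posO n := by
    have : ∀ᵐ s ∂(Measure.map (sv (n := n)) volume), s ∈ posO n := by
      rw [map_sv]
      exact ae_smul_measure (ae_restrict_mem (posO_meas n)) _
    exact ae_of_ae_map sv_meas.aemeasurable this
  have h1 : ∫⁻ u : Vc (2*n+1), f (border (border (Dmat b) 0) u) =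
      ∫⁻ x : ℝ, ∫⁻ v : Vz n, F (Fin.cons (x^2) (sv v)) := by
    have hfm : Measurable fun u : Vc (2*n+1) => f (border (border (Dmat b) 0) u) :=
      hf.comp (border_meas.comp (measurable_const.prodMk measurable_id))
    refine (lint_snoc _ hfm).trans ?_
    have hx : ∀ᵐ x : ℝ, x ≠ 0 := by
      simp [ae_iff]
    refine lintegral_congr_ae ?_
    filter_upwards [hx] with x hx
    refine lintegral_congr_ae ?_
    filter_upwards [hpos] with v hv
    have hx2 : 0 < x^2 := by positivity
    obtain ⟨a, ha, hS⟩ := Sc_surj hα (al0_nonneg b) (Fin.cons (x^2) (sv v)) (fun j => by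
      refine cases ?_ (fun i => ?_) j
      · simpa using hx2
      · simpa using hv i)
    rw [key a ha v x hS.symm]
    simp only [F, Fin.tail_cons, cons_zero]
    rw [← key a ha _ _ (by
      rw [sv_cv (fun j => (hv j).le), Real.sq_sqrt hx2.le, hS])]
  have h2 : ∀ x : ℝ, ∫⁻ v : Vz n, F (Fin.cons x (sv v)) =
      (oR Real.pi)^n * ∫⁻ s in posO n, F (Fin.cons x s) := fun x => by
    have hm : Measurable fun s : Vc n => F (Fin.cons x s) :=
      hF.comp (hco.comp (measurable_const.prodMk measurable_id))
    rw [← lintegral_map hm sv_meas, map_sv, lintegral_smul_measure, smul_eq_mul]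
  rw [h1]
  simp only [h2]
  rw [lint_sq (fun x => (oR Real.pi)^n * ∫⁻ s in posO n, F (Fin.cons x s))]
  have h3 : ∫⁻ s in posO (n+1), oR ((Real.sqrt (s 0))⁻¹) * F s =
      ∫⁻ x in Set.Ioi (0:ℝ), ∫⁻ s in posO n, oR ((Real.sqrt x)⁻¹) * F (Fin.cons x s) := by
    rw [← lintegral_indicator (posO_meas _), lint_cons _ (Measurable.indicator (by fun_prop) (posO_meas _)),
      ← lintegral_indicator measurableSet_Ioi]
    congr 1; ext x
    by_cases hx : x ∈ Set.Ioi (0:ℝ)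
    · rw [indicator_of_mem hx, ← lintegral_indicator (posO_meas _)]
      congr 1; ext s
      have hiff : (Fin.cons x s : Vc (n+1)) ∈ posO (n+1) ↔ s ∈ posO n := by
        simp only [posO, mem_setOf_eq, forall_fin_succ, cons_zero, cons_succ]
        exact ⟨fun h => h.2, fun h => ⟨hx, h⟩⟩
      by_cases hs : s ∈ posO n
      · rw [indicator_of_mem hs, indicator_of_mem (hiff.2 hs), cons_zero]
      · rw [indicator_of_notMem hs, indicator_of_notMem (fun h => hs (hiff.1 h))]
    · rw [indicator_of_notMem hx]
      have : ∀ s, (Fin.cons x s : Vc (n+1)) ∉ posO (n+1) := fun s h => hx (by simpa using h 0)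
      simp [indicator_of_notMem, this]
  have h4 : ∫⁻ x in Set.Ioi (0:ℝ), oR ((Real.sqrt x)⁻¹) *
      ((oR Real.pi)^n * ∫⁻ s in posO n, F (Fin.cons x s)) =
      (oR Real.pi)^n * ∫⁻ s in posO (n+1), oR ((Real.sqrt (s 0))⁻¹) * F s := by
    rw [h3, ← lintegral_const_mul' _ _ (by simp)]
    refine setLIntegral_congr_fun measurableSet_Ioi fun x _ => ?_
    rw [lintegral_const_mul' _ _ (by simp)]; ring
  rw [h4, rootCoV hα (al0_nonneg b)]
  congr 1
  refine setLIntegral_congr_fun (Reg_meas _) fun a ha => ?_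
  have hS := Sc_pos hα ha
  rw [← key a ha (cv (tail (Sc (al0 b) a))) (Real.sqrt (Sc (al0 b) a 0)) (by
      rw [sv_cv (s := tail (Sc (al0 b) a)) (fun j => (hS _).le), Real.sq_sqrt (hS 0).le]; exact cons_self_tail _)]
  rw [← mul_assoc, ← ENNReal.ofReal_mul]
  · congr 2
    have hpa : 0 < ∏ j, a j := prod_pos fun j _ => (ha j).1
    have hpb : 0 < ∏ j, b j := prod_pos fun j _ => hb.1 j
    have hvb := vdm_pos (sq_mono hb.2 hb.1)
    rw [Sc_al0, Finset.prod_pow, Finset.prod_pow, ← div_pow, Real.sqrt_sq (by positivity), al0, vdm_cons]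
    simp only [sub_zero, Finset.prod_pow, prod_mul_distrib]
    simp
    field_simp
  · refine mul_nonneg (prod_nonneg fun j _ => by have := (ha j).1; positivity) ?_
    exact div_nonneg (vdm_pos (sq_mono (Reg_mono ha) fun j => (ha j).1)).le (vdm_pos hα).le

abbrev Mt (m : ℕ) := Matrix (Fin m) (Fin m) ℝ
local notation:max "Mz" n:max => (Mt (2 * n))

abbrev Pr (m : ℕ) := {p : Fin m × Fin m // p.1 < p.2}

def toA (x : Pr m → ℝ) : Mt m := of fun i j =>
  if h : i < j then x ⟨(i, j), h⟩ else if h : j < i then - x ⟨(j, i), h⟩ else 0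

lemma toA_meas : Measurable (toA (m := m)) := by
  refine meas_mat fun i j => ?_
  simp only [toA, of_apply]
  split_ifs <;> fun_prop

lemma toA_skew (x : Pr m → ℝ) : (toA x)ᵀ = - toA x := by
  ext i j
  simp only [toA, transpose_apply, of_apply, Matrix.neg_apply]
  rcases lt_trichotomy i j with h | h | h
  · simp [h, h.not_gt]
  · simp [h]
  · simp [h, h.not_gt]

def lam (m : ℕ) : Measure (Mt m) := Measure.map toA volume

instance (m : ℕ) : SFinite (lam m) := by unfold lam; infer_instance

lemma lam_skew (m : ℕ) : ∀ᵐ X ∂(lam m), Xᵀ = - X := by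
  unfold lam
  rw [ae_map_iff toA_meas.aemeasurable]
  · exact Filter.Eventually.of_forall toA_skew
  · have : {X : Mt m | Xᵀ = -X} = ⋂ i, ⋂ j, {X : Mt m | X j i = - X i j} := by
      ext X; simp only [mem_iInter, mem_setOf_eq]
      exact ⟨fun h i j => congrFun (congrFun h i) j, fun h => by ext i j; exact h i j⟩
    rw [this]
    exact MeasurableSet.iInter fun i => MeasurableSet.iInter fun j =>
      measurableSet_eq_fun (meas_entry j i) (meas_entry i j).neg

def prE (m : ℕ) : Pr m ⊕ Fin m ≃ Pr (m+1) where
  toFun := Sum.elim (fun p => ⟨(p.1.1.castSucc, p.1.2.castSucc), by simpa using p.2⟩)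
    (fun i => ⟨(i.castSucc, last m), castSucc_lt_last i⟩)
  invFun := fun p => if h : p.1.2 = last m then Sum.inr (p.1.1.castPred
      (by intro h2; have := p.2; rw [h, h2] at this; exact lt_irrefl _ this))
    else Sum.inl ⟨(p.1.1.castPred (by intro h2; have := p.2; rw [h2] at this
                                      exact absurd this (le_last _).not_gt),
      p.1.2.castPred h), by simpa using p.2⟩
  left_inv := by
    rintro (⟨⟨i, j⟩, h⟩ | i)
    · simp
    · simp
  right_inv := by
    rintro ⟨⟨i, j⟩, h⟩
    by_cases hj : j = last m
    · subst hj; simp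
    · simp [hj]

lemma toA_succ (x : Pr (m+1) → ℝ) :
    toA x = border (toA fun p => x (prE m (Sum.inl p))) (fun i => x (prE m (Sum.inr i))) := by
  ext i j
  refine lastCases ?_ (fun i => ?_) i <;> refine lastCases ?_ (fun j => ?_) j
  · simp [toA]
  · simp [toA, prE, castSucc_lt_last, (castSucc_lt_last j).not_gt]
  · simp [toA, prE, castSucc_lt_last]
  · simp [toA, prE]

lemma lam_succ (m : ℕ) :
    lam (m+1) = Measure.map (fun p : Mt m × Vc m => border p.1 p.2) ((lam m).prod volume) := by
  have h1 : MeasurePreserving (fun (x : Pr (m+1) → ℝ) (i : Pr m ⊕ Fin m) => x (prE m i)) :=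
    mp_reindex (prE m)
  have h2 := volume_measurePreserving_sumPiEquivProdPi (fun _ : Pr m ⊕ Fin m => ℝ)
  have h3 := h2.comp h1
  have h4 : (lam m).prod (volume : Measure Vc m) =
      Measure.map (Prod.map toA id) ((volume : Measure (Pr m → ℝ)).prod volume) := by
    rw [← map_prod_map _ _ toA_meas measurable_id, Measure.map_id]; rfl
  rw [h4, Measure.map_map border_meas (toA_meas.prodMap measurable_id), ← volume_eq_prod,
    ← h3.map_eq, Measure.map_map (border_meas.comp (toA_meas.prodMap measurable_id)) h3.measurable]
  unfold lam
  congr 1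
  ext1 x
  rw [toA_succ]; rfl

lemma lint_lam_succ (f : Mt (m+1) → ENNReal) (hf : Measurable f) :
    ∫⁻ X, f X ∂(lam (m+1)) = ∫⁻ M, ∫⁻ v, f (border M v) ∂volume ∂(lam m) := by
  rw [lam_succ, lintegral_map hf border_meas]
  exact lintegral_prod _ (hf.comp border_meas).aemeasurable

lemma orth_det {k : Mt m} (hk : k ∈ orthogonalGroup (Fin m) ℝ) : |k.det| = 1 := by
  have h := (mem_orth_iff k).1 hk
  have := congrArg det h
  rw [det_mul, det_transpose, det_one] at this
  rcases mul_self_eq_one_iff.1 this with h | h <;> simp [h]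

lemma mp_mulVec {k : Mt m} (hk : k ∈ orthogonalGroup (Fin m) ℝ) :
    MeasurePreserving (fun v : Vc m => k *ᵥ v) := by
  have h1 := orth_det hk
  have h0 : k.det ≠ 0 := fun h => by simp [h] at h1
  have h2 := Real.map_matrix_volume_pi_eq_smul_volume_pi h0
  have h3 : (fun v : Vc m => k *ᵥ v) = toLin' k := by ext v; simp
  rw [h3]
  refine ⟨(LinearMap.continuous_of_finiteDimensional _).measurable, ?_⟩
  rw [h2, abs_inv, h1]; simp

lemma KInv_border (f : Mt (m+1) → ENNReal) (hf : Measurable f) (hK : KInv f) :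
    KInv fun M : Mt m => ∫⁻ u, f (border M u) := by
  intro M hM k hk
  have hm : Measurable fun u : Vc m => f (border (k * M * kᵀ) u) :=
    hf.comp (border_meas.comp (measurable_const.prodMk measurable_id))
  have := (mp_mulVec hk).lintegral_comp hm
  refine this.symm.trans (lintegral_congr fun u => ?_)
  rw [← ext1_conj]
  exact hK _ (border_transpose _ _ hM) _ (ext1_mem k hk)

lemma meas_border (f : Mt (m+1) → ENNReal) (hf : Measurable f) :
    Measurable fun M : Mt m => ∫⁻ u, f (border M u) :=
  (hf.comp border_meas).lintegral_prod_right'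

def I1 (a' b : Vc n) : ENNReal := (Reg fun j => a' j ^ 2).indicator 1 b
def I2 (b : Vc n) (a : Vc (n+1)) : ENNReal := (Reg (al0 b)).indicator 1 a

lemma Reg_meas2 {k : ℕ} : MeasurableSet {p : Vc k × Vc k | p.2 ∈ Reg p.1} := by
  simp only [Reg, mem_setOf_eq]
  simp only [setOf_forall, setOf_and]
  refine MeasurableSet.iInter fun j : Fin k => ?_
  refine (measurableSet_lt (by fun_prop) (by fun_prop)).inter
    ((measurableSet_lt (by fun_prop) (by fun_prop)).inter ?_)
  exact MeasurableSet.iInter fun i => MeasurableSet.iInter fun _ =>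
    measurableSet_lt (by fun_prop) (by fun_prop)

lemma al0_meas : Measurable (al0 (n := n)) := by
  refine measurable_pi_lambda _ fun i => ?_
  refine cases ?_ (fun i => ?_) i <;> simp only [al0, cons_zero, cons_succ] <;> fun_prop

lemma I1_meas : Measurable fun p : Vc n × Vc n => I1 p.1 p.2 := by
  have : (fun p : Vc n × Vc n => I1 p.1 p.2) =
      indicator ((fun p : Vc n × Vc n => ((fun j => p.1 j ^ 2 : Vc n), p.2)) ⁻¹'
        {p : Vc n × Vc n | p.2 ∈ Reg p.1}) 1 := by
    ext p; simp [I1, indicator]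
  rw [this]
  exact measurable_one.indicator ((by fun_prop : Measurable _) Reg_meas2)

lemma I2_meas : Measurable fun p : Vc n × Vc (n+1) => I2 p.1 p.2 := by
  have : (fun p : Vc n × Vc (n+1) => I2 p.1 p.2) =
      indicator ((fun p : Vc n × Vc (n+1) => (al0 p.1, p.2)) ⁻¹'
        {p : Vc (n+1) × Vc (n+1) | p.2 ∈ Reg p.1}) 1 := by
    ext p; simp [I2, indicator]
  rw [this]
  exact measurable_one.indicator (((al0_meas.comp measurable_fst).prodMk measurable_snd) Reg_meas2)

def cK (n : ℕ) : ENNReal := (oR Real.pi)^n * (oR Real.pi)^n *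
  oR (2^(2*n+1))

lemma vsq_meas : Measurable fun a : Vc n => vdm fun j => a j ^ 2 := by
  unfold vdm; fun_prop

lemma Kstep (f : Mz (n+1) → ENNReal) (hf : Measurable f) (hK : KInv f)
    {a' : Vc n} (ha : a' ∈ Ch n) :
    ∫⁻ v : Vz n, ∫⁻ u : Vc (2*n+1), f (border (border (Dmat a') v) u) =
      cK n * ∫⁻ b, ∫⁻ a, I1 a' b * I2 b a *
        oR (vdm (fun j => a j ^ 2) / vdm (fun j => a' j ^ 2)) * f (Dmat a) := by
  refine (step1 (n := n) (fun M => ∫⁻ u : Vc (2*n+1), f (border M u))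
    (meas_border (m := 2*n+1) f hf) (KInv_border (m := 2*n+1) f hf hK) ha).trans ?_
  have hva := vdm_pos (sq_mono ha.2 ha.1)
  rw [cK, mul_assoc, mul_assoc]
  congr 1
  rw [← mul_assoc, ← lintegral_const_mul' _ _ (by finiteness), ← lintegral_indicator (Reg_meas _)]
  refine lintegral_congr fun b => ?_
  by_cases hb : b ∈ Reg fun j => a' j ^ 2
  · have hbC : b ∈ Ch n := ⟨fun j => (hb j).1, Reg_mono hb⟩
    rw [indicator_of_mem hb, step2 f hf hK hbC, ← lintegral_indicator (Reg_meas _),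
      ← lintegral_const_mul' _ _ (by finiteness), ← lintegral_const_mul' _ _ (by finiteness),
      ← lintegral_const_mul' _ _ (by finiteness)]
    refine lintegral_congr fun a => ?_
    simp only [I1, I2, indicator_of_mem hb, Pi.one_apply, one_mul]
    by_cases h2 : a ∈ Reg (al0 b)
    · rw [indicator_of_mem h2, indicator_of_mem h2, Pi.one_apply, one_mul]
      have hvb := vdm_pos (sq_mono hbC.2 hbC.1)
      have hpb : 0 < ∏ j, b j := prod_pos fun j _ => hbC.1 j
      rw [mul_left_comm, mul_assoc]
      congr 1
      have e1 : 0 ≤ (∏ j, 2 * b j) * ((vdm fun j => b j ^ 2) / vdm fun j => a' j ^ 2) := by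
        refine mul_nonneg (prod_nonneg fun j _ => ?_) (by positivity)
        have := hbC.1 j
        positivity
      have e2 : (0:ℝ) ≤ 2 ^ (2*n+1) := by positivity
      rw [← mul_assoc, ← mul_assoc, ← ENNReal.ofReal_mul e1, ← ENNReal.ofReal_mul e2]
      congr 2
      rw [prod_mul_distrib]
      simp only [Finset.prod_const, card_univ, Fintype.card_fin]
      field_simp
      ring
    · rw [indicator_of_notMem h2, indicator_of_notMem h2]; simp
  · rw [indicator_of_notMem hb]
    simp [I1, indicator_of_notMem hb]

def lo (b : Vc n) (j : Fin n) : ℝ := (Fin.cons 0 b : Vc (n+1)) j.castSucc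

lemma lo_succ (b : Vc (n+1)) (j : Fin n) : lo b j.succ = b j.castSucc := by
  rw [lo, ← succ_castSucc, cons_succ]
lemma lo_zero (b : Vc (n+1)) : lo b 0 = 0 := by simp [lo]

lemma sq_lt_iff {x y : ℝ} (hx : 0 < x) (hy : 0 < y) : x^2 < y^2 ↔ x < y :=
  pow_lt_pow_iff_left₀ hx.le hy.le two_ne_zero

lemma lo_nonneg {b : Vc n} (hb : b ∈ Ch n) (j) : 0 ≤ lo b j := by
  unfold lo
  refine cases ?_ (fun i => ?_) j.castSucc
  · simp
  · simpa using (hb.1 i).le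

lemma lo_lt {b : Vc n} (hb : b ∈ Ch n) (j) : lo b j < b j := by
  cases n with
  | zero => exact j.elim0
  | succ n =>
    refine cases ?_ (fun i => ?_) j
    · rw [lo_zero]; exact hb.1 0
    · rw [lo_succ]; exact hb.2 (castSucc_lt_succ)

lemma mem1 {b a' : Vc n} (hb : b ∈ Ch n) :
    (a' ∈ Ch n ∧ b ∈ Reg (fun j => a' j ^ 2)) ↔ ∀ j, a' j ∈ Set.Ioo (lo b j) (b j) := by
  cases n with
  | zero => simp [Ch, Reg, Subsingleton.strictMono]
  | succ n =>
  constructor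
  · rintro ⟨ha, h⟩ j
    refine ⟨?_, (sq_lt_iff (ha.1 j) (hb.1 j)).1 (h j).2.1⟩
    revert j
    refine cases ?_ fun i => ?_
    · rw [lo_zero]; exact ha.1 0
    · rw [lo_succ]; exact (sq_lt_iff (hb.1 _) (ha.1 _)).1 ((h i.castSucc).2.2 _ castSucc_lt_succ)
  · intro h
    have hp : ∀ j, 0 < a' j := fun j => (lo_nonneg hb j).trans_lt (h j).1
    refine ⟨⟨hp, strictMono_iff_lt_succ.2 fun i => ?_⟩, fun j => ⟨hb.1 j, ?_, fun i hi => ?_⟩⟩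
    · have h1 := (h i.castSucc).2
      have h2 := (h i.succ).1
      rw [lo_succ] at h2; linarith
    · exact (sq_lt_iff (hp j) (hb.1 j)).2 (h j).2
    · refine (sq_lt_iff (hb.1 j) (hp i)).2 ?_
      revert hi
      refine cases ?_ (fun i => ?_) i
      · intro hi; exact absurd hi (Fin.not_lt_zero _)
      · intro hi
        have h2 := (h i.succ).1
        rw [lo_succ] at h2
        exact (hb.2.monotone (le_castSucc_iff.2 hi)).trans_lt h2

lemma mem2 {b : Vc n} {a : Vc (n+1)} (ha : a ∈ Ch (n+1)) :
    (b ∈ Ch n ∧ a ∈ Reg (al0 b)) ↔ ∀ j, b j ∈ Set.Ioo (a j.castSucc) (a j.succ) := by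
  constructor
  · rintro ⟨hb, h⟩ j
    refine ⟨(sq_lt_iff (ha.1 _) (hb.1 j)).1 ?_, (sq_lt_iff (hb.1 j) (ha.1 _)).1 ?_⟩
    · simpa [al0] using (h j.castSucc).2.2 j.succ castSucc_lt_succ
    · simpa [al0] using (h j.succ).2.1
  · intro h
    have hp : ∀ j, 0 < b j := fun j => (ha.1 _).trans (h j).1
    refine ⟨⟨hp, ?_⟩, fun j => ⟨ha.1 j, ?_, fun i hi => ?_⟩⟩
    · cases n with
      | zero => exact Subsingleton.strictMono _
      | succ n =>
        refine strictMono_iff_lt_succ.2 fun i => ?_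
        have h1 := (h i.castSucc).2
        have h2 := (h i.succ).1
        rw [succ_castSucc] at h1
        exact h1.trans h2
    · refine cases ?_ (fun i => ?_) j
      · simpa [al0] using pow_pos (ha.1 0) 2
      · simp only [al0, cons_succ]; exact (sq_lt_iff (hp i) (ha.1 _)).2 (h i).2
    · revert hi
      refine cases ?_ (fun i => ?_) i
      · intro hi; exact absurd hi (Fin.not_lt_zero _)
      · intro hi
        simp only [al0, cons_succ]
        exact (sq_lt_iff (ha.1 j) (hp i)).2
          ((ha.2.monotone (le_castSucc_iff.2 hi)).trans_lt (h i).1)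

def bx (l u : Vc n) : Set Vc n := Set.univ.pi fun j => Set.Ioo (l j) (u j)

lemma box_meas (l u : Vc n) : MeasurableSet (bx l u) :=
  MeasurableSet.univ_pi fun _ => measurableSet_Ioo

lemma box_restrict (l u : Vc n) : (volume : Measure Vc n).restrict (bx l u) =
    Measure.pi fun j => volume.restrict (Set.Ioo (l j) (u j)) := by
  rw [bx, volume_pi, restrict_pi_pi]

lemma box_det_int (l u : Vc n) (g : Fin n → ℝ → ℂ)
    (hg : ∀ j c, IntegrableOn (g c) (Set.Ioo (l j) (u j))) :
    IntegrableOn (fun x => det (of fun b c => g c (x b))) (bx l u) ∧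
    ∫ x in bx l u, det (of fun b c => g c (x b)) =
      det (of fun b c => ∫ x in Set.Ioo (l b) (u b), g c x) := by
  have h1 : ∀ σ : Perm (Fin n), IntegrableOn (fun x : Vc n => ∏ c, g c (x (σ c))) (bx l u) := by
    intro σ
    rw [IntegrableOn, box_restrict]
    have : (fun x : Vc n => ∏ c, g c (x (σ c))) = fun x => ∏ b, g (σ.symm b) (x b) := by
      ext x; rw [← Equiv.prod_comp σ (fun b => g (σ.symm b) (x b))]; simp
    rw [this]
    exact Integrable.fintype_prod fun b => hg b _
  simp only [det_apply', of_apply]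
  constructor
  · exact integrable_finset_sum _ fun σ _ => (h1 σ).const_mul _
  · refine (integral_finset_sum _ fun σ _ => (h1 σ).const_mul _).trans ?_
    refine Finset.sum_congr rfl fun σ _ => ?_
    rw [integral_const_mul]
    congr 1
    rw [box_restrict]
    have : (fun x : Vc n => ∏ c, g c (x (σ c))) = fun x => ∏ b, g (σ.symm b) (x b) := by
      ext x; rw [← Equiv.prod_comp σ (fun b => g (σ.symm b) (x b))]; simp
    rw [this, integral_fintype_prod_eq_prod, ← Equiv.prod_comp σ]
    simp

def dps (s : Fin n → ℂ) (a : Vc n) : ℂ :=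
  det (of fun b c => ((a b : ℝ) : ℂ) ^ (s c))

lemma cpow_int {x y : ℝ} (hxy : x ≤ y) {s : ℂ} (hs : -1 < s.re) :
    IntegrableOn (fun t : ℝ => (t:ℂ)^s) (Set.Ioo x y) ∧
    ∫ t in Set.Ioo x y, (t:ℂ)^s = ((y:ℂ)^(s+1) - (x:ℂ)^(s+1)) / (s+1) := by
  constructor
  · exact ((intervalIntegrable_iff_integrableOn_Ioo_of_le hxy).1
      (intervalIntegral.intervalIntegrable_cpow' hs))
  · rw [← integral_Ioc_eq_integral_Ioo, ← intervalIntegral.integral_of_le hxy, integral_cpow (Or.inl hs)]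

lemma det_div_col (A : Fin n → Fin n → ℂ) (d : Fin n → ℂ) :
    det (of fun b c => A b c / d c) = (∏ c, (d c)⁻¹) * (of A).det := by
  rw [← det_mul_row]
  congr 1; ext b c; simp [div_eq_mul_inv, mul_comm]

lemma J1 {b : Vc n} (hb : b ∈ Ch n) {s : Fin n → ℂ} (hs : ∀ c, -1 < (s c).re) :
    IntegrableOn (dps s) (bx (lo b) b) ∧
    ∫ x in bx (lo b) b, dps s x = (∏ c, (s c + 1)⁻¹) * dps (fun c => s c + 1) b := by
  have h := box_det_int (lo b) b (fun c t => (t:ℂ)^(s c)) fun j c => (cpow_int (lo_lt hb j).le (hs c)).1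
  refine ⟨h.1, h.2.trans ?_⟩
  simp only [fun j c => (cpow_int (lo_lt hb j).le (hs c)).2]
  rw [det_div_col (fun j c => ((b j : ℝ):ℂ)^(s c + 1) - ((lo b j : ℝ):ℂ)^(s c + 1))]
  congr 1
  cases n with
  | zero => simp [dps]
  | succ n =>
    refine (det_eq_of_forall_row_eq_smul_add_pred (fun _ => 1) (fun j => ?_) fun i j => ?_).symm
    · have : s j + 1 ≠ 0 := fun h => by
        have := congrArg re h
        have h2 := hs j
        simp at this; linarith
      simp [lo_zero, zero_cpow this]
    · simp [lo_succ]

lemma J2 {a : Vc (n+1)} (ha : a ∈ Ch (n+1)) {s : Fin n → ℂ} (hs : ∀ c, -1 < (s c).re) :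
    IntegrableOn (dps s) (bx (fun j => a j.castSucc) (fun j => a j.succ)) ∧
    ∫ x in bx (fun j => a j.castSucc) (fun j => a j.succ), dps s x =
      (∏ c, (s c + 1)⁻¹) * dps (Fin.cons 0 fun c => s c + 1) a := by
  have hle : ∀ j : Fin n, a j.castSucc ≤ a j.succ := fun j => (ha.2 castSucc_lt_succ).le
  have h := box_det_int (fun j => a j.castSucc) (fun j => a j.succ) (fun c t => (t:ℂ)^(s c))
    fun j c => (cpow_int (hle j) (hs c)).1
  refine ⟨h.1, h.2.trans ?_⟩
  simp only [fun j c => (cpow_int (hle j) (hs c)).2]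
  rw [det_div_col (fun j c => ((a j.succ : ℝ):ℂ)^(s c + 1) - ((a j.castSucc : ℝ):ℂ)^(s c + 1))]
  congr 1
  have h2 : dps (Fin.cons 0 fun c => s c + 1) a = det (of fun (j : Fin (n+1)) (c : Fin (n+1)) =>
      (Fin.cons ((a 0 : ℂ) ^ ((Fin.cons 0 fun c => s c + 1 : Fin (n+1) → ℂ) c)) (fun i : Fin n =>
        ((a i.succ : ℝ):ℂ) ^ ((Fin.cons 0 fun c => s c + 1 : Fin (n+1) → ℂ) c) -
        ((a i.castSucc : ℝ):ℂ) ^ ((Fin.cons 0 fun c => s c + 1 : Fin (n+1) → ℂ) c)) : Fin (n+1) → ℂ) j) := by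
    refine det_eq_of_forall_row_eq_smul_add_pred (fun _ => 1) (fun j => ?_) fun i j => ?_
    · simp
    · simp
  rw [h2, det_succ_column_zero, sum_univ_succ]
  simp
  congr 1

lemma dps_shift (s : Fin n → ℂ) (t : ℂ) {a : Vc n} (ha : ∀ j, 0 < a j) :
    dps (fun c => s c + t) a = (∏ b, ((a b : ℝ):ℂ)^t) * dps s a := by
  unfold dps
  rw [← det_mul_column]
  congr 1; ext b c
  simp only [of_apply]
  rw [cpow_add _ _ (by exact_mod_cast (ha b).ne'), mul_comm]

def s00 (n : ℕ) (c : Fin n) : ℂ := 2 * (c.val : ℂ)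

lemma dps_s00 (a : Vc n) : dps (s00 n) a = ((vdm fun j => a j ^ 2 : ℝ) : ℂ) := by
  rw [vdm_eq_det, dps, ← ofRealHom_eq_coe, RingHom.map_det]
  congr 1; ext b c
  simp only [of_apply, s00, vandermonde_apply, RingHom.mapMatrix_apply, Matrix.map_apply]
  rw [show (2 * (c.val:ℂ)) = ((2 * c.val : ℕ) : ℂ) by push_cast; ring, cpow_natCast]
  simp [pow_mul]

lemma dps_meas (s : Fin n → ℂ) : Measurable (dps s) := by
  unfold dps
  simp only [det_apply, of_apply]
  fun_prop

abbrev box1 (b : Vc n) := bx (lo b) b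
abbrev box2 (a : Vc (n+1)) := bx (fun j : Fin n => a j.castSucc) (fun j => a j.succ)

lemma I12 (a' b : Vc n) (a : Vc (n+1)) :
    (Ch n).indicator 1 a' * (I1 a' b * I2 b a) =
      (Ch (n+1)).indicator (1 : Vc (n+1) → ENNReal) a * ((box2 a).indicator 1 b * (box1 b).indicator 1 a') := by
  by_cases h : a' ∈ Ch n ∧ b ∈ Reg (fun j => a' j ^ 2) ∧ a ∈ Reg (al0 b)
  · obtain ⟨h1, h2, h3⟩ := h
    have hb : b ∈ Ch n := ⟨fun j => (h2 j).1, Reg_mono h2⟩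
    have ha : a ∈ Ch (n+1) := ⟨fun j => (h3 j).1, Reg_mono h3⟩
    have h4 : a' ∈ box1 b := by simpa [bx] using (mem1 hb).1 ⟨h1, h2⟩
    have h5 : b ∈ box2 a := by simpa [bx] using (mem2 ha).1 ⟨hb, h3⟩
    simp [I1, I2, h1, h2, h3, ha, h4, h5]
  · have h' : ¬ (a ∈ Ch (n+1) ∧ b ∈ box2 a ∧ a' ∈ box1 b) := by
      rintro ⟨ha, h5, h4⟩
      obtain ⟨hb, h3⟩ := (mem2 ha).2 (by simpa [bx] using h5)
      obtain ⟨h1, h2⟩ := (mem1 hb).2 (by simpa [bx] using h4)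
      exact h ⟨h1, h2, h3⟩
    have e1 : (Ch n).indicator (1 : Vc n → ENNReal) a' * (I1 a' b * I2 b a) = 0 := by
      by_contra hne
      simp only [I1, I2, mul_eq_zero, indicator_apply_eq_zero, not_or, Pi.one_apply, one_ne_zero,
        imp_false, not_not] at hne
      exact h ⟨hne.1, hne.2.1, hne.2.2⟩
    rw [e1]
    symm
    by_contra hne
    simp only [mul_eq_zero, indicator_apply_eq_zero, not_or, Pi.one_apply, one_ne_zero,
        imp_false, not_not] at hne
    exact h' ⟨hne.1, hne.2.1, hne.2.2⟩

lemma lint_ind {α : Type*} [MeasurableSpace α] {μ : Measure α} {s : Set α} (hs : MeasurableSet s)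
    (f : α → ENNReal) : ∫⁻ x in s, f x ∂μ = ∫⁻ x, s.indicator 1 x * f x ∂μ := by
  rw [← lintegral_indicator hs]
  refine lintegral_congr fun x => ?_
  by_cases h : x ∈ s <;> simp [h]

lemma swapL (F : Vc n → ENNReal) (H : Vc (n+1) → ENNReal)
    (hF : Measurable F) (hH : Measurable H) :
    ∫⁻ a' in Ch n, ∫⁻ b, ∫⁻ a, I1 a' b * I2 b a * (F a' * H a) =
      ∫⁻ a in Ch (n+1), H a * ∫⁻ b in box2 a, ∫⁻ a' in box1 b, F a' := by
  have hI : Measurable fun p : (Vc n × Vc n) × Vc (n+1) =>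
      (Ch n).indicator (1 : Vc n → ENNReal) p.1.1 * (I1 p.1.1 p.1.2 * I2 p.1.2 p.2) * (F p.1.1 * H p.2) := by
    have := I1_meas (n := n)
    have := I2_meas (n := n)
    have h3 : Measurable ((Ch n).indicator (1 : Vc n → ENNReal)) := measurable_one.indicator (Ch_meas n)
    exact ((h3.comp (by fun_prop)).mul ((I1_meas.comp measurable_fst).mul
      (I2_meas.comp (by fun_prop : Measurable fun p : (Vc n × Vc n) × Vc (n+1) =>
        (p.1.2, p.2))))).mul ((hF.comp (by fun_prop)).mul (hH.comp (by fun_prop)))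
  rw [lint_ind (Ch_meas n)]
  have e1 : ∀ a' : Vc n, (Ch n).indicator 1 a' * ∫⁻ b, ∫⁻ a, I1 a' b * I2 b a * (F a' * H a) =
      ∫⁻ b, ∫⁻ a, (Ch n).indicator (1 : Vc n → ENNReal) a' * (I1 a' b * I2 b a) * (F a' * H a) := by
    intro a'
    have : (Ch n).indicator (1 : Vc n → ENNReal) a' ≠ ⊤ := by
      by_cases h : a' ∈ Ch n <;> simp [h]
    rw [← lintegral_const_mul' _ _ this]
    refine lintegral_congr fun b => ?_
    rw [← lintegral_const_mul' _ _ this]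
    refine lintegral_congr fun a => ?_
    ring
  simp only [e1]
  rw [lint_ind (Ch_meas (n+1))]
  calc ∫⁻ a', ∫⁻ b, ∫⁻ a, (Ch n).indicator (1 : Vc n → ENNReal) a' * (I1 a' b * I2 b a) * (F a' * H a)
      = ∫⁻ b, ∫⁻ a', ∫⁻ a, (Ch n).indicator (1 : Vc n → ENNReal) a' * (I1 a' b * I2 b a) * (F a' * H a) :=
        lintegral_lintegral_swap (hI.lintegral_prod_right'.aemeasurable)
    _ = ∫⁻ b, ∫⁻ a, ∫⁻ a', (Ch n).indicator (1 : Vc n → ENNReal) a' * (I1 a' b * I2 b a) * (F a' * H a) := by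
        refine lintegral_congr fun b => lintegral_lintegral_swap ?_
        exact (hI.comp (by fun_prop : Measurable fun p : Vc n × Vc (n+1) =>
          ((p.1, b), p.2))).aemeasurable
    _ = ∫⁻ a, ∫⁻ b, ∫⁻ a', (Ch n).indicator (1 : Vc n → ENNReal) a' * (I1 a' b * I2 b a) * (F a' * H a) := by
        refine lintegral_lintegral_swap ?_
        have := (hI.comp (by fun_prop : Measurable fun p : (Vc n × Vc (n+1)) × Vc n =>
          ((p.2, p.1.1), p.1.2))).lintegral_prod_right' (ν := volume)
        exact this.aemeasurable
    _ = _ := by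
        refine lintegral_congr fun a => ?_
        rw [← lintegral_indicator (box_meas _ _)]
        simp only [I12]
        by_cases ha : a ∈ Ch (n+1)
        · rw [indicator_of_mem ha, Pi.one_apply]
          simp only [one_mul]
          rw [← lintegral_const_mul]
          · refine lintegral_congr fun b => ?_
            by_cases hb : b ∈ box2 a
            · rw [indicator_of_mem hb, indicator_of_mem hb, lint_ind (box_meas _ _)]
              refine Eq.trans ?_ (lintegral_const_mul _ (((measurable_one.indicator (box_meas _ _))).mul hF))
              refine lintegral_congr fun a' => ?_
              simp only [Pi.one_apply, Pi.mul_apply]; ring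
            · simp [indicator_of_notMem hb]
          · refine Measurable.indicator ?_ (box_meas _ _)
            have h5 : Measurable fun p : Vc n × Vc n => (box1 p.1).indicator (1 : Vc n → ENNReal) p.2 * F p.2 := by
              refine Measurable.mul ?_ (hF.comp measurable_snd)
              have : (fun p : Vc n × Vc n => (box1 p.1).indicator (1 : Vc n → ENNReal) p.2) =
                  indicator {p : Vc n × Vc n | p.2 ∈ box1 p.1} 1 := by
                ext p; simp [indicator]
              rw [this]
              refine measurable_one.indicator ?_
              simp only [bx, mem_univ_pi, Set.mem_Ioo, setOf_forall, setOf_and]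
              refine MeasurableSet.iInter fun j => (measurableSet_lt ?_ (by fun_prop)).inter
                (measurableSet_lt (by fun_prop) (by fun_prop))
              unfold lo
              refine cases ?_ (fun i => ?_) j.castSucc
              · simp
              · simp only [cons_succ]; fun_prop
            have h6 := h5.lintegral_prod_right' (ν := volume)
            have h7 : (fun b : Vc n => ∫⁻ a' in box1 b, F a') = _ := funext fun b => lint_ind (box_meas _ _) F
            rw [h7]; exact h6
        · simp [indicator_of_notMem ha]

lemma mem_box2 {a : Vc (n+1)} (ha : a ∈ Ch (n+1)) {b : Vc n} (hb : b ∈ box2 a) :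
    b ∈ Ch n := ((mem2 ha).2 (by simpa [bx] using hb)).1

lemma mem_box1 {a' : Vc n} {b : Vc n} (hb : b ∈ Ch n) (h : a' ∈ box1 b) :
    a' ∈ Ch n := ((mem1 hb).2 (by simpa [bx] using h)).1

lemma lint_of_int {A : Set Vc n} (hA : MeasurableSet A) {f : Vc n → ℂ} {I : ℂ}
    (hf : IntegrableOn f A) (hI : ∫ x in A, f x = I) (h0 : ∀ x ∈ A, 0 ≤ (f x).re) :
    ∫⁻ x in A, oR (f x).re = oR I.re := by
  have h1 : ∫ x in A, (f x).re = I.re := by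
    rw [← hI]; exact integral_re hf
  have hre : Integrable (fun x => (f x).re) (volume.restrict A) := hf.re
  rw [← h1, ofReal_integral_eq_lintegral_ofReal hre]
  exact ae_restrict_of_forall_mem hA h0

def dn (n : ℕ) : ℝ := ∏ c : Fin n, ((2 * (c.val:ℝ) + 1)⁻¹ * (2 * (c.val:ℝ) + 2)⁻¹)

lemma dn_pos (n : ℕ) : 0 < dn n := prod_pos fun c _ => by positivity

lemma s00_cons (n : ℕ) : (Fin.cons 0 fun c => s00 n c + 1 + 1 : Fin (n+1) → ℂ) = s00 (n+1) := by
  ext c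
  refine cases ?_ (fun i => ?_) c
  · simp [s00]
  · simp [s00]; ring

lemma s00_re (n : ℕ) (c : Fin n) : (s00 n c).re = 2 * c.val := by simp [s00]

lemma dps_s00_re (a : Vc n) : (dps (s00 n) a).re = vdm fun j => a j ^ 2 := by
  rw [dps_s00, ofReal_re]

lemma dps_s001_re {b : Vc n} (hb : b ∈ Ch n) :
    dps (fun c => s00 n c + 1) b = (((∏ j, b j) * vdm fun j => b j ^ 2 : ℝ) : ℂ) := by
  rw [dps_shift _ _ hb.1, dps_s00]; simp

lemma prodinv1 (n : ℕ) : (∏ c, (s00 n c + 1)⁻¹) = ((∏ c : Fin n, (2 * (c.val:ℝ) + 1)⁻¹ : ℝ) : ℂ) := by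
  push_cast; rfl
lemma prodinv2 (n : ℕ) : (∏ c, (s00 n c + 1 + 1)⁻¹) = ((∏ c : Fin n, (2 * (c.val:ℝ) + 2)⁻¹ : ℝ) : ℂ) := by
  push_cast; refine prod_congr rfl fun c _ => ?_
  rw [s00]; congr 1; ring

lemma J1L {b : Vc n} (hb : b ∈ Ch n) :
    ∫⁻ x in box1 b, oR (vdm fun j => x j ^ 2) =
      oR ((∏ c : Fin n, (2 * (c.val:ℝ) + 1)⁻¹) * (dps (fun c => s00 n c + 1) b).re) := by
  have h := J1 hb (s := s00 n) (fun c => by rw [s00_re]; have : (0:ℝ) ≤ c.val := by positivity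
                                            linarith)
  have := lint_of_int (box_meas _ _) h.1 h.2 (fun x hx => by
    rw [dps_s00_re]
    have := mem_box1 hb hx
    exact (vdm_pos (sq_mono this.2 this.1)).le)
  simp only [dps_s00_re] at this
  rw [this, prodinv1, re_ofReal_mul]

lemma J12L {a : Vc (n+1)} (ha : a ∈ Ch (n+1)) :
    ∫⁻ b in box2 a, ∫⁻ x in box1 b, oR (vdm fun j => x j ^ 2) =
      oR (dn n * vdm fun j => a j ^ 2) := by
  have e1 : ∫⁻ b in box2 a, ∫⁻ x in box1 b, oR (vdm fun j => x j ^ 2) =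
      ∫⁻ b in box2 a, oR (∏ c : Fin n, (2 * (c.val:ℝ) + 1)⁻¹) *
        oR (dps (fun c => s00 n c + 1) b).re := by
    refine setLIntegral_congr_fun (box_meas _ _) fun b hb => ?_
    rw [J1L (mem_box2 ha hb), ENNReal.ofReal_mul (prod_nonneg fun c _ => by positivity)]
  rw [e1, lintegral_const_mul' _ _ (by finiteness)]
  have h := J2 ha (s := fun c => s00 n c + 1) (fun c => by
    rw [add_re, s00_re]; have : (0:ℝ) ≤ c.val := by positivity
    simp; linarith)
  rw [lint_of_int (box_meas _ _) h.1 h.2 (fun x hx => by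
    have := mem_box2 ha hx
    rw [dps_s001_re this, ofReal_re]
    exact mul_nonneg (prod_nonneg fun j _ => (this.1 j).le) (vdm_pos (sq_mono this.2 this.1)).le),
    ← ENNReal.ofReal_mul (prod_nonneg fun c _ => by positivity)]
  congr 1
  rw [s00_cons, prodinv2, re_ofReal_mul, dps_s00_re, dn, prod_mul_distrib]
  ring

def cW : ℕ → ENNReal
  | 0 => 1
  | n+1 => cW n * cK n * oR (dn n)

lemma cK_fin (n : ℕ) : cK n ≠ ⊤ := by unfold cK; finiteness
lemma cK_ne (n : ℕ) : cK n ≠ 0 := by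
  unfold cK
  have : oR Real.pi ≠ 0 := by simp [Real.pi_pos]
  have h2 : oR (2^(2*n+1)) ≠ 0 := by simp
  exact mul_ne_zero (mul_ne_zero (pow_ne_zero _ this) (pow_ne_zero _ this)) h2

lemma cW_fin (n : ℕ) : cW n ≠ ⊤ := by
  induction n with
  | zero => simp [cW]
  | succ n ih => have := cK_fin n; simp only [cW]; finiteness
lemma cW_ne (n : ℕ) : cW n ≠ 0 := by
  induction n with
  | zero => simp [cW]
  | succ n ih => exact mul_ne_zero (mul_ne_zero ih (cK_ne n)) (by simp [dn_pos])

lemma lint_lam_succ2 (f : Mz (n+1) → ENNReal) (hf : Measurable f) :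
    ∫⁻ X, f X ∂(lam (2*(n+1))) =
      ∫⁻ M, ∫⁻ v : Vz n, ∫⁻ u : Vc (2*n+1), f (border (border M v) u) ∂volume ∂volume ∂(lam (2*n)) :=
  (lint_lam_succ (m := 2*n+1) f hf).trans (lint_lam_succ (m := 2*n) _ (meas_border (m := 2*n+1) f hf))

instance : IsEmpty (Pr (2*0)) := ⟨fun p => absurd p.1.1.2 (by simp)⟩

theorem Weyl (n : ℕ) : ∀ f : Mz n → ENNReal, Measurable f → KInv f →
    ∫⁻ X, f X ∂(lam (2*n)) = cW n * ∫⁻ a in Ch n, f (Dmat a) * oR ((vdm fun j => a j ^ 2)^2) := by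
  induction n with
  | zero =>
    intro f hf hK
    have hC : Ch 0 = Set.univ := by ext a; simp [Ch, Subsingleton.strictMono]
    rw [lam, lintegral_map hf toA_meas, hC, restrict_univ, lintegral_unique, lintegral_unique]
    simp only [cW, one_mul]
    have e1 : ∀ a : Vc 0, vdm (fun j => a j ^ 2) = 1 := by intro a; simp [vdm]
    simp only [e1]
    simp [volume_pi]
    congr 1
    ext i; exact absurd i.2 (by simp)
  | succ n ih =>
    intro f hf hK
    have hm2 := meas_border (m := 2*n) _ (meas_border (m := 2*n+1) f hf)
    refine ((lint_lam_succ2 f hf).trans (ih (fun M => ∫⁻ v : Vz n, ∫⁻ u : Vc (2*n+1),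
      f (border (border M v) u)) hm2
      (KInv_border (m := 2*n) _ (meas_border (m := 2*n+1) f hf) (KInv_border (m := 2*n+1) f hf hK)))).trans ?_
    have e1 : ∫⁻ a' in Ch n, (∫⁻ v : Vz n, ∫⁻ u : Vc (2*n+1), f (border (border (Dmat a') v) u)) *
        oR ((vdm fun j => a' j ^ 2)^2) = ∫⁻ a' in Ch n, cK n * ∫⁻ b, ∫⁻ a, I1 a' b * I2 b a *
        (oR (vdm fun j => a' j ^ 2) * (oR (vdm fun j => a j ^ 2) * f (Dmat a))) := by
      refine setLIntegral_congr_fun (Ch_meas n) fun a' ha => ?_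
      rw [Kstep f hf hK ha, mul_assoc]
      congr 1
      have hv := vdm_pos (sq_mono ha.2 ha.1)
      rw [← lintegral_mul_const' _ _ (by finiteness)]
      refine lintegral_congr fun b => ?_
      rw [← lintegral_mul_const' _ _ (by finiteness)]
      refine lintegral_congr fun a => ?_
      have : oR (vdm (fun j => a j ^ 2) / vdm (fun j => a' j ^ 2)) *
          oR ((vdm fun j => a' j ^ 2)^2) =
          oR (vdm fun j => a' j ^ 2) * oR (vdm fun j => a j ^ 2) := by
        rw [← ENNReal.ofReal_mul' (by positivity), ← ENNReal.ofReal_mul hv.le]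
        congr 1; field_simp
      calc _ = I1 a' b * I2 b a * (oR (vdm (fun j => a j ^ 2) / vdm (fun j => a' j ^ 2)) *
          oR ((vdm fun j => a' j ^ 2)^2)) * f (Dmat a) := by ring
        _ = _ := by rw [this]; ring
    refine (congrArg (cW n * ·) e1).trans ?_
    rw [lintegral_const_mul' _ _ (cK_fin n), swapL _ (fun a => oR (vdm fun j => a j ^ 2) * f (Dmat a)) (vsq_meas.ennreal_ofReal)
      ((vsq_meas.ennreal_ofReal).mul (hf.comp Dmat_meas))]
    rw [cW, mul_assoc, mul_assoc]
    congr 2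
    rw [← lintegral_const_mul' _ _ (by finiteness)]
    refine setLIntegral_congr_fun (Ch_meas _) fun a ha => ?_
    have hv := vdm_pos (sq_mono ha.2 ha.1)
    simp only [J12L ha]
    rw [ENNReal.ofReal_mul (dn_pos n).le, sq, ENNReal.ofReal_mul hv.le]
    ring

lemma meas_box {α : Type*} [MeasurableSpace α] {n : ℕ} {l u : α → Vc n} (hl : Measurable l)
    (hu : Measurable u) {G : α × Vc n → ENNReal} (hG : Measurable G) :
    Measurable fun p => ∫⁻ x in bx (l p) (u p), G (p, x) := by
  have h7 : (fun p => ∫⁻ x in bx (l p) (u p), G (p, x)) = fun p => ∫⁻ x,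
      ({q : α × Vc n | q.2 ∈ bx (l q.1) (u q.1)}).indicator G (p, x) := by
    funext p
    rw [← lintegral_indicator (box_meas _ _)]
    rfl
  rw [h7]
  refine Measurable.lintegral_prod_right' (hG.indicator ?_)
  simp only [bx, mem_univ_pi, Set.mem_Ioo, setOf_forall, setOf_and]
  exact MeasurableSet.iInter fun j => (measurableSet_lt (((measurable_pi_apply j).comp hl).comp measurable_fst)
    (by fun_prop)).inter (measurableSet_lt (by fun_prop) (((measurable_pi_apply j).comp hu).comp measurable_fst))

lemma lo_meas : Measurable (lo (n := n)) := by
  refine measurable_pi_lambda _ fun j => ?_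
  unfold lo
  refine cases ?_ (fun i => ?_) j.castSucc
  · simp
  · simp only [cons_succ]; fun_prop

lemma swapG (G : Vc n × Vc (n+1) → ENNReal) (hG : Measurable G) :
    ∫⁻ a' in Ch n, ∫⁻ b, ∫⁻ a, I1 a' b * I2 b a * G (a', a) =
      ∫⁻ a in Ch (n+1), ∫⁻ b in box2 a, ∫⁻ a' in box1 b, G (a', a) := by
  have hI : Measurable fun p : (Vc n × Vc n) × Vc (n+1) =>
      (Ch n).indicator (1 : Vc n → ENNReal) p.1.1 * (I1 p.1.1 p.1.2 * I2 p.1.2 p.2) * G (p.1.1, p.2) := by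
    have h3 : Measurable ((Ch n).indicator (1 : Vc n → ENNReal)) := measurable_one.indicator (Ch_meas n)
    exact ((h3.comp (by fun_prop)).mul ((I1_meas.comp measurable_fst).mul
      (I2_meas.comp (by fun_prop : Measurable fun p : (Vc n × Vc n) × Vc (n+1) =>
        (p.1.2, p.2))))).mul (hG.comp (by fun_prop))
  rw [lint_ind (Ch_meas n)]
  have e1 : ∀ a' : Vc n, (Ch n).indicator 1 a' * ∫⁻ b, ∫⁻ a, I1 a' b * I2 b a * G (a', a) =
      ∫⁻ b, ∫⁻ a, (Ch n).indicator (1 : Vc n → ENNReal) a' * (I1 a' b * I2 b a) * G (a', a) := by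
    intro a'
    have : (Ch n).indicator (1 : Vc n → ENNReal) a' ≠ ⊤ := by
      by_cases h : a' ∈ Ch n <;> simp [h]
    rw [← lintegral_const_mul' _ _ this]
    refine lintegral_congr fun b => ?_
    rw [← lintegral_const_mul' _ _ this]
    refine lintegral_congr fun a => ?_
    ring
  simp only [e1]
  rw [← lintegral_indicator (Ch_meas (n+1))]
  refine (lintegral_lintegral_swap (hI.lintegral_prod_right'.aemeasurable)).trans ?_
  have e2 : ∀ b : Vc n, ∫⁻ a', ∫⁻ a, (Ch n).indicator (1 : Vc n → ENNReal) a' *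
      (I1 a' b * I2 b a) * G (a', a) = ∫⁻ a, ∫⁻ a', (Ch n).indicator (1 : Vc n → ENNReal) a' *
      (I1 a' b * I2 b a) * G (a', a) := fun b => by
    refine lintegral_lintegral_swap ?_
    exact (hI.comp (by fun_prop : Measurable fun p : Vc n × Vc (n+1) =>
          ((p.1, b), p.2))).aemeasurable
  simp only [e2]
  have e3 := (hI.comp (by fun_prop : Measurable fun p : (Vc n × Vc (n+1)) × Vc n =>
          ((p.2, p.1.1), p.1.2))).lintegral_prod_right' (ν := volume)
  refine (lintegral_lintegral_swap e3.aemeasurable).trans ?_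
  refine lintegral_congr fun a => ?_
  simp only [I12]
  by_cases ha : a ∈ Ch (n+1)
  · rw [indicator_of_mem ha, indicator_of_mem ha, ← lintegral_indicator (box_meas _ _)]
    refine lintegral_congr fun b => ?_
    by_cases hb : b ∈ box2 a
    · rw [indicator_of_mem hb, indicator_of_mem hb, lint_ind (box_meas _ _)]
      simp
    · simp [indicator_of_notMem hb]
  · simp [indicator_of_notMem ha]

def yp (y : Vc (n+1)) (c : Fin n) : ℝ := y c.succ - y 0

def qd (t : ℝ) (X : Mt m) : ℂ := if X.det = 0 then 0 else exp (((t * (Real.log |X.det| / 2) : ℝ) : ℂ) * I)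

def pa (t : ℝ) (a : Vc n) : ℂ := exp (((t * ∑ j, Real.log (a j) : ℝ) : ℂ) * I)

def lead (X : Mz (n+1)) : Mz n :=
  (X : Mt (2*n+1+1)).submatrix (fun i => i.castSucc.castSucc) (fun i => i.castSucc.castSucc)

def Xs : (n : ℕ) → Vc n → Mz n → ℂ
  | 0, _, _ => 1
  | n+1, y, X => qd (y 0) X * Xs n (yp y) (lead X)

def Rn : (n : ℕ) → Vc n → (ℂ → ENNReal) → Vc n → ENNReal
  | 0, _, ψ, _ => ψ 1
  | n+1, y, ψ, a => ∫⁻ b in box2 a, ∫⁻ a' in box1 b, Rn n (yp y) (fun χ => ψ (pa (y 0) a * χ)) a'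

lemma pa_meas (t : ℝ) : Measurable (pa (n := n) t) := by unfold pa; fun_prop

lemma det_meas : Measurable fun X : Mt m => X.det := by
  simp only [det_apply']
  refine measurable_sum _ fun σ _ => Measurable.const_mul (measurable_prod _ fun i _ => meas_entry _ _) _

lemma qd_meas (t : ℝ) : Measurable (qd (m := m) t) := by
  have := det_meas (m := m)
  unfold qd
  refine Measurable.ite (measurableSet_eq_fun this measurable_const) measurable_const ?_
  refine Complex.measurable_exp.comp (Measurable.mul_const ?_ _)
  refine Complex.measurable_ofReal.comp (Measurable.const_mul ((Real.measurable_log.comp ?_).div_const _) _)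
  exact continuous_abs.measurable.comp this

lemma lead_meas : Measurable (lead (n := n)) := meas_mat fun i j => meas_entry (m := 2*n+1+1) _ _

lemma lead_border (M : Mz n) (v : Vz n) (u : Vc (2*n+1)) :
    lead (n := n) (border (border M v) u) = M := by
  ext i j; simp [lead]

lemma Xs_meas : ∀ (n : ℕ) (y : Vc n), Measurable (Xs n y)
  | 0, _ => measurable_const
  | n+1, y => (qd_meas _).mul ((Xs_meas n _).comp lead_meas)

lemma Rn_meas : ∀ (n : ℕ) (y : Vc n) {α : Type} [MeasurableSpace α] (ψ : α × ℂ → ENNReal)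
    (_ : Measurable ψ), Measurable fun p : α × Vc n => Rn n y (fun χ => ψ (p.1, χ)) p.2
  | 0, _, _, _, ψ, h => by
      simp only [Rn]; exact h.comp (by fun_prop)
  | n+1, y, α, _, ψ, h => by
      have ih := Rn_meas n (yp y) (α := α × Vc (n+1)) (fun q => ψ (q.1.1, pa (y 0) q.1.2 * q.2))
        (h.comp (by have := pa_meas (n := n+1) (y 0); fun_prop))
      simp only [Rn]
      refine meas_box (α := α × Vc (n+1)) (by fun_prop) (by fun_prop)
        (G := fun q => ∫⁻ a' in box1 q.2, Rn n (yp y) (fun χ => ψ (q.1.1, pa (y 0) q.1.2 * χ)) a') ?_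
      refine meas_box (α := (α × Vc (n+1)) × Vc n) (lo_meas.comp measurable_snd) measurable_snd
        (G := fun q => Rn n (yp y) (fun χ => ψ (q.1.1.1, pa (y 0) q.1.1.2 * χ)) q.2) ?_
      exact ih.comp (by fun_prop : Measurable fun q : ((α × Vc (n+1)) × Vc n) × Vc n => (q.1.1, q.2))

lemma Dmat_det (a : Vc n) : (Dmat a).det = ∏ j, a j ^ 2 := by
  have : (Dmat a).submatrix (e2 n) (e2 n) =
      (blockDiagonal fun j => !![0, a j; -a j, 0]).submatrix (prodComm _ _) (prodComm _ _) := by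
    ext ⟨i, p⟩ ⟨j, q⟩
    simp only [submatrix_apply, Dmat_e2, blockDiagonal_apply, prodComm_apply, Prod.swap]
    fin_cases p <;> fin_cases q <;> by_cases h : i = j <;> simp [h]
  rw [← det_submatrix_equiv_self (e2 n), this, det_submatrix_equiv_self, det_blockDiagonal]
  refine prod_congr rfl fun j _ => ?_
  simp [det_fin_two]; ring

lemma qd_Dmat (t : ℝ) {a : Vc n} (ha : ∀ j, 0 < a j) : qd t (Dmat a) = pa t a := by
  have h : 0 < ∏ j, a j := prod_pos fun j _ => ha j
  rw [qd, pa, Dmat_det, Finset.prod_pow, if_neg (by positivity), abs_of_pos (by positivity), Real.log_pow,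
    Real.log_prod (fun j _ => (ha j).ne')]
  congr 4; push_cast; ring

lemma qd_K (t : ℝ) : KInv (qd (m := m) t) := by
  intro X _ k hk
  have := orth_det hk
  have h0 : k.det ≠ 0 := fun h => by simp [h] at this
  rw [qd, qd, det_mul, det_mul, det_transpose, abs_mul, abs_mul, this]; simp [h0]

def cS : ℕ → ENNReal
  | 0 => 1
  | n+1 => cS n * cK n

lemma cS_fin (n : ℕ) : cS n ≠ ⊤ := by
  induction n with
  | zero => simp [cS]
  | succ n ih => have := cK_fin n; simp only [cS]; finiteness
lemma cS_ne (n : ℕ) : cS n ≠ 0 := by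
  induction n with
  | zero => simp [cS]
  | succ n ih => exact mul_ne_zero ih (cK_ne n)

def bb (M : Mz n) (v : Vz n) (u : Vc (2*n+1)) : Mz (n+1) :=
  border (border M v) u

lemma bb_meas : Measurable fun p : (Mz n × Vz n) × Vc (2*n+1) =>
    bb p.1.1 p.1.2 p.2 :=
  (border_meas (m := 2*n+1)).comp (((border_meas (m := 2*n)).comp measurable_fst).prodMk measurable_snd)

lemma Rn_mul : ∀ (n : ℕ) (y : Vc n) (ψ : ℂ → ENNReal) (c : ENNReal) (_ : c ≠ ⊤) (a : Vc n),
    Rn n y (fun χ => c * ψ χ) a = c * Rn n y ψ a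
  | 0, _, _, _, _, _ => rfl
  | n+1, y, ψ, c, hc, a => by
    simp only [Rn]
    rw [← lintegral_const_mul' _ _ hc]
    refine lintegral_congr fun b => ?_
    rw [← lintegral_const_mul' _ _ hc]
    exact lintegral_congr fun a' => Rn_mul n (yp y) _ c hc a'

lemma Rn_lint : ∀ (n : ℕ) (y : Vc n) {α : Type} [MeasurableSpace α] (μ : Measure α) [SFinite μ]
    (ψ : α × ℂ → ENNReal) (_ : Measurable ψ) (a : Vc n),
    Rn n y (fun χ => ∫⁻ p, ψ (p, χ) ∂μ) a = ∫⁻ p, Rn n y (fun χ => ψ (p, χ)) a ∂μ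
  | 0, _, _, _, _, _, _, _, _ => rfl
  | n+1, y, α, _, μ, _, ψ, h, a => by
    simp only [Rn]
    have hψ : Measurable fun q : α × ℂ => ψ (q.1, pa (y 0) a * q.2) := h.comp (by fun_prop)
    have hR := Rn_meas n (yp y) _ hψ
    have e1 : ∀ a', Rn n (yp y) (fun χ => ∫⁻ p, ψ (p, pa (y 0) a * χ) ∂μ) a' =
        ∫⁻ p, Rn n (yp y) (fun χ => ψ (p, pa (y 0) a * χ)) a' ∂μ :=
      fun a' => Rn_lint n (yp y) μ (fun q => ψ (q.1, pa (y 0) a * q.2)) hψ a'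
    simp only [e1]
    have e2 : ∀ b : Vc n, ∫⁻ a' in box1 b, ∫⁻ p, Rn n (yp y) (fun χ => ψ (p, pa (y 0) a * χ)) a' ∂μ =
        ∫⁻ p, (∫⁻ a' in box1 b, Rn n (yp y) (fun χ => ψ (p, pa (y 0) a * χ)) a') ∂μ := fun b => by
      refine lintegral_lintegral_swap ?_
      exact (hR.comp measurable_swap).aemeasurable
    simp only [e2]
    refine lintegral_lintegral_swap ?_
    have := meas_box (α := Vc n × α) (lo_meas.comp measurable_fst) measurable_fst
      (G := fun q => Rn n (yp y) (fun χ => ψ (q.1.2, pa (y 0) a * χ)) q.2)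
      (hR.comp (by fun_prop : Measurable fun q : (Vc n × α) × Vc n => (q.1.2, q.2)))
    exact this.aemeasurable

lemma KInv_bb (f : Mz (n+1) → ENNReal) (hf : Measurable f) (hK : KInv f) :
    KInv fun M : Mz n => ∫⁻ v : Vz n, ∫⁻ u : Vc (2*n+1), f (bb M v u) :=
  KInv_border (m := 2*n) _ (meas_border (m := 2*n+1) f hf) (KInv_border (m := 2*n+1) f hf hK)

def Fb (t : ℝ) (F : Mz (n+1) × ℂ → ENNReal) (p : Mz n × ℂ) : ENNReal :=
  ∫⁻ v : Vz n, ∫⁻ u : Vc (2*n+1), F (bb p.1 v u, qd t (bb p.1 v u) * p.2)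

lemma Fq_meas (t : ℝ) (F : Mz (n+1) × ℂ → ENNReal) (hF : Measurable F) :
    Measurable fun p : Mz (n+1) × ℂ => F (p.1, qd t p.1 * p.2) := by
  have hq := qd_meas (m := 2*(n+1)) t
  exact hF.comp (by fun_prop)

lemma Fb_meas (t : ℝ) (F : Mz (n+1) × ℂ → ENNReal) (hF : Measurable F) :
    Measurable (Fb t F) := by
  have hFq := Fq_meas t F hF
  unfold Fb
  refine Measurable.lintegral_prod_right' (f := fun q : (Mz n × ℂ) × Vz n =>
        ∫⁻ u : Vc (2*n+1), F (bb q.1.1 q.2 u, qd t (bb q.1.1 q.2 u) * q.1.2)) ?_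
  refine Measurable.lintegral_prod_right' (f := fun q : ((Mz n × ℂ) × Vz n) ×
        Vc (2*n+1) => F (bb q.1.1.1 q.1.2 q.2, qd t (bb q.1.1.1 q.1.2 q.2) * q.1.1.2)) ?_
  have h6 : Measurable fun q : ((Mz n × ℂ) × Vz n) × Vc (2*n+1) =>
      ((q.1.1.1, q.1.2), q.2) :=
    ((measurable_fst.comp (measurable_fst.comp measurable_fst)).prodMk (measurable_snd.comp measurable_fst)).prodMk measurable_snd
  have h7 : Measurable fun q : ((Mz n × ℂ) × Vz n) × Vc (2*n+1) => q.1.1.2 :=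
    measurable_snd.comp (measurable_fst.comp measurable_fst)
  exact hFq.comp ((bb_meas.comp h6).prodMk h7)

theorem Sn (n : ℕ) : ∀ (y : Vc n) (F : Mz n × ℂ → ENNReal), Measurable F →
    (∀ χ, KInv fun X => F (X, χ)) →
    ∫⁻ X, F (X, Xs n y X) ∂(lam (2*n)) =
      cS n * ∫⁻ a in Ch n, oR (vdm fun j => a j ^ 2) * Rn n y (fun χ => F (Dmat a, χ)) a := by
  induction n with
  | zero =>
    intro y F hF hK
    have hC : Ch 0 = Set.univ := by ext a; simp [Ch, Subsingleton.strictMono]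
    simp only [Xs]
    have hF1 : Measurable fun X : Mt (2*0) => F (X, 1) := hF.comp (by fun_prop)
    rw [lam, lintegral_map hF1 toA_meas, hC, restrict_univ, lintegral_unique, lintegral_unique]
    simp only [cS, one_mul]
    have e1 : ∀ a : Vc 0, vdm (fun j => a j ^ 2) = 1 := by intro a; simp [vdm]
    simp only [e1]
    simp [volume_pi, Rn]
    congr 2
    ext i; exact absurd i.2 (by simp)
  | succ n ih =>
    intro y F hF hK
    have hq := qd_meas (m := 2*(n+1)) (y 0)
    have hX := Xs_meas (n+1) y
    have hX' := Xs_meas n (yp y)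
    have hFX : Measurable fun X => F (X, Xs (n+1) y X) := hF.comp (by fun_prop)
    have hFq := Fq_meas (y 0) F hF
    have hfm : ∀ χ, Measurable fun X : Mz (n+1) => F (X, qd (y 0) X * χ) := fun χ =>
      hFq.comp (by fun_prop : Measurable fun X : Mz (n+1) => (X, χ))
    have hfK : ∀ χ, KInv fun X : Mz (n+1) => F (X, qd (y 0) X * χ) := by
      intro χ X hXs k hk
      have := qd_K (y 0) X hXs k hk
      simp only [this]
      exact hK _ X hXs k hk
    have key := ih (yp y) (Fb (y 0) F) (Fb_meas _ F hF) (fun χ => KInv_bb _ (hfm χ) (hfK χ))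
    refine (lint_lam_succ2 _ hFX).trans ?_
    have e0 : ∀ (M : Mz n) (v : Vz n) (u : Vc (2*n+1)),
        Xs (n+1) y (bb M v u) = qd (y 0) (bb M v u) * Xs n (yp y) M := by
      intro M v u
      rw [Xs]; congr 2; exact lead_border M v u
    have e00 : ∀ M : Mz n, ∫⁻ v : Vz n, ∫⁻ u : Vc (2*n+1),
        F (bb M v u, Xs (n+1) y (bb M v u)) = Fb (y 0) F (M, Xs n (yp y) M) := by
      intro M; simp only [e0]; rfl
    refine (lintegral_congr e00).trans ?_
    refine key.trans ?_
    clear key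
    have hD := Dmat_meas (n := n+1)
    have hm1 : Measurable fun p : Vc (n+1) × ℂ => F (Dmat p.1, qd (y 0) (Dmat p.1) * p.2) :=
      hFq.comp (by fun_prop : Measurable fun p : Vc (n+1) × ℂ => (Dmat p.1, p.2))
    have hR := Rn_meas n (yp y) _ hm1
    have hv := vsq_meas (n := n+1)
    have e1 : ∀ a' ∈ Ch n, oR (vdm fun j => a' j ^ 2) * Rn n (yp y) (fun χ => Fb (y 0) F (Dmat a', χ)) a' = cK n * ∫⁻ b, ∫⁻ a,
        I1 a' b * I2 b a * (oR (vdm fun j => a j ^ 2) *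
          Rn n (yp y) (fun χ => F (Dmat a, qd (y 0) (Dmat a) * χ)) a') := by
      intro a' ha
      have hv' := vdm_pos (sq_mono ha.2 ha.1)
      have hk : ∀ χ, Fb (y 0) F (Dmat a', χ) = cK n * ∫⁻ b, ∫⁻ a, I1 a' b * I2 b a *
        oR (vdm (fun j => a j ^ 2) / vdm (fun j => a' j ^ 2)) *
          F (Dmat a, qd (y 0) (Dmat a) * χ) := fun χ => Kstep _ (hfm χ) (hfK χ) ha
      simp only [hk]
      have hI : Measurable fun p : Vc n × Vc (n+1) => I1 a' p.1 * I2 p.1 p.2 *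
          oR (vdm (fun j => p.2 j ^ 2) / vdm (fun j => a' j ^ 2)) :=
        ((I1_meas.comp (by fun_prop : Measurable fun p : Vc n × Vc (n+1) => (a', p.1))).mul
          I2_meas).mul (((hv.comp measurable_snd).div_const _).ennreal_ofReal)
      have hI3 : Measurable fun p : (Vc n × ℂ) × Vc (n+1) => I1 a' p.1.1 * I2 p.1.1 p.2 *
          oR (vdm (fun j => p.2 j ^ 2) / vdm (fun j => a' j ^ 2)) *
          F (Dmat p.2, qd (y 0) (Dmat p.2) * p.1.2) :=
        (hI.comp (by fun_prop : Measurable fun p : (Vc n × ℂ) × Vc (n+1) => (p.1.1, p.2))).mul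
          (hm1.comp (by fun_prop : Measurable fun p : (Vc n × ℂ) × Vc (n+1) => (p.2, p.1.2)))
      rw [Rn_mul _ _ _ _ (cK_fin n), Rn_lint n (yp y) volume (fun q : Vc n × ℂ => ∫⁻ a,
        I1 a' q.1 * I2 q.1 a * oR (vdm (fun j => a j ^ 2) / vdm (fun j => a' j ^ 2)) *
          F (Dmat a, qd (y 0) (Dmat a) * q.2)) hI3.lintegral_prod_right', mul_left_comm]
      congr 1
      rw [← lintegral_const_mul' _ _ (by finiteness)]
      refine lintegral_congr fun b => ?_
      rw [Rn_lint n (yp y) volume (fun q : Vc (n+1) × ℂ =>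
        I1 a' b * I2 b q.1 * oR (vdm (fun j => q.1 j ^ 2) / vdm (fun j => a' j ^ 2)) *
          F (Dmat q.1, qd (y 0) (Dmat q.1) * q.2))
          (hI3.comp (by fun_prop : Measurable fun q : Vc (n+1) × ℂ => ((b, q.2), q.1))),
        ← lintegral_const_mul' _ _ (by finiteness)]
      refine lintegral_congr fun a => ?_
      have hIf : I1 a' b * I2 b a * oR (vdm (fun j => a j ^ 2) / vdm (fun j => a' j ^ 2)) ≠ ⊤ := by
        have h1 : I1 a' b ≠ ⊤ := by unfold I1 indicator; split_ifs <;> simp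
        have h2 : I2 b a ≠ ⊤ := by unfold I2 indicator; split_ifs <;> simp
        finiteness
      rw [Rn_mul _ _ _ _ hIf]
      have : oR (vdm fun j => a' j ^ 2) *
          oR (vdm (fun j => a j ^ 2) / vdm (fun j => a' j ^ 2)) =
          oR (vdm fun j => a j ^ 2) := by
        rw [← ENNReal.ofReal_mul hv'.le]
        congr 1; field_simp
      rw [← this]; ring
    rw [setLIntegral_congr_fun (Ch_meas n) e1, lintegral_const_mul' _ _ (cK_fin n), cS, mul_assoc]
    congr 2
    refine (swapG (fun q => oR (vdm fun j => q.2 j ^ 2) *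
          Rn n (yp y) (fun χ => F (Dmat q.2, qd (y 0) (Dmat q.2) * χ)) q.1) ?_).trans ?_
    · exact ((hv.comp measurable_snd).ennreal_ofReal).mul (hR.comp measurable_swap)
    refine setLIntegral_congr_fun (Ch_meas _) fun a ha => ?_
    simp only [Rn, qd_Dmat _ ha.1]
    rw [← lintegral_const_mul' _ _ (by finiteness)]
    refine lintegral_congr fun b => ?_
    rw [← lintegral_const_mul' _ _ (by finiteness)]

def sy (n : ℕ) (y : Vc n) (c : Fin n) : ℂ := 2 * (c.val : ℂ) + ((y c : ℝ) : ℂ) * I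

lemma sy_re (y : Vc n) (c : Fin n) : (sy n y c).re = 2 * (c.val : ℝ) := by simp [sy]

lemma sy_dps (y : Vc (n+1)) {a : Vc (n+1)} (ha : ∀ j, 0 < a j) :
    dps (sy (n+1) y) a = pa (y 0) a * dps (Fin.cons 0 fun c => sy n (yp y) c + 1 + 1) a := by
  have h1 : sy (n+1) y = fun c => (Fin.cons 0 fun c => sy n (yp y) c + 1 + 1 : Fin (n+1) → ℂ) c +
      ((y 0 : ℝ) : ℂ) * I := by
    ext c
    refine cases ?_ (fun i => ?_) c
    · simp [sy]
    · simp only [sy, yp, cons_succ, val_succ]; push_cast; ring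
  rw [h1, dps_shift _ _ ha]
  congr 1
  rw [pa]
  have h2 : ∀ j, ((a j : ℝ) : ℂ) ^ (((y 0 : ℝ) : ℂ) * I) =
      exp (((Real.log (a j) : ℝ) : ℂ) * (((y 0 : ℝ) : ℂ) * I)) := by
    intro j
    rw [cpow_def_of_ne_zero (by exact_mod_cast (ha j).ne'), ofReal_log (ha j).le]
  simp only [h2]
  rw [← exp_sum]
  congr 1
  push_cast
  rw [← sum_mul]; ring

lemma lint_of_int2 {A : Set Vc n} (hA : MeasurableSet A) {f g : Vc n → ℂ} {I J : ℂ}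
    (a b : ℂ) (hf : IntegrableOn f A) (hI : ∫ x in A, f x = I) (hg : IntegrableOn g A)
    (hJ : ∫ x in A, g x = J) (h0 : ∀ x ∈ A, 0 ≤ (a * f x + b * g x).re) :
    ∫⁻ x in A, oR (a * f x + b * g x).re = oR (a * I + b * J).re ∧
      0 ≤ (a * I + b * J).re := by
  have h1 : IntegrableOn (fun x => a * f x + b * g x) A := (hf.const_mul a).add (hg.const_mul b)
  have h2 : ∫ x in A, (a * f x + b * g x) = a * I + b * J := by
    rw [integral_add (hf.const_mul a) (hg.const_mul b), integral_const_mul, integral_const_mul, hI, hJ]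
  refine ⟨lint_of_int hA h1 h2 h0, ?_⟩
  rw [← h2]
  have h3 : ∫ x in A, (a * f x + b * g x).re = (∫ x in A, (a * f x + b * g x)).re := integral_re h1
  rw [← h3]
  exact setIntegral_nonneg hA h0

lemma JJ (y : Vc n) {a : Vc (n+1)} (ha : a ∈ Ch (n+1)) (A B : ℂ)
    (h0 : ∀ x ∈ Ch n, 0 ≤ (A * dps (s00 n) x + B * dps (sy n y) x).re) :
    ∫⁻ b in box2 a, ∫⁻ x in box1 b, oR (A * dps (s00 n) x + B * dps (sy n y) x).re =
      oR (A * dn n * dps (s00 (n+1)) a + B * ((∏ c, (sy n y c + 1)⁻¹) * (∏ c, (sy n y c + 1 + 1)⁻¹)) *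
        dps (Fin.cons 0 fun c => sy n y c + 1 + 1) a).re ∧
    0 ≤ (A * dn n * dps (s00 (n+1)) a + B * ((∏ c, (sy n y c + 1)⁻¹) * (∏ c, (sy n y c + 1 + 1)⁻¹)) *
        dps (Fin.cons 0 fun c => sy n y c + 1 + 1) a).re := by
  have hp : ∀ c : Fin n, (0:ℝ) ≤ c.val := fun c => by positivity
  have e1 : ∀ b ∈ box2 a, _ := fun b hb =>
    lint_of_int2 (box_meas (lo b) b) A B (J1 (mem_box2 ha hb) (s := s00 n) (fun c => by rw [s00_re]; linarith [hp c])).1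
      (J1 (mem_box2 ha hb) (s := s00 n) (fun c => by rw [s00_re]; linarith [hp c])).2
      (J1 (mem_box2 ha hb) (s := sy n y) (fun c => by rw [sy_re]; linarith [hp c])).1
      (J1 (mem_box2 ha hb) (s := sy n y) (fun c => by rw [sy_re]; linarith [hp c])).2
      (fun x hx => h0 x (mem_box1 (mem_box2 ha hb) hx))
  rw [setLIntegral_congr_fun (box_meas _ _) fun b hb => (e1 b hb).1]
  have h2 := J2 ha (s := fun c => s00 n c + 1) (fun c => by
    rw [add_re, s00_re, one_re]; linarith [hp c])
  have h3 := J2 ha (s := fun c => sy n y c + 1) (fun c => by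
    rw [add_re, sy_re, one_re]; linarith [hp c])
  have h4 := lint_of_int2 (box_meas _ _) (A * ∏ c, (s00 n c + 1)⁻¹) (B * ∏ c, (sy n y c + 1)⁻¹)
    h2.1 h2.2 h3.1 h3.2 (fun b hb => by
      have := (e1 b hb).2
      rw [← mul_assoc, ← mul_assoc] at this
      exact this)
  have e5 : A * dn n * dps (s00 (n+1)) a + B * ((∏ c, (sy n y c + 1)⁻¹) * (∏ c, (sy n y c + 1 + 1)⁻¹)) *
        dps (Fin.cons 0 fun c => sy n y c + 1 + 1) a = (A * ∏ c, (s00 n c + 1)⁻¹) *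
        ((∏ c, (s00 n c + 1 + 1)⁻¹) * dps (Fin.cons 0 fun c => s00 n c + 1 + 1) a) +
        (B * ∏ c, (sy n y c + 1)⁻¹) * ((∏ c, (sy n y c + 1 + 1)⁻¹) *
          dps (Fin.cons 0 fun c => sy n y c + 1 + 1) a) := by
    rw [s00_cons, prodinv1, prodinv2, dn, prod_mul_distrib]; push_cast; ring
  rw [e5]
  refine ⟨?_, h4.2⟩
  rw [← h4.1]
  refine lintegral_congr fun b => ?_
  rw [mul_assoc, mul_assoc]

def cz : ℕ → ℝ
  | 0 => 1
  | n+1 => cz n * dn n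

def cs : (n : ℕ) → Vc n → ℂ
  | 0, _ => 1
  | n+1, y => cs n (yp y) * ((∏ c, (sy n (yp y) c + 1)⁻¹) * (∏ c, (sy n (yp y) c + 1 + 1)⁻¹))

lemma cz_pos (n : ℕ) : 0 < cz n := by
  induction n with
  | zero => simp [cz]
  | succ n ih => exact mul_pos ih (dn_pos n)

lemma pa_norm (t : ℝ) (a : Vc n) : ‖pa t a‖ = 1 := by
  rw [pa, norm_exp_ofReal_mul_I]

lemma Rn_char (n : ℕ) : ∀ (y : Vc n) (ω : ℂ), ‖ω‖ ≤ 1 → ∀ a ∈ Ch n,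
    Rn n y (fun χ => oR (1 + (ω * χ).re)) a =
      oR (cz n * dps (s00 n) a + ω * cs n y * dps (sy n y) a).re ∧
    0 ≤ (cz n * dps (s00 n) a + ω * cs n y * dps (sy n y) a).re := by
  induction n with
  | zero =>
    intro y ω hω a ha
    have h1 : -1 ≤ ω.re := by have := abs_re_le_norm ω; have := abs_le.1 (this.trans hω); exact this.1
    simp [Rn, cz, cs, dps, h1]
    linarith
  | succ n ih =>
    intro y ω hω a ha
    have hω' : ‖ω * pa (y 0) a‖ ≤ 1 := by rw [norm_mul, pa_norm, mul_one]; exact hω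
    have hJ := JJ (yp y) ha (cz n) (ω * pa (y 0) a * cs n (yp y)) (fun x hx => (ih (yp y) _ hω' x hx).2)
    have e : cz (n+1) * dps (s00 (n+1)) a + ω * cs (n+1) y * dps (sy (n+1) y) a =
      cz n * dn n * dps (s00 (n+1)) a + ω * pa (y 0) a * cs n (yp y) *
      ((∏ c, (sy n (yp y) c + 1)⁻¹) * (∏ c, (sy n (yp y) c + 1 + 1)⁻¹)) *
        dps (Fin.cons 0 fun c => sy n (yp y) c + 1 + 1) a := by
      rw [sy_dps y ha.1, cz, cs]; push_cast; ring
    rw [e]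
    refine ⟨?_, hJ.2⟩
    rw [← hJ.1]
    simp only [Rn]
    refine setLIntegral_congr_fun (box_meas _ _) fun b hb => ?_
    refine setLIntegral_congr_fun (box_meas _ _) fun x hx => ?_
    have := (ih (yp y) _ hω' x (mem_box1 (mem_box2 ha hb) hx)).1
    rw [← this]
    simp only [mul_assoc]

lemma cs_ne : ∀ (n : ℕ) (y : Vc n), cs n y ≠ 0
  | 0, _ => by simp [cs]
  | n+1, y => by
    have hp : ∀ c : Fin n, (0:ℝ) ≤ c.val := fun c => by positivity
    refine mul_ne_zero (cs_ne n _) (mul_ne_zero ?_ ?_) <;>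
    · refine prod_ne_zero_iff.2 fun c _ => inv_ne_zero fun h => ?_
      have := congrArg re h
      simp only [add_re, sy_re, one_re, zero_re] at this
      linarith [hp c]

lemma cs_bound : ∀ (n : ℕ), ∃ C : ℝ, ∃ N : ℕ, ∀ y : Vc n, ‖(cs n y)⁻¹‖ ≤ C * (1 + ‖y‖) ^ N
  | 0 => ⟨1, 0, fun y => by simp [cs]⟩
  | n+1 => by
    obtain ⟨C, N, h⟩ := cs_bound n
    have hC : 0 ≤ C := by have := (norm_nonneg _).trans (h 0); simpa using this
    have hy : ∀ y : Vc (n+1), ‖yp y‖ ≤ 2 * ‖y‖ := fun y => by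
      refine (pi_norm_le_iff_of_nonneg (by positivity)).2 fun c => ?_
      have h1 := norm_le_pi_norm y c.succ
      have h2 := norm_le_pi_norm y 0
      calc ‖yp y c‖ ≤ ‖y c.succ‖ + ‖y 0‖ := norm_sub_le _ _
        _ ≤ _ := by linarith
    have hs : ∀ (y : Vc (n+1)) (c : Fin n), ‖sy n (yp y) c‖ ≤ 2 * n + 2 * ‖y‖ := fun y c => by
      have h1 := norm_le_pi_norm (yp y) c
      have h2 : (c.val : ℝ) ≤ n := by exact_mod_cast c.2.le
      have h3 := hy y
      calc ‖sy n (yp y) c‖ ≤ ‖(2 * (c.val:ℂ))‖ + ‖((yp y c : ℝ):ℂ) * I‖ := norm_add_le _ _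
        _ = 2 * c.val + ‖yp y c‖ := by simp
        _ ≤ _ := by linarith
    have hb : ∀ (y : Vc (n+1)) (c : Fin n), ‖sy n (yp y) c + 1‖ ≤ (2 * n + 4) * (1 + ‖y‖) ∧
        ‖sy n (yp y) c + 1 + 1‖ ≤ (2 * n + 4) * (1 + ‖y‖) := fun y c => by
      have h1 := hs y c
      have h2 := norm_add_le (sy n (yp y) c) 1
      have h3 := norm_add_le (sy n (yp y) c + 1) 1
      have h4 : 0 ≤ ‖y‖ := norm_nonneg _
      have h5 : (0:ℝ) ≤ n := by positivity
      rw [norm_one] at h2 h3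
      constructor <;> nlinarith
    refine ⟨C * 2 ^ N * ((2 * n + 4) ^ n * (2 * n + 4) ^ n), N + (n + n), fun y => ?_⟩
    have h4 : 0 ≤ ‖y‖ := norm_nonneg _
    rw [cs, mul_inv, mul_inv, norm_mul, norm_mul]
    simp only [Finset.prod_inv_distrib, inv_inv, norm_prod]
    have e1 : ∏ c : Fin n, ‖sy n (yp y) c + 1‖ ≤ ((2 * n + 4) * (1 + ‖y‖)) ^ n := by
      refine (prod_le_prod (fun c _ => norm_nonneg _) fun c _ => (hb y c).1).trans (by simp)
    have e2 : ∏ c : Fin n, ‖sy n (yp y) c + 1 + 1‖ ≤ ((2 * n + 4) * (1 + ‖y‖)) ^ n := by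
      refine (prod_le_prod (fun c _ => norm_nonneg _) fun c _ => (hb y c).2).trans (by simp)
    have e3 : ‖(cs n (yp y))⁻¹‖ ≤ C * (2 * (1 + ‖y‖)) ^ N := by
      refine (h _).trans ?_
      gcongr
      linarith [hy y]
    calc _ ≤ (C * (2 * (1 + ‖y‖)) ^ N) * (((2 * n + 4) * (1 + ‖y‖)) ^ n * ((2 * n + 4) * (1 + ‖y‖)) ^ n) := by
            gcongr
      _ = _ := by rw [mul_pow, mul_pow]; ring

lemma dps_bound (y : Vc n) {a : Vc n} (ha : a ∈ Ch n) :
    ‖cs n y * dps (sy n y) a‖ ≤ cz n * vdm fun j => a j ^ 2 := by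
  set Z := cs n y * dps (sy n y) a with hZ
  by_cases h : Z = 0
  · rw [h, norm_zero]; exact mul_nonneg (cz_pos n).le (vdm_pos (sq_mono ha.2 ha.1)).le
  have hn : (‖Z‖:ℂ) ≠ 0 := by simpa using h
  have := (Rn_char n y (-(starRingEnd ℂ Z) / ‖Z‖) (by simp [h]) a ha).2
  rw [mul_assoc, ← hZ] at this
  have e : -(starRingEnd ℂ Z) / ‖Z‖ * Z = -((‖Z‖ : ℝ) : ℂ) := by
    rw [div_mul_eq_mul_div, neg_mul, conj_mul']
    field_simp
  rw [e, dps_s00] at this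
  norm_cast at this
  linarith

lemma lcv {E : Type*} [NormedAddCommGroup E] [NormedSpace ℝ E] [FiniteDimensional ℝ E]
    [MeasureSpace E] [BorelSpace E] [(volume : Measure E).IsAddHaarMeasure] (f : E →ₗ[ℝ] E)
    (hf : LinearMap.det f ≠ 0) (F : E → ENNReal) :
    ∫⁻ x, F (f x) = oR |(LinearMap.det f)⁻¹| * ∫⁻ x, F x := by
  have h := map_linearMap_addHaar_eq_smul_addHaar (volume : Measure E) hf
  have he : MeasurableEmbedding f := by
    have := (LinearEquiv.ofIsUnitDet (f := f) (v := Module.finBasis ℝ E) (v' := Module.finBasis ℝ E)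
      (by rw [← LinearMap.det_toMatrix (Module.finBasis ℝ E)] at hf
          exact isUnit_iff_ne_zero.2 hf)).toContinuousLinearEquiv.toHomeomorph.measurableEmbedding
    exact this
  rw [← he.lintegral_map, h, lintegral_smul_measure]; rfl

lemma null_of_line {E : Type*} [NormedAddCommGroup E] [NormedSpace ℝ E] [FiniteDimensional ℝ E]
    [MeasureSpace E] [BorelSpace E] [(volume : Measure E).IsAddHaarMeasure] (f : E → ℝ)
    (hf : Measurable f) (v : E) (hv : ∀ x, {s : ℝ | f (x + s • v) = 0}.Finite) :
    ∀ᵐ x, f x ≠ 0 := by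
  have hm : MeasurableSet {x | f x = 0} := measurableSet_eq_fun hf measurable_const
  have h1 : ∀ s : ℝ, ∫⁻ x, {x | f x = 0}.indicator (1 : E → ENNReal) (x + s • v) =
      volume {x | f x = 0} := fun s => by
    rw [lintegral_add_right_eq_self (fun x => {x | f x = 0}.indicator (1 : E → ENNReal) x), lintegral_indicator_one hm]
  have h2 : ∫⁻ s in Set.Icc (0:ℝ) 1, ∫⁻ x, {x | f x = 0}.indicator (1 : E → ENNReal) (x + s • v) = 0 := by
    rw [lintegral_lintegral_swap]
    · rw [lintegral_eq_zero_iff' (by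
        refine (Measurable.lintegral_prod_right' (f := fun p : E × ℝ => {x | f x = 0}.indicator (1 : E → ENNReal) (p.1 + p.2 • v)) ?_).aemeasurable
        exact (measurable_one.indicator hm).comp (by fun_prop))]
      refine Filter.Eventually.of_forall fun x => ?_
      have : ∀ᵐ s ∂(volume.restrict (Set.Icc (0:ℝ) 1)), s ∉ {s : ℝ | f (x + s • v) = 0} :=
        ae_restrict_of_ae ((hv x).measure_zero volume |> measure_eq_zero_iff_ae_notMem.1)
      refine (lintegral_congr_ae (g := fun _ => 0) (this.mono fun s hs => ?_)).trans (by simp)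
      have h3 : ¬ f (x + s • v) = 0 := hs
      simp [h3]
    · exact ((measurable_one.indicator hm).comp (by fun_prop : Measurable fun p : ℝ × E => p.2 + p.1 • v)).aemeasurable
  simp only [h1, lintegral_const, restrict_apply_univ, Real.volume_Icc] at h2
  rw [ae_iff]
  simpa using h2

lemma det_tri {I α : Type*} [Fintype I] [DecidableEq I] [LinearOrder α] (f : I → α)
    (hf : Function.Injective f) (M : Matrix I I ℝ) (hM : ∀ i j, f j < f i → M i j = 0) :
    M.det = ∏ i, M i i := by
  letI : LinearOrder I := LinearOrder.lift' f hf
  have := det_of_isUpperTriangular (M := M) (fun i j (h : f j < f i) => hM i j h)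
  convert this

def BL (b : Mz n) : Prop := ∀ i j : Fz n, i.val / 2 < j.val / 2 → b i j = 0

abbrev Wn (n : ℕ) := ({ij : Fin n × Fin n // ij.2 < ij.1} × Fin 2 × Fin 2) ⊕ (Fin n × Fin 2 × Fin 2)

def rI : Wn n → Fz n
  | .inl x => e2 n (x.1.1.1, x.2.1)
  | .inr x => e2 n (x.1, x.2.1)
def cI : Wn n → Fz n
  | .inl x => e2 n (x.1.1.2, x.2.2)
  | .inr x => e2 n (x.1, x.2.2)

def xm (M : Mz n) (i : Wn n) : ℝ := M (rI i) (cI i)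

def bm (x : Wn n → ℝ) : Mz n := of fun p q =>
  let P := (e2 n).symm p
  let Q := (e2 n).symm q
  if h : Q.1 < P.1 then x (.inl (⟨(P.1, Q.1), h⟩, P.2, Q.2)) else
    if P.1 = Q.1 then x (.inr (P.1, P.2, Q.2)) else 0

lemma xm_bm (x : Wn n → ℝ) : xm (bm x) = x := by
  funext i
  rcases i with ⟨⟨⟨i, j⟩, h⟩, p, q⟩ | ⟨i, p, q⟩
  · simp only at h
    simp [xm, rI, cI, bm, h]
  · simp [xm, rI, cI, bm]

lemma BL_iff (b : Mz n) : BL b ↔ ∀ P Q : Fin n × Fin 2, P.1 < Q.1 → b (e2 n P) (e2 n Q) = 0 := by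
  constructor
  · intro h P Q hPQ
    refine h _ _ ?_
    rw [e2_div, e2_div]; exact hPQ
  · intro h i j hij
    obtain ⟨P, rfl⟩ := (e2 n).surjective i
    obtain ⟨Q, rfl⟩ := (e2 n).surjective j
    rw [e2_div, e2_div] at hij
    exact h P Q hij

lemma bm_BL (x : Wn n → ℝ) : BL (bm x) := by
  rw [BL_iff]; intro P Q h
  simp [bm, h.not_gt, h.ne]

lemma bm_xm {b : Mz n} (hb : BL b) : bm (xm b) = b := by
  rw [BL_iff] at hb
  ext p q
  obtain ⟨P, rfl⟩ := (e2 n).surjective p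
  obtain ⟨Q, rfl⟩ := (e2 n).surjective q
  simp only [bm, of_apply, symm_apply_apply, xm, rI, cI]
  split_ifs with h1 h2
  · rfl
  · obtain ⟨P1, P2⟩ := P; obtain ⟨Q1, Q2⟩ := Q; simp only at h2; subst h2; rfl
  · exact (hb P Q (lt_of_le_of_ne (not_lt.1 h1) h2)).symm

lemma BL_mul {a b : Mz n} (ha : BL a) (hb : BL b) : BL (a * b) := by
  intro i j hij
  rw [Matrix.mul_apply]
  refine Finset.sum_eq_zero fun k _ => ?_
  rcases lt_or_ge (i.val/2) (k.val/2) with h | h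
  · rw [ha _ _ h, zero_mul]
  · rw [hb _ _ (h.trans_lt hij), mul_zero]

lemma bm_add (x y : Wn n → ℝ) : bm (x + y) = bm x + bm y := by
  ext p q; simp only [bm, of_apply, Matrix.add_apply]; split_ifs <;> simp
lemma bm_smul (c : ℝ) (x : Wn n → ℝ) : bm (c • x) = c • bm x := by
  ext p q; simp only [bm, of_apply, Matrix.smul_apply]; split_ifs <;> simp

def Lm (b c : Mz n) : (Wn n → ℝ) →ₗ[ℝ] (Wn n → ℝ) where
  toFun x := xm (b * bm x * c)
  map_add' x y := by rw [bm_add, Matrix.mul_add, Matrix.add_mul]; rfl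
  map_smul' t x := by rw [bm_smul, Matrix.mul_smul, smul_mul]; rfl

lemma rcI_inj : Function.Injective fun i : Wn n => (rI i, cI i) := by
  intro i j h
  simp only [Prod.mk.injEq] at h
  rcases i with ⟨⟨⟨i, l⟩, h1⟩, p, q⟩ | ⟨i, p, q⟩ <;> rcases j with ⟨⟨⟨i', j'⟩, h1'⟩, p', q'⟩ | ⟨i', p', q'⟩ <;>
    simp only [rI, cI, EmbeddingLike.apply_eq_iff_eq, Prod.mk.injEq] at h <;> (try simp only at h1) <;> (try simp only at h1')
  · obtain ⟨⟨rfl, rfl⟩, rfl, rfl⟩ := h; rfl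
  · obtain ⟨⟨rfl, rfl⟩, rfl, rfl⟩ := h; exact absurd h1 (lt_irrefl _)
  · obtain ⟨⟨rfl, rfl⟩, rfl, rfl⟩ := h; exact absurd h1' (lt_irrefl _)
  · obtain ⟨⟨rfl, rfl⟩, _, rfl⟩ := h; rfl

lemma bm_single (i : Wn n) : bm (Pi.single i 1) = single (rI i) (cI i) (1:ℝ) := by
  have hb : BL (single (rI i) (cI i) (1:ℝ)) := by
    rw [BL_iff]; intro P Q h
    rw [single_apply, if_neg]
    rintro ⟨h1, h2⟩
    rcases i with ⟨⟨⟨i, j⟩, h3⟩, p, q⟩ | ⟨i, p, q⟩ <;>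
      simp only [rI, cI, EmbeddingLike.apply_eq_iff_eq] at h1 h2 <;> subst h1 h2
    · exact lt_asymm h h3
    · exact lt_irrefl _ h
  rw [← bm_xm hb]
  congr 1
  funext j
  rw [xm, single_apply, Pi.single_apply]
  refine if_congr ?_ rfl rfl
  refine ⟨fun h => by rw [h]; simp, fun h => (rcI_inj (Prod.ext h.1 h.2)).symm⟩

lemma Lm_apply (b c : Mz n) (i j : Wn n) :
    LinearMap.toMatrix' (Lm b c) i j = b (rI i) (rI j) * c (cI j) (cI i) := by
  rw [LinearMap.toMatrix'_apply]
  change xm (b * bm (Pi.single j 1) * c) i = _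
  rw [bm_single, xm, Matrix.mul_apply, sum_eq_single (cI j)]
  · simp
  · intro k _ hk
    rw [mul_single_apply_of_ne, zero_mul]
    exact hk
  · simp

lemma lexlt {α β : Type*} [LinearOrder α] [LinearOrder β] {a c : α} {b d : β} (h : toLex (a, b) < toLex (c, d)) :
    a < c ∨ (a = c ∧ b < d) := Prod.Lex.lt_iff.1 h

lemma det_LmL {b : Mz n} (hb : ∀ i j, i < j → b i j = 0) :
    LinearMap.det (Lm b 1) = ∏ i : Wn n, b (rI i) (rI i) := by
  rw [← LinearMap.det_toMatrix', ← det_transpose,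
    det_tri (fun i : Wn n => toLex (rI i, cI i)) (fun i j h => rcI_inj (toLex.injective h))]
  · exact prod_congr rfl fun i _ => by first | rw [transpose_apply, Lm_apply, one_apply_eq, mul_one] | rw [Lm_apply, one_apply_eq, one_mul]
  · intro i j h
    rw [transpose_apply, Lm_apply, Matrix.one_apply]
    rcases lexlt h with h | h
    · rw [hb _ _ h, zero_mul]
    · rw [if_neg (ne_of_gt h.2), mul_zero]

lemma det_LmR {b : Mz n} (hb : ∀ i j, i < j → b i j = 0) :
    LinearMap.det (Lm 1 b) = ∏ i : Wn n, b (cI i) (cI i) := by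
  rw [← LinearMap.det_toMatrix',
    det_tri (fun i : Wn n => toLex (rI i, cI i)) (fun i j h => rcI_inj (toLex.injective h))]
  · exact prod_congr rfl fun i _ => by first | rw [transpose_apply, Lm_apply, one_apply_eq, mul_one] | rw [Lm_apply, one_apply_eq, one_mul]
  · intro i j h
    rw [Lm_apply, Matrix.one_apply]
    rcases lexlt h with h | h
    · rw [if_neg (ne_of_gt h), zero_mul]
    · rw [hb _ _ h.2, mul_zero]

def dz (b : Mz n) (j : Fin n) : ℝ :=
  (of fun p q : Fin 2 => b (e2 n (j, p)) (e2 n (j, q))).det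

def wt (b : Mz n) : ℝ := ∏ j : Fin n, |dz b j| ^ (2*(n-1-j.val))

lemma dz_mul {a b : Mz n} (ha : BL a) (hb : BL b) (j : Fin n) :
    dz (a * b) j = dz a j * dz b j := by
  rw [dz, dz, dz, ← det_mul]
  congr 1
  ext p q
  rw [BL_iff] at ha hb
  rw [of_apply, Matrix.mul_apply, ← (e2 n).sum_comp, Fintype.sum_prod_type,
    sum_eq_single j, Matrix.mul_apply]
  · rfl
  · intro k _ hk
    refine Finset.sum_eq_zero fun r _ => ?_
    rcases lt_or_gt_of_ne hk with h | h
    · rw [hb (k, r) (j, q) h, mul_zero]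
    · rw [ha (j, p) (k, r) h, zero_mul]
  · simp

lemma det_dz {b : Mz n} (hb : BL b) : b.det = ∏ j, dz b j := by
  rw [BL_iff] at hb
  rw [← det_submatrix_equiv_self (e2 n), ← det_transpose,
    BlockTriangular.det_fintype (M := (b.submatrix (e2 n) (e2 n))ᵀ) (b := Prod.fst) (fun i j h => hb j i h)]
  refine prod_congr rfl fun j _ => ?_
  let e : Fin 2 ≃ {a : Fin n × Fin 2 // a.1 = j} :=
    { toFun := fun p => ⟨(j, p), rfl⟩
      invFun := fun a => a.1.2
      left_inv := fun p => rfl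
      right_inv := by rintro ⟨⟨i, p⟩, rfl⟩; rfl }
  rw [dz, ← det_submatrix_equiv_self e, ← det_transpose]
  rfl

lemma wt_mul {a b : Mz n} (ha : BL a) (hb : BL b) : wt (a * b) = wt a * wt b := by
  rw [wt, wt, wt, ← prod_mul_distrib]
  refine prod_congr rfl fun j _ => ?_
  rw [dz_mul ha hb, abs_mul, mul_pow]

lemma lower_BL {b : Mz n} (hb : ∀ i j, i < j → b i j = 0) : BL b := fun i j h =>
  hb i j (by by_contra h'; have := Nat.div_le_div_right (c := 2) (not_lt.1 h'); omega)

lemma dz_lower {b : Mz n} (hb : ∀ i j, i < j → b i j = 0) (j : Fin n) :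
    dz b j = b (e2 n (j,0)) (e2 n (j,0)) * b (e2 n (j,1)) (e2 n (j,1)) := by
  rw [dz, det_fin_two]
  simp only [of_apply]
  rw [hb (e2 n (j,0)) (e2 n (j,1)) (by simp [e2]), zero_mul, sub_zero]

lemma prod_rI {b : Mz n} (hb : ∀ i j, i < j → b i j = 0) :
    |∏ i : Wn n, b (rI i) (rI i)| * wt b = |b.det| ^ (2*n) := by
  have h1 : ∏ i : Wn n, b (rI i) (rI i) = ∏ j : Fin n, dz b j ^ (2*j.val+2) := by
    rw [Fintype.prod_sum_type, Fintype.prod_prod_type, Fintype.prod_prod_type]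
    simp only [rI, Fintype.prod_prod_type, prod_univ_two]
    have h2 : ∀ j : Fin n, b (e2 n (j,0)) (e2 n (j,0)) * b (e2 n (j,0)) (e2 n (j,0)) *
       (b (e2 n (j,1)) (e2 n (j,1)) * b (e2 n (j,1)) (e2 n (j,1))) = dz b j ^ 2 := fun j => by
      rw [dz_lower hb]; ring
    simp only [h2]
    rw [← prod_subtype (Finset.univ.filter fun ij : Fin n × Fin n => ij.2 < ij.1) (by simp)
      (fun ij : Fin n × Fin n => dz b ij.1 ^ 2), prod_filter, Fintype.prod_prod_type, ← prod_mul_distrib]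
    refine prod_congr rfl fun j _ => ?_
    dsimp only
    rw [← prod_filter, Finset.prod_const]
    have : (Finset.univ.filter fun i : Fin n => i < j).card = j.val := by
      rw [← card_Iio j]; congr 1; ext; simp
    rw [this]; ring
  rw [h1, wt, abs_prod, ← prod_mul_distrib, det_dz (lower_BL hb), abs_prod, ← Finset.prod_pow]
  refine prod_congr rfl fun j _ => ?_
  rw [abs_pow, ← pow_add]
  congr 1
  have := j.isLt
  omega

lemma qr {g : Mt m} (hg : g.det ≠ 0) : ∃ b k : Mt m, (∀ i j, i < j → b i j = 0) ∧
    k ∈ orthogonalGroup (Fin m) ℝ ∧ g = b * k ∧ b.det ≠ 0 := by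
  have hgu : IsUnit g := (isUnit_iff_isUnit_det g).2 (isUnit_iff_ne_zero.2 hg)
  have hS : (g * gᴴ).PosDef := PosDef.mul_conjTranspose_self g (vecMul_injective_of_isUnit hgu)
  set M := LDL.lowerInv hS with hM
  have hMd : M.det ≠ 0 := by
    have := isUnit_det_of_invertible M
    exact this.ne_zero
  have hD := LDL.diag_eq_lowerInv_conj hS
  rw [← hM] at hD
  have hpos : (LDL.diag hS).PosDef := by
    rw [hD]
    exact hS.mul_mul_conjTranspose_same (vecMul_injective_of_isUnit ((isUnit_iff_isUnit_det M).2 (isUnit_iff_ne_zero.2 hMd)))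
  have hd : ∀ i, 0 < LDL.diagEntries hS i := by
    have := hpos
    rw [LDL.diag, posDef_diagonal_iff] at this
    exact this
  set d := LDL.diagEntries hS with hdd
  set s : Mt m := Matrix.diagonal fun i => Real.sqrt (d i) with hs
  set r : Mt m := Matrix.diagonal fun i => (Real.sqrt (d i))⁻¹ with hr
  have hsr : s * r = 1 := by
    rw [hs, hr, diagonal_mul_diagonal, ← diagonal_one]
    congr 1; funext i; exact mul_inv_cancel₀ (Real.sqrt_ne_zero'.2 (hd i))
  have hMM : M⁻¹ * M = 1 := nonsing_inv_mul M (isUnit_iff_ne_zero.2 hMd)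
  have hsd : s.det ≠ 0 := fun h => by
    have := congrArg det hsr
    rw [det_mul, h, zero_mul, det_one] at this
    exact zero_ne_one this
  have tri : ∀ i j, i < j → M⁻¹ i j = 0 := by
    have h1 : BlockTriangular M OrderDual.toDual := fun i j h => LDL.lowerInv_triangular hS h
    haveI : Invertible M := LDL.invertibleLowerInv hS
    have h2 := blockTriangular_inv_of_blockTriangular h1
    exact fun i j h => h2 h
  refine ⟨M⁻¹ * s, r * M * g, ?_, ?_, ?_, ?_⟩
  · intro i j h
    rw [hs, mul_diagonal, tri i j h, zero_mul]
  · rw [mem_orth_iff, transpose_mul, transpose_mul]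
    have : r * M * g * (gᵀ * (Mᵀ * rᵀ)) = r * (M * (g * gᴴ) * Mᴴ) * rᵀ := by
      simp only [conjTranspose_eq_transpose_of_trivial, Matrix.mul_assoc]
    rw [this, ← hD, LDL.diag, ← hdd, hr, diagonal_transpose, diagonal_mul_diagonal,
      diagonal_mul_diagonal, ← diagonal_one]
    congr 1; funext i
    have h1 := Real.sqrt_ne_zero'.2 (hd i)
    have h2 := Real.mul_self_sqrt (hd i).le
    rw [inv_mul_eq_div]; nth_rewrite 1 [← h2]; field_simp
  · rw [← Matrix.mul_assoc, ← Matrix.mul_assoc, Matrix.mul_assoc M⁻¹ s r, hsr, Matrix.mul_one, hMM, Matrix.one_mul]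
  · rw [det_mul]
    refine mul_ne_zero ?_ hsd
    intro h
    have := congrArg det hMM
    rw [det_mul, h, zero_mul, det_one] at this
    exact zero_ne_one this

lemma det_line (M : Mt m) : {s : ℝ | (M + s • (1 : Mt m)).det = 0}.Finite := by
  refine ((-M).charpoly.roots.toFinset.finite_toSet).subset fun s hs => ?_
  simp only [mem_coe, Multiset.mem_toFinset]
  rw [Polynomial.mem_roots (charpoly_monic _).ne_zero, Polynomial.IsRoot, eval_charpoly]
  rw [mem_setOf_eq] at hs
  rw [← hs]
  congr 1
  rw [sub_neg_eq_add, add_comm]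
  congr 1
  ext i j; simp [scalar_apply, diagonal_apply, Matrix.one_apply]

lemma ae_det : ∀ᵐ u : Fin m → Vc m, (of u).det ≠ 0 := by
  refine null_of_line (fun u : Fin m → Vc m => (of u).det) (det_meas (m := m)) (1 : Mt m) fun x => ?_
  exact det_line (of x)

lemma bm_meas : Measurable (bm (n := n)) := by
  refine meas_mat fun i j => ?_
  simp only [bm, of_apply]
  split_ifs <;> fun_prop

lemma BL_one : BL (1 : Mz n) := lower_BL fun i j h => one_apply_ne h.ne

lemma ae_bdet : ∀ᵐ x : Wn n → ℝ, (bm x).det ≠ 0 := by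
  refine null_of_line (fun x => (bm x).det) (det_meas.comp bm_meas) (xm 1) fun x => ?_
  simp only [bm_add, bm_smul, bm_xm BL_one]
  exact det_line (bm x)

lemma gleft {b : Mt m} (hb : b.det ≠ 0) (Q : Mt m → ENNReal) :
    ∫⁻ u : Fin m → Vc m, Q (b * of u) =
      oR (|b.det| ^ m)⁻¹ * ∫⁻ u : Fin m → Vc m, Q (of u) := by
  let T : (Fin m → Vc m) ≃ₗ[ℝ] (Fin m → Vc m) := transposeLinearEquiv (Fin m) (Fin m) ℝ ℝ
  let f : (Fin m → Vc m) →ₗ[ℝ] (Fin m → Vc m) :=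
    (T : (Fin m → Vc m) →ₗ[ℝ] _) ∘ₗ (LinearMap.pi fun i => (toLin' b) ∘ₗ LinearMap.proj i) ∘ₗ (T.symm : _ →ₗ[ℝ] (Fin m → Vc m))
  have hf : LinearMap.det f = b.det ^ m := by
    rw [LinearMap.det_conj, LinearMap.det_pi]
    simp
  have h1 := lcv f (by rw [hf]; exact pow_ne_zero _ hb) (fun u => Q (of u))
  rw [hf, abs_inv, abs_pow] at h1
  rw [← h1]
  refine lintegral_congr fun u => ?_
  congr 1

def LQ (Q : Mz n → ENNReal) : ENNReal :=
  ∫⁻ x : Wn n → ℝ, oR (wt (bm x)) * Q (bm x)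

lemma wt_pos {b : Mz n} (hb : BL b) (h : b.det ≠ 0) : 0 < wt b := by
  rw [det_dz hb, prod_ne_zero_iff] at h
  exact prod_pos fun j hj => pow_pos (abs_pos.2 (h j hj)) _

lemma LQ_right {b : Mz n} (hb : ∀ i j, i < j → b i j = 0) (hd : b.det ≠ 0) :
    ∃ δ : ENNReal, δ ≠ 0 ∧ δ ≠ ⊤ ∧ ∀ Q, LQ (fun c => Q (c * b)) = δ * LQ Q := by
  have hbl := lower_BL hb
  have hw := wt_pos hbl hd
  have hdiag : ∀ i, b i i ≠ 0 := by
    have h1 := det_tri (fun i : Fz n => i) Function.injective_id bᵀ (fun i j h => hb j i h)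
    rw [det_transpose] at h1
    rw [h1, prod_ne_zero_iff] at hd
    exact fun i => hd i (Finset.mem_univ _)
  have hf : LinearMap.det (Lm 1 b) ≠ 0 := by
    rw [det_LmR hb, prod_ne_zero_iff]; exact fun i _ => hdiag _
  refine ⟨(oR (wt b))⁻¹ * oR |(LinearMap.det (Lm 1 b))⁻¹|, ?_, ?_, fun Q => ?_⟩
  · refine mul_ne_zero (by simp) ?_
    rw [ne_eq, ENNReal.ofReal_eq_zero, not_le]
    positivity
  · exact mul_ne_top (inv_ne_top.2 (by simpa using hw)) ofReal_ne_top
  · have h1 := lcv (Lm 1 b) hf (fun x => oR (wt (bm x)) * Q (bm x))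
    have h2 : ∀ x, bm (Lm 1 b x) = bm x * b := fun x => by
      change bm (xm (1 * bm x * b)) = _
      rw [Matrix.one_mul, bm_xm (BL_mul (bm_BL x) hbl)]
    simp only [h2, wt_mul (bm_BL _) hbl, mul_comm _ (wt b), ENNReal.ofReal_mul hw.le, mul_assoc] at h1
    rw [lintegral_const_mul' _ _ ofReal_ne_top] at h1
    rw [LQ, LQ, mul_assoc, ← h1, ← mul_assoc, ENNReal.inv_mul_cancel (by simpa using hw) ofReal_ne_top, one_mul]

lemma LQ_left {b : Mz n} (hb : ∀ i j, i < j → b i j = 0) (hd : b.det ≠ 0) (Q : Mz n → ENNReal) :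
    LQ (fun c => oR (|c.det| ^ (2*n))⁻¹ * Q (b * c)) = LQ (fun c => oR (|c.det| ^ (2*n))⁻¹ * Q c) := by
  have hbl := lower_BL hb
  have hw := wt_pos hbl hd
  have h3 := prod_rI hb
  rw [← det_LmL hb] at h3
  have hp : 0 < |b.det| ^ (2*n) := by positivity
  have hf : LinearMap.det (Lm b 1) ≠ 0 := by
    intro h0; rw [h0, abs_zero, zero_mul] at h3; exact hp.ne h3
  have h1 := lcv (Lm b 1) hf (fun x => oR (wt (bm x)) * (oR (|(bm x).det| ^ (2*n))⁻¹ * Q (bm x)))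
  have h2 : ∀ x, bm (Lm b 1 x) = b * bm x := fun x => by
    change bm (xm (b * bm x * 1)) = _
    rw [Matrix.mul_one, bm_xm (BL_mul hbl (bm_BL x))]
  simp only [h2, wt_mul hbl (bm_BL _), det_mul, abs_mul, mul_pow, mul_inv, ENNReal.ofReal_mul hw.le,
    ENNReal.ofReal_mul (inv_nonneg.2 hp.le)] at h1
  have h4 : ∀ x : Wn n → ℝ, oR (wt b) * oR (wt (bm x)) * (oR (|b.det| ^ (2*n))⁻¹ *
      oR (|(bm x).det| ^ (2*n))⁻¹ * Q (b * bm x)) = oR (wt b * (|b.det| ^ (2*n))⁻¹) *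
      (oR (wt (bm x)) * (oR (|(bm x).det| ^ (2*n))⁻¹ * Q (b * bm x))) := fun x => by
    rw [ENNReal.ofReal_mul hw.le]; ring
  simp only [h4] at h1
  rw [lintegral_const_mul' _ _ ofReal_ne_top] at h1
  have h5 : |(LinearMap.det (Lm b 1))⁻¹| = wt b * (|b.det| ^ (2*n))⁻¹ := by
    rw [← h3, abs_inv]; field_simp
  rw [h5] at h1
  have h6 : 0 < wt b * (|b.det| ^ (2*n))⁻¹ := by positivity
  exact (ENNReal.mul_right_inj (by simpa using h6) ofReal_ne_top).1 h1

def RK (Q : Mt m → ENNReal) : Prop := ∀ g, ∀ k ∈ orthogonalGroup (Fin m) ℝ, Q (g * k) = Q g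

def w0 : Mt m → ENNReal := {g : Mt m | (g * gᵀ).trace ≤ 1}.indicator 1

lemma trace_eq (g : Mt m) : (g * gᵀ).trace = ∑ i, ∑ j, g i j ^ 2 := by
  simp [trace, Matrix.mul_apply, sq]

lemma mul_meas : Measurable fun p : Mt m × Mt m => p.1 * p.2 := by
  refine meas_mat fun i j => ?_
  simp only [Matrix.mul_apply]
  exact measurable_sum _ fun k _ => ((meas_entry i k).comp measurable_fst).mul ((meas_entry k j).comp measurable_snd)

lemma inv_meas : Measurable fun p : Mt m => p⁻¹ := by
  refine meas_mat fun i j => ?_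
  simp only [Matrix.inv_def, Matrix.smul_apply, Ring.inverse_eq_inv', smul_eq_mul, adjugate_apply]
  refine det_meas.inv.mul (det_meas.comp (meas_mat fun k l => ?_))
  by_cases h : k = j
  · subst h; simp
  · simp only [updateRow_ne h]; exact meas_entry k l

lemma w0_set : MeasurableSet {g : Mt m | (g * gᵀ).trace ≤ 1} := by
  simp only [trace_eq]
  refine measurableSet_le ?_ measurable_const
  exact measurable_sum _ fun i _ => measurable_sum _ fun j _ => (meas_entry i j).pow_const 2

lemma w0_meas : Measurable (w0 (m := m)) := measurable_one.indicator w0_set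

lemma w0_RK : RK (w0 (m := m)) := by
  intro g k hk
  have : (g * k) * (g * k)ᵀ = g * gᵀ := by
    rw [transpose_mul, Matrix.mul_assoc, ← Matrix.mul_assoc k, (mem_orth_iff k).1 hk, Matrix.one_mul]
  simp only [w0, indicator_apply, mem_setOf_eq, this, Pi.one_apply]

lemma w0_entry {g : Mt m} (h : (g * gᵀ).trace ≤ 1) (i j : Fin m) : |g i j| ≤ 1 := by
  rw [trace_eq] at h
  have h1 : g i j ^ 2 ≤ ∑ j, g i j ^ 2 := single_le_sum (f := fun j => g i j ^ 2) (fun _ _ => sq_nonneg _) (Finset.mem_univ j)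
  have h2 : ∑ j, g i j ^ 2 ≤ ∑ i, ∑ j, g i j ^ 2 := single_le_sum (f := fun i => ∑ j, g i j ^ 2)
    (fun _ _ => sum_nonneg fun _ _ => sq_nonneg _) (Finset.mem_univ i)
  rw [abs_le_one_iff_mul_self_le_one]; nlinarith

lemma w0_int : (∫⁻ u : Fin m → Vc m, w0 (of u)) ≠ 0 ∧ (∫⁻ u : Fin m → Vc m, w0 (of u)) ≠ ⊤ := by
  have : (∫⁻ u : Fin m → Vc m, w0 (of u)) = volume {u : Fin m → Vc m | ((of u) * (of u)ᵀ).trace ≤ 1} := by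
    rw [← lintegral_indicator_one (by exact w0_set (m := m))]; rfl
  rw [this]
  constructor
  · refine (lt_of_lt_of_le ?_ (measure_mono (s := {u : Fin m → Vc m | ∑ i, ∑ j, u i j ^ 2 < 1}) ?_)).ne'
    · refine IsOpen.measure_pos _ ?_ ⟨0, by simp⟩
      exact isOpen_lt (by fun_prop) continuous_const
    · intro u hu
      rw [mem_setOf_eq, trace_eq]; exact le_of_lt hu
  · refine ne_top_of_le_ne_top ?_ (measure_mono (t := Set.Icc (-1) 1) ?_)
    · exact (isCompact_Icc.measure_lt_top).ne
    · intro u hu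
      exact ⟨fun i j => (abs_le.1 (w0_entry hu i j)).1, fun i j => (abs_le.1 (w0_entry hu i j)).2⟩

lemma wt_meas : Measurable fun x : Wn n → ℝ => wt (bm x) := by
  unfold wt
  refine measurable_prod _ fun j _ => Measurable.pow_const (continuous_abs.measurable.comp ?_) _
  unfold dz
  simp only [det_fin_two, of_apply]
  have := fun p q => (meas_entry (m := 2*n) p q).comp (bm_meas (n := n))
  exact ((this _ _).mul (this _ _)).sub ((this _ _).mul (this _ _))

lemma LQ_w0 : LQ (n := n) w0 ≠ 0 ∧ LQ (n := n) w0 ≠ ⊤ := by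
  have hm : Measurable fun x : Wn n → ℝ => oR (wt (bm x)) * w0 (bm x) :=
    wt_meas.ennreal_ofReal.mul (w0_meas.comp bm_meas)
  constructor
  · intro h
    rw [LQ, lintegral_eq_zero_iff hm] at h
    have h2 : ∀ᵐ x : Wn n → ℝ, x ∉ {x : Wn n → ℝ | ∑ i, ∑ j, bm x i j ^ 2 < 1} := by
      filter_upwards [h, ae_bdet] with x hx hd hx2
      have h3 : w0 (bm x) = 1 := by
        rw [w0, indicator_of_mem]; rfl
        rw [mem_setOf_eq, trace_eq]; exact le_of_lt hx2
      rw [h3, mul_one] at hx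
      simp only [Pi.zero_apply, ENNReal.ofReal_eq_zero] at hx
      exact absurd (wt_pos (bm_BL x) hd) (not_lt.2 hx)
    rw [← measure_eq_zero_iff_ae_notMem] at h2
    refine (IsOpen.measure_pos volume ?_ ⟨0, ?_⟩).ne' h2
    · refine isOpen_lt ?_ continuous_const
      refine continuous_finset_sum _ fun i _ => continuous_finset_sum _ fun j _ => Continuous.pow ?_ 2
      simp only [bm, of_apply]
      split_ifs <;> fun_prop
    · have : bm (0 : Wn n → ℝ) = 0 := by ext i j; simp [bm]
      simp [this]
  · have hb : ∀ x : Wn n → ℝ, oR (wt (bm x)) * w0 (bm x) ≤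
        (Set.Icc (-1) 1).indicator (fun _ => oR (∏ j : Fin n, 2 ^ (2*(n-1-j.val)))) x := by
      intro x
      by_cases h : ((bm x) * (bm x)ᵀ).trace ≤ 1
      · have he := w0_entry h
        have hx : x ∈ Set.Icc (-1) 1 := by
          have : ∀ i, |x i| ≤ 1 := fun i => by rw [← xm_bm x]; exact he _ _
          exact ⟨fun i => (abs_le.1 (this i)).1, fun i => (abs_le.1 (this i)).2⟩
        have h1 : w0 (bm x) = 1 := by rw [w0, indicator_of_mem]; rfl; exact h
        rw [indicator_of_mem hx, h1, mul_one]
        refine ofReal_le_ofReal (prod_le_prod (fun j _ => by positivity) fun j _ => ?_)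
        refine pow_le_pow_left₀ (abs_nonneg _) ?_ _
        rw [dz, det_fin_two]
        simp only [of_apply]
        refine (abs_sub _ _).trans ?_
        rw [abs_mul, abs_mul]
        have := fun p q r s => mul_le_one₀ (he p q) (abs_nonneg _) (he r s)
        linarith [this (e2 n (j,0)) (e2 n (j,0)) (e2 n (j,1)) (e2 n (j,1)), this (e2 n (j,0)) (e2 n (j,1)) (e2 n (j,1)) (e2 n (j,0))]
      · have h1 : w0 (bm x) = 0 := by rw [w0, indicator_of_notMem]; exact h
        simp [h1]
    refine ne_top_of_le_ne_top ?_ (lintegral_mono hb)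
    rw [lintegral_indicator measurableSet_Icc, lintegral_const, restrict_apply_univ]
    exact mul_ne_top ofReal_ne_top (isCompact_Icc.measure_lt_top).ne

abbrev Um (m : ℕ) := Fin m → Vc m
local notation:max "Uz" n:max => (Um (2 * n))

def vv (g : Mz n) : ENNReal := w0 g / LQ (fun c => w0 (c * g))

lemma LQ_meas {α : Type*} [MeasurableSpace α] {Q : α × Mz n → ENNReal} (hQ : Measurable Q) :
    Measurable fun p => LQ fun c => Q (p, c) := by
  unfold LQ
  refine Measurable.lintegral_prod_right' (f := fun q : α × (Wn n → ℝ) => oR (wt (bm q.2)) * Q (q.1, bm q.2)) ?_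
  exact (wt_meas.ennreal_ofReal.comp measurable_snd).mul (hQ.comp (measurable_fst.prodMk (bm_meas.comp measurable_snd)))

lemma vv_meas : Measurable (vv (n := n)) := by
  refine w0_meas.div (LQ_meas (Q := fun p : Mz n × Mz n => w0 (p.2 * p.1)) ?_)
  exact w0_meas.comp (mul_meas.comp measurable_swap)

lemma vv_RK : RK (vv (n := n)) := by
  intro g k hk
  simp only [vv, w0_RK g k hk, ← Matrix.mul_assoc]
  simp only [w0_RK _ k hk]

lemma qr_form {g : Mz n} (hg : g.det ≠ 0) {Q : Mz n → ENNReal} (hQ : RK Q) :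
    vv g * LQ (fun c => Q (c * g)) = w0 g * (LQ Q / LQ (n := n) w0) := by
  obtain ⟨b, k, hb, hk, rfl, hd⟩ := qr hg
  obtain ⟨δ, h0, ht, hδ⟩ := LQ_right hb hd
  simp only [vv, ← Matrix.mul_assoc, w0_RK _ k hk, hQ _ k hk]
  rw [hδ, hδ, div_eq_mul_inv, div_eq_mul_inv, ENNReal.mul_inv (Or.inl h0) (Or.inl ht)]
  rw [show w0 b * (δ⁻¹ * (LQ w0)⁻¹) * (δ * LQ Q) = (δ⁻¹ * δ) * (w0 b * (LQ Q * (LQ w0)⁻¹)) by ring,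
    ENNReal.inv_mul_cancel h0 ht, one_mul]

def AA (u : Mz n) : ENNReal := LQ fun c => oR (|c.det| ^ (2*n))⁻¹ * vv (c⁻¹ * u)

lemma AA_const {g : Mz n} (hg : g.det ≠ 0) : AA g = AA (n := n) 1 := by
  obtain ⟨b, k, hb, hk, rfl, hd⟩ := qr hg
  simp only [AA, ← Matrix.mul_assoc, vv_RK _ k hk]
  rw [← LQ_left hb hd (fun c => vv (c⁻¹ * b))]
  simp only [Matrix.mul_inv_rev, Matrix.mul_assoc, Matrix.mul_one,
    nonsing_inv_mul b (isUnit_iff_ne_zero.2 hd)]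

lemma meas_of : Measurable (of : Um m → Mt m) := meas_mat fun i j => by
  simp only [of_apply]; fun_prop

lemma ae_mul {N : Set (Mz n)} (hN : MeasurableSet N) (h0 : ∀ᵐ u : Uz n, of u ∉ N) :
    ∀ᵐ u : Uz n, ∀ᵐ x : Wn n → ℝ, bm x * of u ∉ N := by
  have hm : MeasurableSet {p : (Wn n → ℝ) × Uz n | bm p.1 * of p.2 ∉ N} :=
    (mul_meas.comp ((bm_meas.comp measurable_fst).prodMk (meas_of.comp measurable_snd))) hN.compl
  have h1 : ∀ᵐ x : Wn n → ℝ, ∀ᵐ u : Uz n, bm x * of u ∉ N := by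
    filter_upwards [ae_bdet] with x hx
    have h2 := gleft hx (N.indicator 1)
    have h3 : ∫⁻ u : Uz n, N.indicator (1 : Mz n → ENNReal) (of u) = 0 := by
      rw [lintegral_congr_ae (h0.mono fun u hu => indicator_of_notMem hu _)]; simp
    rw [h3, mul_zero, lintegral_eq_zero_iff] at h2
    · filter_upwards [h2] with u hu hu2
      rw [indicator_of_mem hu2] at hu
      exact one_ne_zero hu
    · exact (measurable_one.indicator hN).comp (mul_meas.comp (measurable_const.prodMk meas_of))
  exact (ae_ae_comm hm).1 h1

lemma ae_LQ {Q Q' : Mz n → ENNReal} (g : Mz n) (h : ∀ᵐ x : Wn n → ℝ, Q (bm x * g) = Q' (bm x * g)) :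
    LQ (fun c => Q (c * g)) = LQ (fun c => Q' (c * g)) :=
  lintegral_congr_ae (h.mono fun x hx => by simp only [hx])

lemma qr_pre {Q Q' : Mz n → ENNReal} (hQ : RK Q) (hm : Measurable Q')
    (hQQ : ∀ᵐ u : Uz n, ∀ᵐ x : Wn n → ℝ, Q (bm x * of u) = Q' (bm x * of u)) :
    (∫⁻ u : Uz n, Q' (of u)) * AA (n := n) 1 = (∫⁻ u : Uz n, w0 (of u)) * (LQ Q / LQ (n := n) w0) := by
  have hmm : Measurable fun p : Uz n × (Wn n → ℝ) =>
      vv (of p.1) * (oR (wt (bm p.2)) * Q' (bm p.2 * of p.1)) :=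
    (vv_meas.comp (meas_of.comp measurable_fst)).mul ((wt_meas.ennreal_ofReal.comp measurable_snd).mul
      (hm.comp (mul_meas.comp ((bm_meas.comp measurable_snd).prodMk (meas_of.comp measurable_fst)))))
  have hmm2 : Measurable fun p : Uz n × (Wn n → ℝ) =>
      Q' (of p.1) * (oR (wt (bm p.2)) * (oR (|(bm p.2).det| ^ (2*n))⁻¹ * vv ((bm p.2)⁻¹ * of p.1))) := by
    refine (hm.comp (meas_of.comp measurable_fst)).mul ((wt_meas.ennreal_ofReal.comp measurable_snd).mul (Measurable.mul ?_
      (vv_meas.comp (mul_meas.comp ((inv_meas.comp (bm_meas.comp measurable_snd)).prodMk (meas_of.comp measurable_fst))))))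
    exact ((continuous_abs.measurable.comp (det_meas.comp (bm_meas.comp measurable_snd))).pow_const _).inv.ennreal_ofReal
  have e1 : ∫⁻ u : Uz n, ∫⁻ x : Wn n → ℝ, vv (of u) * (oR (wt (bm x)) * Q' (bm x * of u)) =
      (∫⁻ u : Uz n, w0 (of u)) * (LQ Q / LQ (n := n) w0) := by
    refine Eq.trans ?_ (lintegral_mul_const (μ := (volume : Measure (Uz n))) _ (w0_meas.comp meas_of))
    refine lintegral_congr_ae ?_
    filter_upwards [hQQ, ae_det] with u hu hd
    rw [← qr_form hd hQ, ae_LQ _ hu]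
    exact lintegral_const_mul _ (wt_meas.ennreal_ofReal.mul (hm.comp (mul_meas.comp (bm_meas.prodMk measurable_const))))
  rw [← e1, lintegral_lintegral_swap hmm.aemeasurable]
  have e2 : ∀ᵐ x : Wn n → ℝ, ∫⁻ u : Uz n, vv (of u) * (oR (wt (bm x)) * Q' (bm x * of u)) =
      ∫⁻ u : Uz n, Q' (of u) * (oR (wt (bm x)) * (oR (|(bm x).det| ^ (2*n))⁻¹ * vv ((bm x)⁻¹ * of u))) := by
    filter_upwards [ae_bdet] with x hx
    have h1 := gleft hx (fun g => vv ((bm x)⁻¹ * g) * (oR (wt (bm x)) * Q' g))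
    simp only [← Matrix.mul_assoc, nonsing_inv_mul _ (isUnit_iff_ne_zero.2 hx), Matrix.one_mul] at h1
    rw [h1, ← lintegral_const_mul' _ _ ofReal_ne_top]
    refine lintegral_congr fun u => ?_
    ring
  rw [lintegral_congr_ae e2, ← lintegral_lintegral_swap hmm2.aemeasurable]
  refine (lintegral_mul_const (μ := (volume : Measure (Uz n))) _ (hm.comp meas_of)).symm.trans ?_
  refine lintegral_congr_ae ?_
  filter_upwards [ae_det] with u hu
  rw [Function.comp_apply, ← AA_const hu]
  refine (lintegral_const_mul _ ?_).symm
  refine wt_meas.ennreal_ofReal.mul (Measurable.mul ?_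
      (vv_meas.comp (mul_meas.comp ((inv_meas.comp bm_meas).prodMk measurable_const))))
  exact ((continuous_abs.measurable.comp (det_meas.comp bm_meas)).pow_const _).inv.ennreal_ofReal

def kap (n : ℕ) : ENNReal := (∫⁻ u : Uz n, w0 (of u)) / LQ (n := n) w0

lemma kap_ne (n : ℕ) : kap n ≠ 0 := ENNReal.div_ne_zero.2 ⟨w0_int.1, LQ_w0.2⟩
lemma kap_fin (n : ℕ) : kap n ≠ ⊤ := div_ne_top w0_int.2 LQ_w0.1

lemma AA_one : AA (n := n) 1 = 1 := by
  have h := qr_pre (n := n) (Q := w0) (Q' := w0) w0_RK w0_meas (by simp)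
  rw [ENNReal.div_self LQ_w0.1 LQ_w0.2, mul_one] at h
  have h2 : (∫⁻ u : Uz n, w0 (of u)) * AA (n := n) 1 = (∫⁻ u : Uz n, w0 (of u)) * 1 := by
    rw [h, mul_one]
  exact (ENNReal.mul_right_inj w0_int.1 w0_int.2).1 h2

lemma QR {Q : Mz n → ENNReal} (hQ : RK Q) (hm : AEMeasurable (fun u : Uz n => Q (of u))) :
    (∫⁻ u : Uz n, Q (of u)) = kap n * LQ Q ∧ AEMeasurable fun x : Wn n → ℝ => Q (bm x) := by
  obtain ⟨Q', hm', hQQ⟩ := hm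
  let Q2 : Mz n → ENNReal := Q'
  have hm2 : Measurable Q2 := hm'
  obtain ⟨N, hN1, hN2, hN3⟩ := exists_measurable_superset_of_null (ae_iff.1 hQQ)
  have hN0 : ∀ᵐ u : Uz n, of u ∉ (N : Set (Mz n)) := measure_eq_zero_iff_ae_notMem.1 hN3
  have h1 := ae_mul (N := N) hN2 hN0
  have h2 : ∀ᵐ u : Uz n, ∀ᵐ x : Wn n → ℝ, Q (bm x * of u) = Q2 (bm x * of u) := by
    filter_upwards [h1] with u hu
    filter_upwards [hu] with x hx
    by_contra h
    exact hx (hN1 h)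
  refine ⟨?_, ?_⟩
  · have h3 := qr_pre hQ hm2 h2
    rw [AA_one, mul_one] at h3
    rw [lintegral_congr_ae hQQ]
    refine Eq.trans ?_ (h3.trans ?_)
    · rfl
    · rw [kap, div_eq_mul_inv, div_eq_mul_inv]; ring
  · obtain ⟨u, hu, hd⟩ := (h2.and ae_det).exists
    obtain ⟨b, k, hb, hk, hg, hbd⟩ := qr hd
    have hbl := lower_BL hb
    have hdiag : ∀ i, b i i ≠ 0 := by
      have h1 := det_tri (fun i : Fz n => i) Function.injective_id bᵀ (fun i j h => hb j i h)
      rw [det_transpose] at h1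
      rw [h1, prod_ne_zero_iff] at hbd
      exact fun i => hbd i (Finset.mem_univ _)
    have hf : LinearMap.det (Lm 1 b) ≠ 0 := by
      rw [det_LmR hb, prod_ne_zero_iff]; exact fun i _ => hdiag _
    have h3 : ∀ x, bm (Lm 1 b x) = bm x * b := fun x => by
      change bm (xm (1 * bm x * b)) = _
      rw [Matrix.one_mul, bm_xm (BL_mul (bm_BL x) hbl)]
    let e := (LinearMap.equivOfDetNeZero _ hf).toContinuousLinearEquiv
    have he : ∀ x, e x = Lm 1 b x := fun x => rfl
    have h4 : ∀ᵐ x : Wn n → ℝ, Q (bm (e x)) = Q2 (bm (e x) * k) := by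
      filter_upwards [hu] with x hx
      rw [hg, ← Matrix.mul_assoc, hQ _ k hk] at hx
      rw [he, h3, hx]
    refine ⟨fun x => Q2 (bm x * k), hm2.comp (mul_meas.comp (bm_meas.prodMk measurable_const)), ?_⟩
    have h5 : QuasiMeasurePreserving e.symm (volume : Measure (Wn n → ℝ)) volume := by
      refine ⟨e.symm.continuous.measurable, ?_⟩
      have := map_linearMap_addHaar_eq_smul_addHaar (volume : Measure (Wn n → ℝ)) (f := (e.symm : (Wn n → ℝ) →ₗ[ℝ] (Wn n → ℝ))) (LinearEquiv.isUnit_det' e.symm.toLinearEquiv).ne_zero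
      exact this ▸ smul_absolutelyContinuous
    filter_upwards [h5.ae h4] with x hx
    simpa using hx

def EE (y : Vc n) (x : Vc n) : ℂ := exp (((∑ c, y c * Real.log (x c) : ℝ) : ℂ) * I)

lemma BL_lead {b : Mz (n+1)} (hb : BL b) : BL (lead b) := fun i j h => hb _ _ h

lemma dz_lead (b : Mz (n+1)) (j : Fin n) : dz (lead b) j = dz b j.castSucc := by
  have h : ∀ p, (e2 n (j, p)).castSucc.castSucc = e2 (n+1) (j.castSucc, p) := fun p => by
    apply Fin.ext; simp [e2]
  unfold dz; congr 1

lemma lead_mul {b X : Mz (n+1)} (hb : BL b) :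
    lead (b * X * bᵀ) = lead b * lead X * (lead b)ᵀ := by
  have h1 : ∀ Y : Mz (n+1), ∀ i : Fz n, ∀ j, (b * Y) (i.castSucc.castSucc : Fin (2*n+1+1)) j =
      ∑ l : Fz n, lead b i l * Y (l.castSucc.castSucc : Fin (2*n+1+1)) j := fun Y i j => by
    rw [Matrix.mul_apply]
    refine (sum_univ_castSucc (n := 2*n+1) _).trans ?_
    rw [sum_univ_castSucc, hb _ (last (2*n)).castSucc, hb _ (last (2*n+1))]
    · simp [lead]
    · have := i.isLt; simp only [val_castSucc, val_last]; omega
    · have := i.isLt; simp only [val_castSucc, val_last]; omega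
  ext i j
  change (b * X * bᵀ) (i.castSucc.castSucc : Fin (2*n+1+1)) (j.castSucc.castSucc : Fin (2*n+1+1)) = _
  rw [Matrix.mul_assoc, h1, Matrix.mul_assoc, Matrix.mul_apply]
  refine Finset.sum_congr rfl fun l _ => ?_
  congr 1
  have := h1 Xᵀ j (l.castSucc.castSucc : Fin (2*n+1+1))
  rw [← transpose_apply (X * bᵀ), transpose_mul, transpose_transpose, this, Matrix.mul_apply]
  exact Finset.sum_congr rfl fun k _ => mul_comm _ _

lemma qd_mul (t : ℝ) {b : Mt m} (X : Mt m) (h : b.det ≠ 0) :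
    qd t (b * X * bᵀ) = exp (((t * Real.log |b.det| : ℝ) : ℂ) * I) * qd t X := by
  unfold qd
  have hd : (b * X * bᵀ).det = b.det ^ 2 * X.det := by
    rw [det_mul, det_mul, det_transpose]; ring
  rw [hd]
  by_cases hX : X.det = 0
  · simp [hX]
  rw [if_neg (mul_ne_zero (pow_ne_zero _ h) hX), if_neg hX, ← exp_add, abs_mul, abs_pow,
    Real.log_mul (by positivity) (by positivity), Real.log_pow]
  congr 1; push_cast; ring

lemma Xs_mul : ∀ (n : ℕ) (y : Vc n) (b X : Mz n), BL b → b.det ≠ 0 →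
    Xs n y (b * X * bᵀ) = EE y (fun c => |dz b c.rev|) * Xs n y X
  | 0, y, b, X, hb, hd => by simp [Xs, EE]
  | n+1, y, b, X, hb, hd => by
    have hd' := hd
    rw [det_dz hb, prod_ne_zero_iff] at hd'
    have hl : (lead b).det ≠ 0 := by
      rw [det_dz (BL_lead hb), prod_ne_zero_iff]
      intro j _; rw [dz_lead]; exact hd' _ (Finset.mem_univ _)
    rw [Xs, Xs, lead_mul hb, Xs_mul n _ _ _ (BL_lead hb) hl, qd_mul _ _ hd]
    have : EE y (fun c => |dz b c.rev|) = exp (((y 0 * Real.log |b.det| : ℝ) : ℂ) * I) *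
        EE (yp y) (fun c => |dz (lead b) c.rev|) := by
      rw [EE, EE, ← exp_add, ← add_mul, ← Complex.ofReal_add]
      congr 3
      rw [det_dz hb, abs_prod, Real.log_prod (fun j hj => abs_ne_zero.2 (hd' j hj)),
        ← Equiv.sum_comp revPerm (fun j => Real.log |dz b j|), sum_univ_succ, sum_univ_succ, mul_add, mul_sum, add_assoc,
        ← sum_add_distrib]
      refine congrArg₂ _ rfl (Finset.sum_congr rfl fun c _ => ?_)
      rw [dz_lead, yp]
      have : c.rev.castSucc = c.succ.rev := by rw [rev_succ]
      simp only [this, revPerm_apply]; ring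
    rw [this]; ring

lemma Xs_one : ∀ (n : ℕ) (y : Vc n), Xs n y 1 = 1
  | 0, y => rfl
  | n+1, y => by
    have : lead (1 : Mz (n+1)) = 1 := by
      ext i j; simp only [lead, submatrix_apply, Matrix.one_apply]
      congr 1; simp [Fin.ext_iff]
    rw [Xs, this, Xs_one, qd]; simp

lemma Xs_bb (y : Vc n) {b : Mz n} (hb : BL b) (hd : b.det ≠ 0) :
    Xs n y (b * bᵀ) = EE y (fun c => |dz b c.rev|) := by
  have := Xs_mul n y b 1 hb hd
  rwa [Matrix.mul_one, Xs_one, mul_one] at this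

lemma Xs_norm : ∀ (n : ℕ) (y : Vc n) (X), ‖Xs n y X‖ ≤ 1
  | 0, y, X => by simp [Xs]
  | n+1, y, X => by
    rw [Xs, norm_mul]
    refine mul_le_one₀ ?_ (norm_nonneg _) (Xs_norm n _ _)
    unfold qd; split_ifs
    · simp
    · rw [norm_exp_ofReal_mul_I]

abbrev Cn (n : ℕ) := {ij : Fin n × Fin n // ij.2 < ij.1} → Fin 2 → Vc 2
abbrev Zn (n : ℕ) := Fin n → Fin 2 → Vc 2

def mkW (p : Cn n × Zn n) : Wn n → ℝ
  | .inl i => p.1 i.1 i.2.1 i.2.2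
  | .inr i => p.2 i.1 i.2.1 i.2.2

lemma mkW_mp : MeasurePreserving (mkW (n := n)) := by
  have hm : Measurable (mkW (n := n)) := by
    refine measurable_pi_lambda _ fun i => ?_
    rcases i with i | i <;> simp only [mkW] <;> fun_prop
  refine ⟨hm, (pi_eq fun s hs => ?_).symm⟩
  rw [Measure.map_apply hm (MeasurableSet.univ_pi hs)]
  have : mkW (n := n) ⁻¹' (Set.univ.pi s) =
      (Set.univ.pi fun i => Set.univ.pi fun p => Set.univ.pi fun q => s (.inl (i, p, q))) ×ˢ
      (Set.univ.pi fun i => Set.univ.pi fun p => Set.univ.pi fun q => s (.inr (i, p, q))) := by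
    ext x
    simp only [Set.mem_preimage, mem_univ_pi, mem_prod]
    exact ⟨fun h => ⟨fun i p q => h (.inl (i,p,q)), fun i p q => h (.inr (i,p,q))⟩,
      fun h i => by rcases i with i | i <;> [exact h.1 _ _ _; exact h.2 _ _ _]⟩
  rw [this, volume_eq_prod, prod_prod]
  simp only [volume_pi_pi, Fintype.prod_sum_type, Fintype.prod_prod_type]

def cR (z : Zn n) : Cn n →ₗ[ℝ] Cn n :=
  LinearMap.pi fun ij => (LinearMap.pi fun p => (vecMulLinear (of (z ij.1.2))).comp (LinearMap.proj p)).comp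
    (LinearMap.proj ij)

lemma cR_det (z : Zn n) : |LinearMap.det (cR z)| = ∏ j : Fin n, |(of (z j)).det| ^ (2*(n-1-j.val)) := by
  rw [cR, LinearMap.det_pi]
  have : ∀ A : Matrix (Fin 2) (Fin 2) ℝ, LinearMap.det (vecMulLinear A) = A.det := fun A => by
    have : vecMulLinear A = toLin' Aᵀ := by
      ext v i; simp
    rw [this, LinearMap.det_toLin', det_transpose]
  simp only [LinearMap.det_pi, this, Finset.prod_const, card_univ, Fintype.card_fin]
  rw [← prod_subtype (Finset.univ.filter fun ij : Fin n × Fin n => ij.2 < ij.1) (by simp)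
      (fun ij : Fin n × Fin n => (of (z ij.2)).det ^ 2), prod_filter, Fintype.prod_prod_type_right, abs_prod]
  refine prod_congr rfl fun j _ => ?_
  dsimp only
  rw [← prod_filter, Finset.prod_const, abs_pow, abs_pow, ← pow_mul]
  have : (Finset.univ.filter fun i : Fin n => j < i).card = n - 1 - j.val := by
    rw [← card_Ioi j]; congr 1; ext; simp
  rw [this]

lemma bm_TZ (c : Cn n) (z : Zn n) : bm (mkW (cR z c, z)) = Tmat c * Zmat z := by
  ext i j
  obtain ⟨P, rfl⟩ := (e2 n).surjective i
  obtain ⟨Q, rfl⟩ := (e2 n).surjective j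
  have hT : ∀ P Q, Tmat c (e2 n P) (e2 n Q) = if h : Q.1 < P.1 then c ⟨(P.1, Q.1), h⟩ P.2 Q.2 else
      if P.1 = Q.1 then (if P.2 = Q.2 then 1 else 0) else 0 := fun P Q => by
    obtain ⟨i, p⟩ := P; obtain ⟨j, q⟩ := Q
    simp only [Tmat, of_apply, e2_div, e2_mod, Fin.val_inj]; rfl
  have hZ : ∀ P Q, Zmat z (e2 n P) (e2 n Q) = if P.1 = Q.1 then z P.1 P.2 Q.2 else 0 := fun P Q => by
    obtain ⟨i, p⟩ := P; obtain ⟨j, q⟩ := Q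
    simp only [Zmat, of_apply, e2_div, e2_mod, Fin.val_inj]
  rw [Matrix.mul_apply, sum_e2]
  simp only [hT, hZ]
  rw [sum_eq_single Q.1 (fun j _ hj => by simp [hj]) (by simp)]
  simp only [if_true, bm, of_apply, symm_apply_apply]
  rcases P with ⟨i, p⟩; rcases Q with ⟨j, q⟩
  by_cases h : j < i
  · simp [h, mkW, cR, vecMul, dotProduct]
  · by_cases h' : i = j
    · subst h'; fin_cases p <;> simp [mkW]
    · simp [h, h']

lemma dz_bm (c : Cn n) (z : Zn n) (j : Fin n) : dz (bm (mkW (c, z))) j = (of (z j)).det := by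
  unfold dz; congr 1
  ext p q; simp [bm, mkW]

def dw (z : Zn n) : ℝ := ∏ j : Fin n, |(of (z j)).det| ^ (2*(n-1-j.val))

lemma wt_bm (c : Cn n) (z : Zn n) : wt (bm (mkW (c, z))) = dw z := by
  simp only [wt, dz_bm, dw]

lemma ae_zdet : ∀ᵐ z : Zn n, ∀ j, (of (z j)).det ≠ 0 := by
  exact ae_all_iff.2 fun j => (quasiMeasurePreserving_eval (fun _ : Fin n => (volume : Measure (Fin 2 → Vc 2))) j).ae (ae_det (m := 2))

lemma LQ_cz {Q : Mz n → ENNReal} (hm : AEMeasurable fun x : Wn n → ℝ => Q (bm x)) :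
    LQ Q = ∫⁻ z : Zn n, oR (dw z ^ 2) * ∫⁻ c : Cn n, Q (Tmat c * Zmat z) := by
  rw [LQ, ← mkW_mp.map_eq, lintegral_map' (by rw [mkW_mp.map_eq]; exact wt_meas.ennreal_ofReal.aemeasurable.mul hm) mkW_mp.measurable.aemeasurable, volume_eq_prod,
    lintegral_prod_symm _ (by
      rw [← volume_eq_prod]
      exact AEMeasurable.comp_quasiMeasurePreserving (wt_meas.ennreal_ofReal.aemeasurable.mul hm) mkW_mp.quasiMeasurePreserving)]
  refine lintegral_congr_ae ?_
  filter_upwards [ae_zdet] with z hz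
  have hp : 0 < dw z := prod_pos fun j _ => pow_pos (abs_pos.2 (hz j)) _
  haveI : (volume : Measure (Fin 2 → Vc 2)).IsAddHaarMeasure := haveI : (volume : Measure Vc 2).IsAddHaarMeasure := inferInstance; instIsAddHaarMeasureForallVolumeOfMeasurableAddOfSigmaFinite
  haveI : (volume : Measure (Cn n)).IsAddHaarMeasure := instIsAddHaarMeasureForallVolumeOfMeasurableAddOfSigmaFinite
  have h0 : |LinearMap.det (cR z)| = dw z := cR_det z
  simp only [wt_bm, ← bm_TZ]
  rw [lintegral_const_mul' _ _ ofReal_ne_top, lcv (cR z) (abs_pos.1 (h0 ▸ hp)) (fun c => Q (bm (mkW (c, z)))),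
    abs_inv, h0, ← mul_assoc, ← ENNReal.ofReal_mul (by positivity)]
  congr 2; field_simp

lemma lint_prod_pi {ι E : Type*} [Fintype ι] [MeasurableSpace E] (μ : Measure E) [SigmaFinite μ] {f : ι → E → ℝ}
    (hf : ∀ i, Integrable (f i) μ) (h0 : ∀ i x, 0 ≤ f i x) :
    ∫⁻ x : ι → E, ∏ i, oR (f i (x i)) ∂(Measure.pi fun _ => μ) = ∏ i, ∫⁻ x, oR (f i x) ∂μ := by
  have h1 := integral_fintype_prod_eq_prod (μ := fun _ : ι => μ) f
  have h2 := Integrable.fintype_prod (μ := fun _ : ι => μ) hf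
  simp only [← ofReal_prod_of_nonneg fun i _ => h0 i _]
  rw [← ofReal_integral_eq_lintegral_ofReal h2 (ae_of_all _ fun x => prod_nonneg fun i _ => h0 i _), h1,
    ofReal_prod_of_nonneg fun i _ => integral_nonneg (h0 i)]
  exact prod_congr rfl fun i _ => ofReal_integral_eq_lintegral_ofReal (hf i) (ae_of_all _ (h0 i))

lemma pi_wd {ι E : Type*} [Fintype ι] [MeasurableSpace E] (μ : Measure E) [SigmaFinite μ] {f : E → ℝ}
    (hf : Integrable f μ) (h0 : ∀ x, 0 ≤ f x) :
    Measure.pi (fun _ : ι => μ.withDensity fun x => oR (f x)) =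
      (Measure.pi fun _ : ι => μ).withDensity fun x => ∏ i, oR (f (x i)) := by
  haveI : IsFiniteMeasure (μ.withDensity fun x => oR (f x)) := isFiniteMeasure_withDensity_ofReal hf.2
  refine pi_eq fun s hs => ?_
  rw [withDensity_apply _ (MeasurableSet.univ_pi hs), ← lintegral_indicator (MeasurableSet.univ_pi hs)]
  have := lint_prod_pi μ (f := fun i => (s i).indicator f) (fun i => hf.indicator (hs i))
    (fun i x => indicator_nonneg (fun x _ => h0 x) x)
  have e : ∀ s : Set E, ∀ x, oR (s.indicator f x) = s.indicator (fun x => oR (f x)) x := fun s x => by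
    by_cases hx : x ∈ s <;> simp [hx]
  refine Eq.trans (lintegral_congr fun x => ?_) (this.trans (prod_congr rfl fun i _ => ?_))
  · by_cases hx : x ∈ Set.univ.pi s
    · rw [indicator_of_mem hx]
      exact prod_congr rfl fun i _ => by rw [indicator_of_mem (hx i (Set.mem_univ i))]
    · rw [indicator_of_notMem hx]
      simp only [mem_univ_pi, not_forall] at hx
      obtain ⟨i, hi⟩ := hx
      exact (prod_eq_zero (Finset.mem_univ i) (by rw [indicator_of_notMem hi, ENNReal.ofReal_zero])).symm
  · simp only [e]; rw [withDensity_apply _ (hs i), lintegral_indicator (hs i)]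

structure Core (n : ℕ) (P : Mz n → ℝ) (σ : Matrix (Fin 2) (Fin 2) ℝ → ℝ) (h : ℝ → ℝ) : Prop where
  fac : IsFactorizing n P σ
  hm : Measurable h
  nn : ∀ t, 0 ≤ h t
  neg : ∀ t, t ≤ 0 → h t = 0
  int0 : Integrable h
  int : ∀ j : Fin n, Integrable fun t => h t * t ^ (2 * j.val)
  sint : Integrable fun z : Fin 2 → Vc 2 => σ (of z)
  law : Measure.map (fun z : Fin 2 → Vc 2 => |(of z).det|)
    (volume.withDensity fun z => oR (σ (of z))) = volume.withDensity fun t => oR (h t)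

lemma Core.push {P σ h} (H : Core n P σ h) {G : Vc n → ENNReal} (hG : Measurable G) :
    ∫⁻ z : Zn n, (∏ j, oR (σ (of (z j)))) * G (fun j => |(of (z j)).det|) =
      ∫⁻ x : Vc n, (∏ j, oR (h (x j))) * G x := by
  have e1 := pi_wd (ι := Fin n) volume H.sint (fun z => H.fac.wnonneg _)
  have e2 := pi_wd (ι := Fin n) volume H.int0 H.nn
  have hd : Measurable (fun z : Fin 2 → Vc 2 => |(of z).det|) :=
    continuous_abs.measurable.comp (det_meas (m := 2))
  haveI : IsFiniteMeasure ((volume : Measure (Fin 2 → Vc 2)).withDensity fun x => oR (σ (of x))) :=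
    isFiniteMeasure_withDensity_ofReal H.sint.2
  have e3 := pi_map_pi (μ := fun _ : Fin n => (volume : Measure (Fin 2 → Vc 2)).withDensity fun x => oR (σ (of x)))
    (f := fun _ z => |(of z).det|) (fun _ => hd.aemeasurable)
  rw [H.law, e1, e2] at e3
  have hd2 : Measurable fun (z : Zn n) j => |(of (z j)).det| :=
    measurable_pi_lambda _ fun j => hd.comp (measurable_pi_apply j)
  have a1 : AEMeasurable (fun z : Zn n => ∏ j, oR (σ (of (z j)))) :=
    aemeasurable_fun_prod _ fun j _ => AEMeasurable.ennreal_ofReal (H.sint.1.aemeasurable.comp_quasiMeasurePreserving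
      (quasiMeasurePreserving_eval (fun _ : Fin n => (volume : Measure (Fin 2 → Vc 2))) j))
  have a2 : Measurable (fun x : Vc n => ∏ j, oR (h (x j))) :=
    Finset.measurable_fun_prod _ fun j _ => (H.hm.comp (measurable_pi_apply j)).ennreal_ofReal
  have e4 := congrArg (fun m => ∫⁻ x, G x ∂m) e3
  rw [lintegral_map hG hd2, lintegral_withDensity_eq_lintegral_mul₀ a2.aemeasurable hG.aemeasurable] at e4
  exact (lintegral_withDensity_eq_lintegral_mul₀ a1 (hG.comp hd2).aemeasurable).symm.trans e4

lemma Core.Pm {P σ h} (H : Core n P σ h) : AEMeasurable fun u : Uz n => oR (P (of u)) :=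
  H.fac.integrable.1.aemeasurable.ennreal_ofReal

lemma Core.rk {P σ h} (H : Core n P σ h) : RK fun g => oR (P g) := fun g k hk => by
  have := H.fac.invariant g 1 (Submonoid.one_mem _) k hk
  rw [Matrix.one_mul] at this; simp only [this]

lemma Core.one {P σ h} (H : Core n P σ h) : ∫⁻ u : Uz n, oR (P (of u)) = 1 := by
  rw [← ofReal_integral_eq_lintegral_ofReal H.fac.integrable (ae_of_all _ fun u => H.fac.nonneg _), H.fac.prob, ENNReal.ofReal_one]

lemma Core.fact {P σ h} (H : Core n P σ h) : ∀ᵐ z : Zn n,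
    oR (dw z ^ 2) * ∫⁻ c : Cn n, oR (P (Tmat c * Zmat z)) =
      oR (dw z) * ∏ j, oR (σ (of (z j))) := by
  obtain ⟨h1, h2⟩ := QR H.rk H.Pm
  have hL : LQ (n := n) (fun g => oR (P g)) ≠ ⊤ := fun ht => by
    rw [H.one, ht, mul_top (kap_ne n)] at h1; exact one_ne_top h1
  have h4 : AEMeasurable (fun p : Zn n × Cn n => oR (P (bm (mkW p.swap)))) := by
    exact AEMeasurable.comp_quasiMeasurePreserving (f := fun p : Zn n × Cn n => mkW p.swap) h2
      ((mkW_mp (n := n)).comp measurePreserving_swap).quasiMeasurePreserving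
  haveI : (volume : Measure (Fin 2 → Vc 2)).IsAddHaarMeasure := haveI : (volume : Measure Vc 2).IsAddHaarMeasure := inferInstance; instIsAddHaarMeasureForallVolumeOfMeasurableAddOfSigmaFinite
  haveI : (volume : Measure (Cn n)).IsAddHaarMeasure := instIsAddHaarMeasureForallVolumeOfMeasurableAddOfSigmaFinite
  have h5 : ∀ᵐ z : Zn n, AEMeasurable fun c : Cn n => oR (P (bm (mkW (c, z)))) := by
    obtain ⟨f, hf, hff⟩ := h4
    rw [volume_eq_prod] at hff
    filter_upwards [ae_ae_of_ae_prod hff] with z hz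
    exact ⟨fun c => f (z, c), hf.comp measurable_prodMk_left, hz⟩
  have h6 : ∀ᵐ z : Zn n, AEMeasurable (fun c : Cn n => P (Tmat c * Zmat z)) := by
    filter_upwards [h5, ae_zdet] with z h5 hz
    have hp : 0 < dw z := prod_pos fun j _ => pow_pos (abs_pos.2 (hz j)) _
    have h0 : |LinearMap.det (cR z)| = dw z := cR_det z
    have := map_linearMap_addHaar_eq_smul_addHaar (volume : Measure (Cn n)) (abs_pos.1 (h0 ▸ hp))
    have h7 : QuasiMeasurePreserving (cR z) volume volume :=
      ⟨(LinearMap.continuous_of_finiteDimensional _).measurable, by rw [this]; exact smul_absolutelyContinuous⟩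
    have := (h5.comp_quasiMeasurePreserving h7).ennreal_toReal
    refine this.congr (ae_of_all _ fun c => ?_)
    simp only [Function.comp, bm_TZ]
    exact toReal_ofReal (H.fac.nonneg _)
  have h8 : ∀ᵐ z : Zn n, oR (dw z ^ 2) * ∫⁻ c : Cn n, oR (P (Tmat c * Zmat z)) < ⊤ := by
    rw [LQ_cz h2] at hL
    refine ae_lt_top' ?_ hL
    have h9 := (wt_meas.ennreal_ofReal.aemeasurable.mul h2).comp_quasiMeasurePreserving
       (f := fun p : Zn n × Cn n => mkW p.swap) ((mkW_mp (n := n)).comp measurePreserving_swap).quasiMeasurePreserving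
    have h10 := AEMeasurable.lintegral_prod_right' h9
    refine h10.congr ?_
    filter_upwards [ae_zdet] with z hz
    have hp : 0 < dw z := prod_pos fun j _ => pow_pos (abs_pos.2 (hz j)) _
    have h0 : |LinearMap.det (cR z)| = dw z := cR_det z
    simp only [Function.comp, Pi.mul_apply, Prod.swap_prod_mk, wt_bm, ← bm_TZ]
    rw [lintegral_const_mul' _ _ ofReal_ne_top, lcv (cR z) (abs_pos.1 (h0 ▸ hp)) (fun c => oR (P (bm (mkW (c, z))))),
      abs_inv, h0, ← mul_assoc, ← ENNReal.ofReal_mul (by positivity)]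
    congr 2; field_simp
  filter_upwards [h6, h8, ae_zdet, H.fac.factor] with z h6 h8 hz hf
  have hp : 0 < dw z := prod_pos fun j _ => pow_pos (abs_pos.2 (hz j)) _
  have hfin : ∫⁻ c : Cn n, oR (P (Tmat c * Zmat z)) ≠ ⊤ := fun ht => by
    rw [ht, mul_top (by simp; positivity)] at h8; exact lt_irrefl _ h8
  rw [integral_eq_lintegral_of_nonneg_ae (ae_of_all _ fun c => H.fac.nonneg _) h6.aestronglyMeasurable] at hf
  have hd : (∏ j : Fin n, ((of (z j)) * (of (z j))ᵀ).det ^ (n - 1 - j.val)) = dw z := by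
    refine prod_congr rfl fun j _ => ?_
    rw [det_mul, det_transpose, pow_mul, sq_abs, sq]
  rw [hd] at hf
  rw [← ofReal_prod_of_nonneg fun j _ => H.fac.wnonneg _, ← hf, ENNReal.ofReal_mul hp.le, ofReal_toReal hfin,
    ← mul_assoc, ← ENNReal.ofReal_mul hp.le, sq]

lemma EE_meas (y : Vc n) : Measurable (EE y) := by
  unfold EE; fun_prop

lemma Core.QRm {P σ h} (H : Core n P σ h) (y : Vc n) {Ψ : ℂ → ENNReal} (hΨ : Measurable Ψ) (hT : ∀ χ, Ψ χ ≠ ⊤) :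
    ∫⁻ u : Uz n, oR (P (of u)) * Ψ (Xs n y (of u * (of u)ᵀ)) =
      kap n * ∫⁻ x : Vc n, oR (∏ c, h (x c) * x c ^ (2 * c.val)) * Ψ (EE y x) := by
  have hXm : Measurable fun u : Mz n => Ψ (Xs n y (u * uᵀ)) := hΨ.comp ((Xs_meas n y).comp
    (mul_meas.comp (measurable_id.prodMk (meas_mat fun i j => meas_entry j i))))
  have hRK : RK fun g : Mz n => oR (P g) * Ψ (Xs n y (g * gᵀ)) := fun g k hk => by
    have := H.rk g k hk
    simp only at this ⊢
    rw [this, transpose_mul, Matrix.mul_assoc, ← Matrix.mul_assoc k, (mem_orth_iff k).1 hk, Matrix.one_mul]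
  obtain ⟨h1, h2⟩ := QR hRK (H.Pm.mul (show Measurable fun u : Uz n => Ψ (Xs n y (of u * (of u)ᵀ)) from hXm).aemeasurable)
  rw [h1, LQ_cz h2]
  congr 1
  let G : Vc n → ENNReal := fun x => oR (∏ j : Fin n, x j ^ (2*(n-1-j.val))) * Ψ (EE y fun c => x c.rev)
  have hG : Measurable G := by
    refine Measurable.mul (by fun_prop) (hΨ.comp ((EE_meas y).comp (by fun_prop)))
  have h3 : ∫⁻ z : Zn n, oR (dw z ^ 2) * ∫⁻ c : Cn n, oR (P (Tmat c * Zmat z)) *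
      Ψ (Xs n y ((Tmat c * Zmat z) * (Tmat c * Zmat z)ᵀ)) =
      ∫⁻ z : Zn n, (∏ j, oR (σ (of (z j)))) * G (fun j => |(of (z j)).det|) := by
    refine lintegral_congr_ae ?_
    filter_upwards [ae_zdet, H.fact] with z hz hf
    have hX : ∀ c : Cn n, Xs n y ((Tmat c * Zmat z) * (Tmat c * Zmat z)ᵀ) = EE y fun c => |(of (z c.rev)).det| := fun c => by
      rw [← bm_TZ, Xs_bb y (bm_BL _) (by
        rw [det_dz (bm_BL _), prod_ne_zero_iff]; intro j _; rw [dz_bm]; exact hz j)]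
      simp only [dz_bm]
    simp only [hX, G]
    rw [lintegral_mul_const' _ _ (hT _), ← mul_assoc, hf]
    change _ = _ * (oR (dw z) * _)
    ring
  rw [h3, H.push hG, ← (mp_reindex (revPerm (n := n))).lintegral_comp (by
    refine Measurable.mul (Finset.measurable_fun_prod _ fun j _ => (H.hm.comp (measurable_pi_apply j)).ennreal_ofReal) hG)]
  refine lintegral_congr fun x => ?_
  simp only [G, revPerm_apply, rev_rev]
  rw [← ofReal_prod_of_nonneg fun j _ => H.nn _, ← mul_assoc, ← ENNReal.ofReal_mul (prod_nonneg fun j _ => H.nn _),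
    ← prod_mul_distrib]
  refine congrArg₂ _ (congrArg _ ?_) rfl
  refine (Equiv.prod_comp revPerm _).symm.trans (prod_congr rfl fun j _ => ?_)
  simp only [revPerm_apply, rev_rev, val_rev]
  congr 3; have := j.isLt; omega

def co (X : Mt m) (p : Pr m) : ℝ := X p.1.1 p.1.2

lemma toA_co {X : Mt m} (hX : Xᵀ = -X) : toA (co X) = X := by
  have h : ∀ i j, X j i = - X i j := fun i j => congrFun (congrFun hX i) j
  ext i j
  simp only [toA, co, of_apply]
  rcases lt_trichotomy i j with hij | rfl | hij
  · simp [hij]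
  · have := h i i; simp; linarith
  · simp [hij, hij.not_gt]; have := h j i; linarith

lemma co_toA (x : Pr m → ℝ) : co (toA x) = x := by
  funext p; simp [co, toA, p.2]

lemma skew_conj {X : Mt m} (hX : Xᵀ = -X) (g : Mt m) : (g * X * gᵀ)ᵀ = -(g * X * gᵀ) := by
  rw [transpose_mul, transpose_mul, hX, transpose_transpose]
  simp [Matrix.mul_assoc]

def Lg (g : Mt m) : (Pr m → ℝ) →ₗ[ℝ] (Pr m → ℝ) where
  toFun x := co (g * toA x * gᵀ)
  map_add' x y := by
    have : toA (x + y) = toA x + toA y := by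
      ext i j; simp only [toA, of_apply, Matrix.add_apply]; split_ifs <;> simp <;> ring
    rw [this, Matrix.mul_add, Matrix.add_mul]; rfl
  map_smul' t x := by
    have : toA (t • x) = t • toA x := by
      ext i j; simp only [toA, of_apply, Matrix.smul_apply]; split_ifs <;> simp
    rw [this, Matrix.mul_smul, smul_mul]; rfl

lemma Lg_app (g : Mt m) (x : Pr m → ℝ) : Lg g x = co (g * toA x * gᵀ) := rfl

lemma toA_Lg (g : Mt m) (x : Pr m → ℝ) : toA (Lg g x) = g * toA x * gᵀ :=
  toA_co (skew_conj (toA_skew x) g)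

lemma Lg_mul (g k : Mt m) : Lg (g * k) = Lg g ∘ₗ Lg k := by
  refine LinearMap.ext fun x => ?_
  rw [LinearMap.comp_apply, Lg_app, Lg_app g, toA_Lg, transpose_mul]; simp only [Matrix.mul_assoc]

lemma Lg_one : Lg (1 : Mt m) = LinearMap.id := by
  refine LinearMap.ext fun x => ?_
  rw [Lg_app, transpose_one, Matrix.mul_one, Matrix.one_mul, co_toA]; rfl

def jg (g : Mt m) : ℝ := LinearMap.det (Lg g)

lemma jg_mul (g k : Mt m) : jg (g * k) = jg g * jg k := by
  rw [jg, Lg_mul, LinearMap.det_comp]; rfl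

lemma Lg_mat (g : Mt m) (p q : Pr m) : LinearMap.toMatrix' (Lg g) p q =
    g p.1.1 q.1.1 * g p.1.2 q.1.2 - g p.1.1 q.1.2 * g p.1.2 q.1.1 := by
  rw [LinearMap.toMatrix'_apply]
  change co (g * toA (Pi.single q 1) * gᵀ) p = _
  have : toA (Pi.single q (1:ℝ)) = vecMulVec (Pi.single q.1.1 1) (Pi.single q.1.2 1) -
      vecMulVec (Pi.single q.1.2 1) (Pi.single q.1.1 1) := by
    refine Eq.trans (congrArg toA ?_) (toA_co ?_)
    · obtain ⟨⟨a, b⟩, hq⟩ := q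
      funext ⟨⟨i, j⟩, hp⟩
      simp only at hp hq
      simp only [co, Matrix.sub_apply, vecMulVec_apply, Pi.single_apply, Subtype.mk.injEq, Prod.mk.injEq]
      have : ¬ (i = b ∧ j = a) := by rintro ⟨rfl, rfl⟩; exact lt_asymm hp hq
      by_cases h1 : i = a <;> by_cases h2 : j = b <;> by_cases h3 : i = b <;> by_cases h4 : j = a <;> simp_all
    · rw [transpose_sub, transpose_vecMulVec, transpose_vecMulVec, neg_sub]
  rw [this, Matrix.mul_sub, Matrix.sub_mul, mul_vecMulVec, mul_vecMulVec, vecMulVec_mul, vecMulVec_mul]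
  simp [co, vecMulVec_apply, vecMul_transpose]

lemma jg_T (g : Mt m) : jg gᵀ = jg g := by
  rw [jg, jg, ← LinearMap.det_toMatrix', ← LinearMap.det_toMatrix', ← det_transpose]
  congr 1
  ext p q
  rw [transpose_apply, Lg_mat, Lg_mat]; simp only [transpose_apply]; ring

lemma jg_ne {g : Mt m} (hg : g.det ≠ 0) : jg g ≠ 0 := fun h => by
  have := jg_mul g g⁻¹
  rw [mul_nonsing_inv _ (isUnit_iff_ne_zero.2 hg), h, zero_mul, jg, Lg_one, LinearMap.det_id] at this
  exact one_ne_zero this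

lemma jg_K {k : Mt m} (hk : k ∈ orthogonalGroup (Fin m) ℝ) : |jg k| = 1 := by
  have := jg_mul k kᵀ
  rw [(mem_orth_iff k).1 hk, jg_T, jg, Lg_one, LinearMap.det_id] at this
  rcases mul_self_eq_one_iff.1 this.symm with h | h <;> simp [h]

lemma conj_meas : Measurable fun p : Mt m × Mt m => p.1 * p.2 * p.1ᵀ :=
  mul_meas.comp (mul_meas.prodMk (meas_mat fun i j => (meas_entry j i).comp measurable_fst))

lemma lam_cv {g : Mt m} (hg : g.det ≠ 0) {F : Mt m → ENNReal} (hF : Measurable F) :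
    ∫⁻ X, F (g * X * gᵀ) ∂(lam m) = oR |(jg g)⁻¹| * ∫⁻ X, F X ∂(lam m) := by
  have hm : Measurable fun X => F (g * X * gᵀ) := hF.comp (conj_meas.comp (measurable_const.prodMk measurable_id))
  rw [lam, lintegral_map hm toA_meas, lintegral_map hF toA_meas]
  simp only [← toA_Lg]
  exact lcv (Lg g) (jg_ne hg) (fun x => F (toA x))

lemma lam_K {k : Mt m} (hk : k ∈ orthogonalGroup (Fin m) ℝ) {F : Mt m → ENNReal} (hF : Measurable F) :
    ∫⁻ X, F (k * X * kᵀ) ∂(lam m) = ∫⁻ X, F X ∂(lam m) := by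
  have h : k.det ≠ 0 := fun h => by have := orth_det hk; simp [h] at this
  rw [lam_cv h hF, abs_inv, jg_K hk]; simp

lemma jg_meas : Measurable (jg (m := m)) := by
  have : (jg (m := m)) = fun g => (of fun p q : Pr m => g p.1.1 q.1.1 * g p.1.2 q.1.2 - g p.1.1 q.1.2 * g p.1.2 q.1.1).det := by
    funext g; rw [jg, ← LinearMap.det_toMatrix']; congr 1; ext p q; rw [Lg_mat]; rfl
  rw [this]
  simp only [det_apply', of_apply]
  refine measurable_sum _ fun s _ => measurable_const.mul (measurable_prod _ fun p _ => ?_)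
  exact ((meas_entry _ _).mul (meas_entry _ _)).sub ((meas_entry _ _).mul (meas_entry _ _))

def Kw (w : Mz n → ENNReal) (Y g : Mz n) : ENNReal := oR |(jg g)⁻¹| * w (g⁻¹ * Y * (g⁻¹)ᵀ)

lemma conj_inv_meas : Measurable fun p : Mt m × Mt m => p.2⁻¹ * p.1 * (p.2⁻¹)ᵀ := by
  have h1 : Measurable fun p : Mt m × Mt m => p.2⁻¹ := (inv_meas (m := m)).comp measurable_snd
  have h2 : Measurable fun p : Mt m × Mt m => (p.2⁻¹, p.1) := h1.prodMk measurable_fst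
  exact Measurable.comp (g := fun p : Mt m × Mt m => p.1 * p.2 * p.1ᵀ) (f := fun p : Mt m × Mt m => (p.2⁻¹, p.1)) conj_meas h2

lemma Kw_meas {w : Mz n → ENNReal} (hw : Measurable w) : Measurable fun p : Mz n × Mz n => Kw w p.1 p.2 := by
  have h4 : Measurable fun g : Mz n => oR |(jg g)⁻¹| :=
    (continuous_abs.measurable.comp (jg_meas (m := 2*n)).inv).ennreal_ofReal
  exact (h4.comp measurable_snd).mul (hw.comp conj_inv_meas)

def w2 (P : Mz n → ℝ) (w : Mz n → ENNReal) (Y : Mz n) : ENNReal :=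
  ∫⁻ u : Uz n, oR (P (of u)) * Kw w Y (of u)

lemma w2_in {w : Mz n → ENNReal} (hw : Measurable w) : Measurable fun p : Mz n × Uz n => Kw w p.1 (of p.2) :=
  Kw_meas hw

lemma w2_meas {P σ h} (H : Core n P σ h) {w : Mz n → ENNReal} (hw : Measurable w) : Measurable (w2 P w) := by
  have e : w2 P w = fun Y => ∫⁻ u : Uz n, H.Pm.mk _ u *
    Kw w Y (of u) := by
    funext Y
    refine lintegral_congr_ae ?_
    filter_upwards [H.Pm.ae_eq_mk] with u hu
    rw [hu]
  rw [e]
  refine Measurable.lintegral_prod_right' (ν := volume) (f := fun p : Mz n × Uz n => H.Pm.mk _ p.2 *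
    Kw w p.1 (of p.2)) ?_
  exact (H.Pm.measurable_mk.comp measurable_snd).mul (w2_in hw)

lemma w2_K {P σ h} (H : Core n P σ h) (w : Mz n → ENNReal) : KInv (w2 P w) := by
  intro Y _ k hk
  have hd : k.det ≠ 0 := fun h => by have := orth_det hk; simp [h] at this
  have := gleft hd fun g => oR (P g) * Kw w (k * Y * kᵀ) g
  rw [orth_det hk] at this
  simp only [one_pow, inv_one, ENNReal.ofReal_one, one_mul] at this
  rw [w2, w2, ← this]
  refine lintegral_congr fun u => ?_
  have hp : P (k * of u) = P (of u) := by
    have := H.fac.invariant (of u) k hk 1 (Submonoid.one_mem _)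
    rwa [Matrix.mul_one] at this
  have hkk : k⁻¹ * k = 1 := nonsing_inv_mul _ (isUnit_iff_ne_zero.2 hd)
  have hi : ∀ g : Mz n, (g⁻¹ * k⁻¹) * (k * Y * kᵀ) * (g⁻¹ * k⁻¹)ᵀ = g⁻¹ * Y * (g⁻¹)ᵀ := fun g => by
    have e : (g⁻¹ * k⁻¹) * (k * Y * kᵀ) * (g⁻¹ * k⁻¹)ᵀ = g⁻¹ * (k⁻¹ * k) * Y * ((k⁻¹ * k)ᵀ * (g⁻¹)ᵀ) := by
      simp only [transpose_mul, Matrix.mul_assoc]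
    rw [e, hkk]; simp
  rw [hp, Kw, Kw, jg_mul, Matrix.mul_inv_rev, hi, mul_inv, abs_mul, abs_inv, jg_K hk]
  simp

lemma idA {P σ h} (H : Core n P σ h) {w F : Mz n → ENNReal} (hw : Measurable w) (hF : Measurable F) :
    ∫⁻ Y, F Y * w2 P w Y ∂(lam (2*n)) = ∫⁻ u : Uz n, oR (P (of u)) *
      ∫⁻ X, w X * F (of u * X * (of u)ᵀ) ∂(lam (2*n)) := by
  have hin : ∀ Y, Measurable fun u : Uz n => Kw w Y (of u) :=
    fun Y => Measurable.comp (g := fun p : Mz n × Uz n => Kw w p.1 (of p.2)) (f := fun u => (Y, u))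
      (w2_in hw) (measurable_const.prodMk measurable_id)
  have e : ∀ Y, F Y * w2 P w Y = ∫⁻ u : Uz n, F Y * (H.Pm.mk _ u *
    Kw w Y (of u)) := fun Y => by
    refine Eq.trans ?_ (lintegral_const_mul (F Y) (H.Pm.measurable_mk.mul (hin Y))).symm
    congr 1
    refine lintegral_congr_ae ?_
    filter_upwards [H.Pm.ae_eq_mk] with u hu
    rw [hu]; rfl
  simp only [e]
  refine (lintegral_lintegral_swap ?_).trans ?_
  · exact ((hF.comp measurable_fst).mul ((H.Pm.measurable_mk.comp measurable_snd).mul (w2_in hw))).aemeasurable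
  · refine lintegral_congr_ae ?_
    filter_upwards [H.Pm.ae_eq_mk, ae_det (m := 2*n)] with u hu hd
    rw [← hu]
    have hwu : Measurable fun Y : Mz n => w ((of u)⁻¹ * Y * ((of u)⁻¹)ᵀ) :=
      hw.comp (Measurable.comp (g := fun p : Mz n × Mz n => p.1 * p.2 * p.1ᵀ) (f := fun Y => ((of u)⁻¹, Y))
        conj_meas (measurable_const.prodMk measurable_id))
    have := lam_cv hd (F := fun Y => F Y * w ((of u)⁻¹ * Y * ((of u)⁻¹)ᵀ)) (hF.mul hwu)
    have e2 : ∀ X : Mz n, (of u)⁻¹ * (of u * X * (of u)ᵀ) * ((of u)⁻¹)ᵀ = X := fun X => by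
      have hkk : (of u)⁻¹ * of u = 1 := nonsing_inv_mul _ (isUnit_iff_ne_zero.2 hd)
      have e : (of u)⁻¹ * (of u * X * (of u)ᵀ) * ((of u)⁻¹)ᵀ =
        ((of u)⁻¹ * of u) * X * ((of u)⁻¹ * of u)ᵀ := by simp only [transpose_mul, Matrix.mul_assoc]
      rw [e, hkk]; simp
    simp only [e2] at this
    simp only [mul_comm (w _)]
    rw [this, ← mul_assoc]
    refine Eq.trans ?_ (lintegral_const_mul _ (hF.mul hwu))
    exact lintegral_congr fun Y => by rw [Kw]; ring

lemma Xs_gK {w : Mz n → ENNReal} (hw : Measurable w) (hK : KInv w) (y : Vc n) {G : ℂ → ENNReal} (hG : Measurable G)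
    {g : Mz n} (hg : g.det ≠ 0) : ∫⁻ X, w X * G (Xs n y (g * X * gᵀ)) ∂(lam (2*n)) =
      ∫⁻ X, w X * G (Xs n y (g * gᵀ) * Xs n y X) ∂(lam (2*n)) := by
  obtain ⟨b, k, hb, hk, rfl, hd⟩ := qr hg
  have hB : BL b := lower_BL hb
  have hkk : k * kᵀ = 1 := (mem_orth_iff k).1 hk
  have e1 : (b * k) * (b * k)ᵀ = b * bᵀ := by
    have : (b * k) * (b * k)ᵀ = b * (k * kᵀ) * bᵀ := by simp only [transpose_mul, Matrix.mul_assoc]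
    rw [this, hkk, Matrix.mul_one]
  have e2 : ∀ X, (b * k) * X * (b * k)ᵀ = b * (k * X * kᵀ) * bᵀ := fun X => by simp only [transpose_mul, Matrix.mul_assoc]
  rw [e1, Xs_bb y hB hd]
  have hm : Measurable fun X => w X * G (EE y (fun c => |dz b c.rev|) * Xs n y X) :=
    hw.mul (hG.comp (measurable_const.mul (Xs_meas n y)))
  rw [← lam_K hk hm]
  refine lintegral_congr_ae ?_
  filter_upwards [lam_skew (2*n)] with X hX
  rw [e2, Xs_mul n y _ _ hB hd, hK X hX k hk]

def re1 (ω χ : ℂ) : ENNReal := oR (1 + (ω * χ).re)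

lemma re1_meas (ω : ℂ) : Measurable (re1 ω) := by unfold re1; fun_prop

lemma re1_le {ω χ ξ : ℂ} (h1 : ‖ω‖ ≤ 1) (h2 : ‖χ‖ ≤ 1) : re1 ω (ξ * χ) ≤ oR (1 + ‖ξ‖) := by
  have h := re_le_norm (ω * (ξ * χ))
  rw [norm_mul, norm_mul] at h
  refine ofReal_le_ofReal ?_
  have h3 : ‖ξ‖ * ‖χ‖ ≤ ‖ξ‖ := mul_le_of_le_one_right (norm_nonneg _) h2
  have h4 : ‖ω‖ * (‖ξ‖ * ‖χ‖) ≤ ‖ξ‖ * ‖χ‖ := mul_le_of_le_one_left (by positivity) h1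
  linarith

lemma SnR {w : Mz n → ENNReal} (hw : Measurable w) (hK : KInv w) (hi : ∫⁻ X, w X ∂(lam (2*n)) ≠ ⊤)
    (y : Vc n) {ω : ℂ} (hω : ‖ω‖ ≤ 1) : ∫⁻ X, w X * re1 ω (Xs n y X) ∂(lam (2*n)) =
      cS n * ∫⁻ a in Ch n, w (Dmat a) * oR (vdm fun j => a j ^ 2) *
        oR (cz n * vdm (fun j => a j ^ 2) + (ω * (cs n y * dps (sy n y) a)).re) := by
  rw [Sn n y (fun p => w p.1 * re1 ω p.2) ((hw.comp measurable_fst).mul ((re1_meas ω).comp measurable_snd))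
    (fun χ X hX k hk => by simp only [hK X hX k hk])]
  congr 1
  have hfin : ∀ᵐ a ∂(volume.restrict (Ch n)), w (Dmat a) ≠ ⊤ := by
    rw [Weyl n w hw hK] at hi
    have h2 := lt_top_of_mul_ne_top_right hi (cW_ne n)
    have hm : Measurable fun a : Vc n => w (Dmat a) * oR ((vdm fun j => a j ^ 2)^2) :=
      (hw.comp Dmat_meas).mul (vsq_meas.pow_const 2).ennreal_ofReal
    filter_upwards [ae_lt_top hm h2.ne, ae_restrict_mem (Ch_meas n)] with a h3 ha
    refine (lt_top_of_mul_ne_top_left h3.ne ?_).ne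
    have := vdm_pos (sq_mono ha.2 ha.1)
    rw [ne_eq, ENNReal.ofReal_eq_zero, not_le]; positivity
  refine lintegral_congr_ae ?_
  filter_upwards [hfin, ae_restrict_mem (Ch_meas n)] with a h3 ha
  rw [Rn_mul n y _ _ h3, show re1 ω = fun χ => oR (1 + (ω * χ).re) from rfl, (Rn_char n y ω hω a ha).1, dps_s00]
  rw [← mul_assoc, mul_comm (oR _)]
  congr 2
  rw [mul_assoc ω, add_re, ← Complex.ofReal_mul, ofReal_re]

lemma EE_norm (y x : Vc n) : ‖EE y x‖ = 1 := norm_exp_ofReal_mul_I _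

lemma w2_fin {P σ h} (H : Core n P σ h) {w : Mz n → ENNReal} (hw : Measurable w) (hi : ∫⁻ X, w X ∂(lam (2*n)) ≠ ⊤) :
    ∫⁻ X, w2 P w X ∂(lam (2*n)) ≠ ⊤ := by
  have := idA H hw (F := fun _ => 1) measurable_const
  simp only [one_mul, mul_one] at this
  rw [this, lintegral_mul_const' _ _ hi, H.one, one_mul]; exact hi

lemma idC {P σ h} (H : Core n P σ h) {w : Mz n → ENNReal} (hw : Measurable w) (hK : KInv w)
    (hi : ∫⁻ X, w X ∂(lam (2*n)) ≠ ⊤) (y : Vc n) {ω : ℂ} (hω : ‖ω‖ ≤ 1) :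
    ∫⁻ a in Ch n, w2 P w (Dmat a) * oR (vdm fun j => a j ^ 2) *
        oR (cz n * vdm (fun j => a j ^ 2) + (ω * (cs n y * dps (sy n y) a)).re) =
    kap n * ∫⁻ x : Vc n, oR (∏ c, h (x c) * x c ^ (2 * c.val)) *
      ∫⁻ a in Ch n, w (Dmat a) * oR (vdm fun j => a j ^ 2) *
        oR (cz n * vdm (fun j => a j ^ 2) + (ω * (EE y x * (cs n y * dps (sy n y) a))).re) := by
  have h1 := SnR (w2_meas H hw) (w2_K H w) (w2_fin H hw hi) y hω
  have h2 := idA H hw (F := fun Y => re1 ω (Xs n y Y)) ((re1_meas ω).comp (Xs_meas n y))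
  have hΨm : Measurable fun χ : ℂ => ∫⁻ X, w X * re1 ω (χ * Xs n y X) ∂(lam (2*n)) := by
    refine Measurable.lintegral_prod_right' (ν := lam (2*n)) (f := fun p : ℂ × Mz n => w p.2 * re1 ω (p.1 * Xs n y p.2)) ?_
    exact (hw.comp measurable_snd).mul ((re1_meas ω).comp (measurable_fst.mul ((Xs_meas n y).comp measurable_snd)))
  have hΨT : ∀ χ : ℂ, ∫⁻ X, w X * re1 ω (χ * Xs n y X) ∂(lam (2*n)) ≠ ⊤ := fun χ => by
    refine ne_top_of_le_ne_top ?_ (lintegral_mono fun X => mul_le_mul_right (re1_le (ξ := χ) hω (Xs_norm n y X)) (w X))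
    rw [lintegral_mul_const' _ _ ofReal_ne_top]
    exact mul_ne_top hi ofReal_ne_top
  have h3 := H.QRm y hΨm hΨT
  have h4 : ∫⁻ u : Uz n, oR (P (of u)) *
      ∫⁻ X, w X * re1 ω (Xs n y (of u * X * (of u)ᵀ)) ∂(lam (2*n)) =
      ∫⁻ u : Uz n, oR (P (of u)) *
      ∫⁻ X, w X * re1 ω (Xs n y (of u * (of u)ᵀ) * Xs n y X) ∂(lam (2*n)) := by
    refine lintegral_congr_ae ?_
    filter_upwards [ae_det (m := 2*n)] with u hd
    rw [Xs_gK hw hK y (re1_meas ω) hd]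
  have h5 : ∀ x : Vc n, ∫⁻ X, w X * re1 ω (EE y x * Xs n y X) ∂(lam (2*n)) =
      cS n * ∫⁻ a in Ch n, w (Dmat a) * oR (vdm fun j => a j ^ 2) *
        oR (cz n * vdm (fun j => a j ^ 2) + (ω * (EE y x * (cs n y * dps (sy n y) a))).re) := fun x => by
    have hω' : ‖ω * EE y x‖ ≤ 1 := by rw [norm_mul, EE_norm, mul_one]; exact hω
    have := SnR hw hK hi y hω'
    simp only [re1, mul_assoc] at this ⊢
    exact this
  simp only [mul_comm (re1 ω _)] at h2
  rw [h1, h4, h3] at h2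
  simp only [h5] at h2
  simp only [mul_left_comm _ (cS n)] at h2
  rw [lintegral_const_mul' _ _ (cS_fin n), mul_left_comm] at h2
  exact (ENNReal.mul_right_inj (cS_ne n) (cS_fin n)).1 h2

lemma cx1 {α : Type*} [MeasurableSpace α] {μ : Measure α} {D : α → ℝ} {A : α → ℂ} (hD : Integrable D μ)
    (hA : AEStronglyMeasurable A μ) (hb : ∀ᵐ a ∂μ, ‖A a‖ ≤ D a) : Integrable A μ ∧ ∀ ω : ℂ, ‖ω‖ ≤ 1 →
    ∫⁻ a, oR (D a + (ω * A a).re) ∂μ = oR (∫ a, D a ∂μ + (ω * ∫ a, A a ∂μ).re) ∧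
      0 ≤ ∫ a, D a ∂μ + (ω * ∫ a, A a ∂μ).re := by
  have hI : Integrable A μ := hD.mono' hA hb
  refine ⟨hI, fun ω hω => ?_⟩
  have h1 : Integrable (fun a => (ω * A a).re) μ := (hI.const_mul ω).re
  have h2 : ∫ a, (D a + (ω * A a).re) ∂μ = ∫ a, D a ∂μ + (ω * ∫ a, A a ∂μ).re := by
    rw [integral_add hD h1]
    congr 1
    rw [← integral_const_mul]
    exact integral_re (𝕜 := ℂ) (hI.const_mul ω)
  have h3 : ∀ᵐ a ∂μ, 0 ≤ D a + (ω * A a).re := by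
    filter_upwards [hb] with a ha
    have := abs_re_le_norm (ω * A a)
    rw [norm_mul] at this
    have h4 : ‖ω‖ * ‖A a‖ ≤ ‖A a‖ := mul_le_of_le_one_left (norm_nonneg _) hω
    linarith [neg_abs_le (ω * A a).re]
  rw [← h2]
  exact ⟨(ofReal_integral_eq_lintegral_ofReal (hD.add h1) h3).symm, integral_nonneg_of_ae h3⟩

lemma cx2 {α β : Type*} [MeasurableSpace α] [MeasurableSpace β] {μ : Measure α} {ν : Measure β} {D : α → ℝ} {A : α → ℂ} {D' : β → ℝ} {A' : β → ℂ}
    {κ : ENNReal} (hκ : κ ≠ ⊤)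
    (hD : Integrable D μ) (hA : AEStronglyMeasurable A μ) (hb : ∀ᵐ a ∂μ, ‖A a‖ ≤ D a)
    (hD' : Integrable D' ν) (hA' : AEStronglyMeasurable A' ν) (hb' : ∀ᵐ a ∂ν, ‖A' a‖ ≤ D' a)
    (h : ∀ ω : ℂ, ‖ω‖ ≤ 1 → ∫⁻ a, oR (D a + (ω * A a).re) ∂μ = κ * ∫⁻ a, oR (D' a + (ω * A' a).re) ∂ν) :
    ∫ a, A a ∂μ = κ.toReal * ∫ a, A' a ∂ν := by
  obtain ⟨_, h1⟩ := cx1 hD hA hb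
  obtain ⟨_, h2⟩ := cx1 hD' hA' hb'
  have key : ∀ ω : ℂ, ‖ω‖ ≤ 1 → ∫ a, D a ∂μ + (ω * ∫ a, A a ∂μ).re = κ.toReal * (∫ a, D' a ∂ν + (ω * ∫ a, A' a ∂ν).re) := fun ω hω => by
    have := h ω hω
    rw [(h1 ω hω).1, (h2 ω hω).1] at this
    have := congrArg ENNReal.toReal this
    rwa [toReal_mul, toReal_ofReal (h1 ω hω).2, toReal_ofReal (h2 ω hω).2] at this
  have k0 := key 0 (by simp)
  have k1 := key 1 (by simp)
  have k2 := key (-I) (by simp)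
  simp only [zero_mul, zero_re, one_mul, add_zero] at k0 k1
  simp only [neg_mul, neg_re, mul_re, I_re, I_im, zero_mul, one_mul, zero_sub, neg_neg] at k2
  apply Complex.ext
  · rw [re_ofReal_mul]; linarith
  · rw [im_ofReal_mul]; linarith

def Dl (a : Vc n) : ℝ := vdm fun j => a j ^ 2

def Wm (w : Mz n → ENNReal) : Measure Vc n :=
  (volume.restrict (Ch n)).withDensity fun a => w (Dmat a) * oR (Dl a)

instance {n : ℕ} (w : Mz n → ENNReal) : SFinite (Wm w) := by unfold Wm; infer_instance

def Hm (n : ℕ) (h : ℝ → ℝ) : Measure Vc n := volume.withDensity fun x => oR (∏ c, h (x c) * x c ^ (2 * c.val))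

instance {n : ℕ} (h : ℝ → ℝ) : SFinite (Hm n h) := by unfold Hm; infer_instance

lemma Dl_meas : Measurable (Dl (n := n)) := vsq_meas

lemma Dl_pos {a : Vc n} (ha : a ∈ Ch n) : 0 < Dl a := vdm_pos (sq_mono ha.2 ha.1)

lemma wD_meas {w : Mz n → ENNReal} (hw : Measurable w) : Measurable fun a : Vc n => w (Dmat a) * oR (Dl a) :=
  (hw.comp Dmat_meas).mul Dl_meas.ennreal_ofReal

lemma Wm_lint {w : Mz n → ENNReal} (hw : Measurable w) {f : Vc n → ENNReal} (hf : Measurable f) :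
    ∫⁻ a, f a ∂(Wm w) = ∫⁻ a in Ch n, w (Dmat a) * oR (Dl a) * f a := by
  rw [Wm, lintegral_withDensity_eq_lintegral_mul _ (wD_meas hw) hf]; rfl

lemma Wm_Ch (w : Mz n → ENNReal) : ∀ᵐ a ∂(Wm w), a ∈ Ch n :=
  (withDensity_absolutelyContinuous _ _).ae_le (ae_restrict_mem (Ch_meas n))

lemma Wm_D {w : Mz n → ENNReal} (hw : Measurable w) (hK : KInv w) (hi : ∫⁻ X, w X ∂(lam (2*n)) ≠ ⊤) :
    Integrable (Dl (n := n)) (Wm w) := by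
  refine ⟨Dl_meas.aestronglyMeasurable, ?_⟩
  rw [Weyl n w hw hK] at hi
  refine lt_of_eq_of_lt ?_ (lt_top_of_mul_ne_top_right hi (cW_ne n))
  rw [Wm_lint hw Dl_meas.enorm]
  refine setLIntegral_congr_fun (Ch_meas n) fun a ha => ?_
  have := Dl_pos ha
  rw [Real.enorm_eq_ofReal this.le, mul_assoc, ← ENNReal.ofReal_mul this.le, ← sq]; rfl

lemma Hm_meas {P σ h} (H : Core n P σ h) : Measurable fun x : Vc n => ∏ c, h (x c) * x c ^ (2 * c.val) :=
  measurable_prod _ fun c _ => (H.hm.comp (measurable_pi_apply c)).mul ((measurable_pi_apply c).pow_const _)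

lemma Hm_fin {P σ h} (H : Core n P σ h) : IsFiniteMeasure (Hm n h) := by
  refine isFiniteMeasure_withDensity ?_
  have : Integrable fun x : Vc n => ∏ c, h (x c) * x c ^ (2 * c.val) := Integrable.fintype_prod (fun c => H.int c)
  exact this.lintegral_lt_top.ne

lemma Hm_pos {P σ h} (H : Core n P σ h) : ∀ᵐ x ∂(Hm n h), ∀ c, 0 < x c := by
  rw [Hm, ae_withDensity_iff (Hm_meas H).ennreal_ofReal]
  refine ae_of_all _ fun x hx c => ?_
  by_contra h0
  refine hx ?_
  rw [prod_eq_zero (Finset.mem_univ c) (by rw [H.neg _ (not_lt.1 h0), zero_mul]), ENNReal.ofReal_zero]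

lemma idF {P σ h} (H : Core n P σ h) {w : Mz n → ENNReal} (hw : Measurable w) (hK : KInv w)
    (hi : ∫⁻ X, w X ∂(lam (2*n)) ≠ ⊤) (y : Vc n) :
    ∫ a, dps (sy n y) a ∂(Wm (w2 P w)) = (kap n).toReal * ∫ p, EE y p.1 * dps (sy n y) p.2 ∂((Hm n h).prod (Wm w)) := by
  haveI := Hm_fin H
  have hdm : Measurable fun a : Vc n => cs n y * dps (sy n y) a := (dps_meas _).const_mul _
  have hA' : Measurable fun p : Vc n × Vc n => EE y p.1 * (cs n y * dps (sy n y) p.2) :=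
    ((EE_meas y).comp measurable_fst).mul (hdm.comp measurable_snd)
  have hD' : Integrable (fun p : Vc n × Vc n => cz n * Dl p.2) ((Hm n h).prod (Wm w)) :=
    ((Wm_D hw hK hi).const_mul (cz n)).comp_snd _
  have key := cx2 (μ := Wm (w2 P w)) (ν := (Hm n h).prod (Wm w)) (D := fun a => cz n * Dl a) (A := fun a => cs n y * dps (sy n y) a)
    (D' := fun p => cz n * Dl p.2) (A' := fun p => EE y p.1 * (cs n y * dps (sy n y) p.2)) (κ := kap n) (kap_fin n)
    ((Wm_D (w2_meas H hw) (w2_K H w) (w2_fin H hw hi)).const_mul _) hdm.aestronglyMeasurable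
    (by filter_upwards [Wm_Ch (w2 P w)] with a ha; exact dps_bound y ha) hD' hA'.aestronglyMeasurable
    (by
      have : ∀ᵐ p ∂((Hm n h).prod (Wm w)), p.2 ∈ Ch n := Measure.quasiMeasurePreserving_snd.ae (Wm_Ch w)
      filter_upwards [this] with p hp
      rw [norm_mul, EE_norm, one_mul]; exact dps_bound y hp)
    (fun ω hω => by
      have hm1 : Measurable fun a : Vc n => oR (cz n * Dl a + (ω * (cs n y * dps (sy n y) a)).re) :=
        ((Dl_meas.const_mul _).add (Complex.measurable_re.comp (hdm.const_mul ω))).ennreal_ofReal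
      have hm2 : Measurable fun p : Vc n × Vc n => oR (cz n * Dl p.2 + (ω * (EE y p.1 * (cs n y * dps (sy n y) p.2))).re) :=
        (((Dl_meas.const_mul _).comp measurable_snd).add (Complex.measurable_re.comp (hA'.const_mul ω))).ennreal_ofReal
      have hm3 : ∀ x : Vc n, Measurable fun a : Vc n => oR (cz n * Dl a + (ω * (EE y x * (cs n y * dps (sy n y) a))).re) :=
        fun x => ((Dl_meas.const_mul _).add (Complex.measurable_re.comp ((hdm.const_mul _).const_mul ω))).ennreal_ofReal
      rw [Wm_lint (w2_meas H hw) hm1, lintegral_prod _ hm2.aemeasurable]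
      refine (idC H hw hK hi y hω).trans ?_
      congr 1
      rw [Hm, lintegral_withDensity_eq_lintegral_mul _ (Hm_meas H).ennreal_ofReal hm2.lintegral_prod_right']
      refine lintegral_congr fun x => ?_
      exact congrArg _ (Wm_lint hw (f := fun a => oR (cz n * Dl a + (ω * (EE y x * (cs n y * dps (sy n y) a))).re))
        (hm3 x)).symm)
  simp only [mul_left_comm _ (cs n y)] at key
  rw [integral_const_mul, integral_const_mul, mul_left_comm] at key
  exact mul_left_cancel₀ (cs_ne n y) key

abbrev Eu (n : ℕ) := EuclideanSpace ℝ (Fin n)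

def yx (ξ : Eu n) (c : Fin n) : ℝ := 2 * Real.pi * ξ c

open scoped FourierTransform SchwartzMap ContDiff in
lemma four {g : Vc n → ℝ} (hg : ContDiff ℝ ∞ g) (hc : HasCompactSupport g) (hs : ∀ a ∈ tsupport g, ∀ j, 0 < a j) :
    ∃ F : Eu n → ℂ, Continuous F ∧ (∀ N : ℕ, Integrable fun ξ => (1 + ‖yx ξ‖) ^ N * ‖F ξ‖) ∧
      ∀ a : Vc n, (∀ j, 0 < a j) → ((g a : ℝ) : ℂ) = (∏ c, ((a c ^ (2 * c.val) : ℝ) : ℂ)) * ∫ ξ, F ξ * EE (yx ξ) a := by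
  let f : Eu n → ℂ := fun x => ((g (fun c => Real.exp (x c)) * Real.exp (-∑ c : Fin n, (2 * c.val : ℕ) * x c) : ℝ) : ℂ)
  have hf : ContDiff ℝ ∞ f := by
    refine Complex.ofRealCLM.contDiff.comp ?_
    have hx : ∀ c, ContDiff ℝ ∞ fun x : Eu n => x c := fun c => (EuclideanSpace.proj (𝕜 := ℝ) c).contDiff
    refine ContDiff.mul (hg.comp (contDiff_pi.2 fun c => (hx c).exp)) (ContDiff.exp (ContDiff.neg (ContDiff.sum fun c _ => contDiff_const.mul (hx c))))
  have hfc : HasCompactSupport f := by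
    let L : Vc n → Eu n := fun a => WithLp.toLp 2 fun c => Real.log (a c)
    have hL : IsCompact (L '' tsupport g) := by
      refine hc.isCompact.image_of_continuousOn ?_
      refine (PiLp.continuous_toLp 2 _).comp_continuousOn (continuousOn_pi.2 fun c => ?_)
      exact ContinuousOn.log (continuous_apply c).continuousOn fun a ha => (hs a ha c).ne'
    refine HasCompactSupport.intro hL fun x hx => ?_
    have : g (fun c => Real.exp (x c)) = 0 := by
      by_contra h0
      refine hx ⟨_, subset_tsupport _ h0, ?_⟩
      ext c; simp [L]
    simp [f, this]
  let S : 𝓢(Eu n, ℂ) := hfc.toSchwartzMap hf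
  have hS : ∀ x, S x = f x := fun x => rfl
  let S' : 𝓢(Eu n, ℂ) := 𝓕 S
  refine ⟨S', S'.continuous, fun N => ?_, fun a ha => ?_⟩
  · have hle : ∀ ξ : Eu n, ‖yx ξ‖ ≤ 2 * Real.pi * ‖ξ‖ := fun ξ => by
      rw [pi_norm_le_iff_of_nonneg (by positivity)]
      intro c
      rw [yx, norm_mul, Real.norm_of_nonneg (by positivity)]
      exact mul_le_mul_of_nonneg_left (PiLp.norm_apply_le ξ c) (by positivity)
    have hI : Integrable fun ξ : Eu n => 2 ^ N * ((2 * Real.pi) ^ N * (‖ξ‖ ^ N * ‖S' ξ‖) + ‖ξ‖ ^ 0 * ‖S' ξ‖) :=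
      (((S'.integrable_pow_mul volume N).const_mul _).add (S'.integrable_pow_mul volume 0)).const_mul _
    have hym : Measurable fun ξ : Eu n => ‖yx ξ‖ := by
      have : Continuous fun ξ : Eu n => yx ξ := continuous_pi fun c => by unfold yx; fun_prop
      exact this.norm.measurable
    refine hI.mono' ?_ (ae_of_all _ fun ξ => ?_)
    · exact (((hym.const_add 1).pow_const N).mul S'.continuous.norm.measurable).aestronglyMeasurable
    · rw [Real.norm_of_nonneg (by positivity)]
      have h1 : (1 + ‖yx ξ‖) ^ N ≤ 2 ^ N * ((2 * Real.pi * ‖ξ‖) ^ N + 1) := by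
        have h2 : 1 + ‖yx ξ‖ ≤ 2 * max (2 * Real.pi * ‖ξ‖) 1 := by
          have := hle ξ; have h3 := le_max_left (2 * Real.pi * ‖ξ‖) 1; have h4 := le_max_right (2 * Real.pi * ‖ξ‖) 1
          linarith
        refine (pow_le_pow_left₀ (by positivity) h2 N).trans ?_
        rw [mul_pow]
        refine mul_le_mul_of_nonneg_left ?_ (by positivity)
        rcases max_choice (2 * Real.pi * ‖ξ‖) 1 with h | h <;> rw [h]
        · linarith
        · rw [one_pow]; have : 0 ≤ (2 * Real.pi * ‖ξ‖) ^ N := by positivity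
          linarith
      refine (mul_le_mul_of_nonneg_right h1 (norm_nonneg _)).trans (le_of_eq ?_)
      rw [mul_pow]; ring
  · have h1 : 𝓕⁻ S' = S := FourierTransform.fourierInv_fourier_eq S
    have h2 := congrArg (fun T : 𝓢(Eu n, ℂ) => T (WithLp.toLp 2 fun c => Real.log (a c))) h1
    simp only [] at h2
    rw [SchwartzMap.fourierInv_coe, Real.fourierInv_eq', hS] at h2
    have h3 : ∫ ξ, S' ξ * EE (yx ξ) a = f (WithLp.toLp 2 fun c => Real.log (a c)) := by
      rw [← h2]
      refine integral_congr_ae (ae_of_all _ fun ξ => ?_)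
      simp only [smul_eq_mul]
      rw [mul_comm, EE]
      congr 4
      rw [PiLp.inner_apply, mul_sum]
      refine Finset.sum_congr rfl fun c _ => ?_
      simp [yx]; ring
    rw [h3]
    have h4 : ∏ c, a c ^ (2 * c.val) = Real.exp (∑ c : Fin n, (2 * c.val : ℕ) * Real.log (a c)) := by
      rw [Real.exp_sum]
      refine prod_congr rfl fun c _ => ?_
      rw [Real.exp_nat_mul, Real.exp_log (ha c)]
    have h5 : (fun c => Real.exp (Real.log (a c))) = a := funext fun c => Real.exp_log (ha c)
    simp only [f]
    rw [h5, ← ofReal_prod, h4, ← Complex.ofReal_mul, mul_left_comm, ← Real.exp_add]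
    simp

def AS (g : Vc n → ℝ) (x a : Vc n) : ℝ := ∑ s : Perm (Fin n), ((Perm.sign s : ℤ) : ℝ) * g fun c => x c * a (s c)

lemma EE_mul (y : Vc n) {x b : Vc n} (hx : ∀ c, 0 < x c) (hb : ∀ c, 0 < b c) :
    EE y (fun c => x c * b c) = EE y x * EE y b := by
  rw [EE, EE, EE, ← exp_add, ← add_mul, ← Complex.ofReal_add, ← sum_add_distrib]
  congr 4
  exact funext fun c => by rw [Real.log_mul (hx c).ne' (hb c).ne']; ring

lemma dps_EE (y : Vc n) {a : Vc n} (ha : ∀ c, 0 < a c) :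
    dps (sy n y) a = ∑ s : Perm (Fin n), ((Perm.sign s : ℤ) : ℂ) * ((∏ c, ((a (s c) ^ (2 * c.val) : ℝ) : ℂ)) * EE y fun c => a (s c)) := by
  rw [dps, det_apply']
  refine Finset.sum_congr rfl fun s _ => ?_
  congr 1
  rw [EE, ofReal_sum, sum_mul, exp_sum, ← prod_mul_distrib]
  refine prod_congr rfl fun c _ => ?_
  have h0 : ((a (s c) : ℝ) : ℂ) ≠ 0 := by exact_mod_cast (ha _).ne'
  rw [of_apply, sy, cpow_add _ _ h0]
  congr 1
  · have : (2 : ℂ) * (c.val : ℂ) = ((2 * c.val : ℕ) : ℂ) := by push_cast; ring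
    rw [this, cpow_natCast]; push_cast; ring
  · rw [cpow_def_of_ne_zero h0, ← ofReal_log (ha _).le]
    congr 1; push_cast; ring

lemma AS_eq {g : Vc n → ℝ} {F : Eu n → ℂ} (hF : ∀ y : Vc n, Integrable fun ξ => F ξ * EE (yx ξ) y)
    (h : ∀ a : Vc n, (∀ j, 0 < a j) → ((g a : ℝ) : ℂ) = (∏ c, ((a c ^ (2 * c.val) : ℝ) : ℂ)) * ∫ ξ, F ξ * EE (yx ξ) a)
    {x a : Vc n} (hx : ∀ c, 0 < x c) (ha : ∀ c, 0 < a c) :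
    ((AS g x a : ℝ) : ℂ) = (∏ c, ((x c ^ (2 * c.val) : ℝ) : ℂ)) * ∫ ξ, F ξ * (EE (yx ξ) x * dps (sy n (yx ξ)) a) := by
  have e : ∀ ξ, F ξ * (EE (yx ξ) x * dps (sy n (yx ξ)) a) = ∑ s : Perm (Fin n), ((Perm.sign s : ℤ) : ℂ) *
      (∏ c, ((a (s c) ^ (2 * c.val) : ℝ) : ℂ)) * (F ξ * EE (yx ξ) fun c => x c * a (s c)) := fun ξ => by
    rw [dps_EE _ ha, mul_sum, mul_sum]
    refine Finset.sum_congr rfl fun s _ => ?_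
    rw [EE_mul _ hx fun c => ha (s c)]; ring
  simp only [e]
  rw [integral_finset_sum _ fun s _ => (hF _).const_mul _, mul_sum, AS, ofReal_sum]
  refine Finset.sum_congr rfl fun s _ => ?_
  rw [integral_const_mul, Complex.ofReal_mul, h _ fun c => mul_pos (hx c) (ha (s c))]
  simp only [mul_pow, Complex.ofReal_mul, prod_mul_distrib]
  push_cast
  ring

lemma yx_cont : Continuous fun ξ : Eu n => yx ξ := continuous_pi fun c => by unfold yx; fun_prop

lemma EE_jm {α : Type*} [MeasurableSpace α] {f : α → Vc n} (hf : Measurable f) : Measurable fun p : Eu n × α => EE (yx p.1) (f p.2) := by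
  have h1 : ∀ c, Measurable fun p : Eu n × α => yx p.1 c := fun c => (measurable_pi_apply c).comp (yx_cont.measurable.comp measurable_fst)
  have h2 : ∀ c, Measurable fun p : Eu n × α => f p.2 c := fun c => (measurable_pi_apply c).comp (hf.comp measurable_snd)
  unfold EE
  fun_prop

lemma dps_jm {α : Type*} [MeasurableSpace α] {f : α → Vc n} (hf : Measurable f) :
    Measurable fun p : Eu n × α => dps (sy n (yx p.1)) (f p.2) := by
  have h1 : ∀ c, Measurable fun p : Eu n × α => yx p.1 c := fun c => (measurable_pi_apply c).comp (yx_cont.measurable.comp measurable_fst)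
  have h2 : ∀ c, Measurable fun p : Eu n × α => f p.2 c := fun c => (measurable_pi_apply c).comp (hf.comp measurable_snd)
  unfold dps sy
  simp only [det_apply, of_apply]
  fun_prop

lemma fub {α : Type*} [MeasurableSpace α] {μ : Measure α} [SFinite μ] {F : Eu n → ℂ} (hF : Continuous F)
    (hN : ∀ N : ℕ, Integrable fun ξ => (1 + ‖yx ξ‖) ^ N * ‖F ξ‖) {A : Eu n → α → ℂ} (hA : Measurable fun p : Eu n × α => A p.1 p.2)
    {D : α → ℝ} (hD : Integrable D μ) (hb : ∀ᵐ p ∂μ, ∀ ξ, ‖cs n (yx ξ) * A ξ p‖ ≤ D p) :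
    ∫ p, (∫ ξ, F ξ * A ξ p) ∂μ = ∫ ξ, F ξ * ∫ p, A ξ p ∂μ := by
  obtain ⟨C, N, hC⟩ := cs_bound n
  have h1 : Integrable (fun p : Eu n × α => F p.1 * A p.1 p.2) (volume.prod μ) := by
    refine (((hN N).const_mul C).mul_prod hD).mono' ((hF.measurable.comp measurable_fst).mul hA).aestronglyMeasurable ?_
    have : ∀ᵐ p ∂((volume : Measure (Eu n)).prod μ), ∀ ξ, ‖cs n (yx ξ) * A ξ p.2‖ ≤ D p.2 := Measure.quasiMeasurePreserving_snd.ae hb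
    filter_upwards [this] with p hp
    have h2 := hp p.1
    have h3 : ‖A p.1 p.2‖ ≤ ‖(cs n (yx p.1))⁻¹‖ * D p.2 := by
      rw [norm_mul] at h2
      rw [norm_inv, inv_mul_eq_div, le_div_iff₀ (norm_pos_iff.2 (cs_ne n _)), mul_comm]; exact h2
    have h4 : 0 ≤ D p.2 := (norm_nonneg _).trans h2
    rw [norm_mul]
    calc ‖F p.1‖ * ‖A p.1 p.2‖ ≤ ‖F p.1‖ * (C * (1 + ‖yx p.1‖) ^ N * D p.2) :=
          mul_le_mul_of_nonneg_left (h3.trans (mul_le_mul_of_nonneg_right (hC _) h4)) (norm_nonneg _)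
      _ = _ := by ring
  refine (integral_integral_swap (f := fun p ξ => F ξ * A ξ p) h1.swap).trans ?_
  exact integral_congr_ae (ae_of_all _ fun ξ => integral_const_mul _ _)

lemma AS_one {g : Vc n → ℝ} (hs : ∀ a, g a ≠ 0 → a ∈ Ch n) {a : Vc n} (ha : a ∈ Ch n) : AS g (fun _ => 1) a = g a := by
  rw [AS, sum_eq_single 1]
  · simp
  · intro s _ hs1
    by_contra h0
    have h1 := (hs _ (right_ne_zero_of_mul h0)).2
    simp only [one_mul] at h1
    have h2 : StrictMono s := fun i j hij => ha.2.lt_iff_lt.1 (h1 hij)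
    refine hs1 (Equiv.ext fun i => ?_)
    have : (⇑s) = id := by
      have := Subsingleton.elim (h2.orderIsoOfSurjective s s.surjective) (OrderIso.refl _)
      funext i; exact congrArg (fun e : Fin n ≃o Fin n => e i) this
    simp [this]
  · simp

open scoped ContDiff in
lemma star {P σ h} (H : Core n P σ h) {w : Mz n → ENNReal} (hw : Measurable w) (hK : KInv w)
    (hi : ∫⁻ X, w X ∂(lam (2*n)) ≠ ⊤) {g : Vc n → ℝ} (hg : ContDiff ℝ ∞ g) (hc : HasCompactSupport g) (hs : tsupport g ⊆ Ch n) :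
    ∫ a, g a ∂(Wm (w2 P w)) = (kap n).toReal * ∫ p, (∏ c, p.1 c ^ (2 * c.val))⁻¹ * AS g p.1 p.2 ∂((Hm n h).prod (Wm w)) := by
  haveI := Hm_fin H
  obtain ⟨F, hF, hN, hgF⟩ := four hg hc fun a ha => (hs ha).1
  have hFi : ∀ y : Vc n, Integrable fun ξ => F ξ * EE (yx ξ) y := fun y => by
    have hm : Measurable fun ξ : Eu n => EE (yx ξ) y := Measurable.comp (g := fun p : Eu n × Unit => EE (yx p.1) y) (f := fun ξ => (ξ, ()))
      (EE_jm (f := fun _ => y) measurable_const) (measurable_id.prodMk measurable_const)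
    refine (hN 0).mono' (hF.measurable.mul hm).aestronglyMeasurable ?_
    exact ae_of_all _ fun ξ => by rw [norm_mul, EE_norm, pow_zero, one_mul, mul_one]
  have hAS := fun (x a : Vc n) => AS_eq (x := x) (a := a) hFi hgF
  have e1 := fub (μ := Wm (w2 P w)) hF hN (A := fun ξ a => dps (sy n (yx ξ)) a) (dps_jm measurable_id)
    ((Wm_D (w2_meas H hw) (w2_K H w) (w2_fin H hw hi)).const_mul (cz n))
    (by filter_upwards [Wm_Ch (w2 P w)] with a ha ξ; exact dps_bound _ ha)
  have hD' : Integrable (fun p : Vc n × Vc n => cz n * Dl p.2) ((Hm n h).prod (Wm w)) :=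
    ((Wm_D hw hK hi).const_mul (cz n)).comp_snd _
  have hc2 : ∀ᵐ p ∂((Hm n h).prod (Wm w)), p.2 ∈ Ch n := Measure.quasiMeasurePreserving_snd.ae (Wm_Ch w)
  have hc1 : ∀ᵐ p ∂((Hm n h).prod (Wm w)), ∀ c, 0 < p.1 c := Measure.quasiMeasurePreserving_fst.ae (Hm_pos H)
  have e2 := fub (μ := (Hm n h).prod (Wm w)) hF hN (A := fun ξ p => EE (yx ξ) p.1 * dps (sy n (yx ξ)) p.2)
    ((EE_jm measurable_fst).mul (dps_jm measurable_snd)) hD'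
    (by
      filter_upwards [hc2] with p hp ξ
      rw [mul_left_comm, norm_mul, EE_norm, one_mul]; exact dps_bound _ hp)
  simp only [idF H hw hK hi, mul_left_comm _ ((kap n).toReal : ℂ)] at e1
  rw [integral_const_mul, ← e2] at e1
  apply ofReal_injective
  rw [Complex.ofReal_mul, ← integral_complex_ofReal, ← integral_complex_ofReal]
  refine Eq.trans (integral_congr_ae ?_) (e1.trans ?_)
  · filter_upwards [Wm_Ch (w2 P w)] with a ha
    rw [← AS_one (fun b hb => hs (subset_tsupport _ hb)) ha, hAS _ _ (fun _ => one_pos) ha.1]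
    simp [EE]
  · congr 1
    refine integral_congr_ae ?_
    filter_upwards [hc1, hc2] with p h1 h2
    rw [Complex.ofReal_mul, hAS _ _ h1 h2.1, ← mul_assoc, ← ofReal_prod, ← Complex.ofReal_mul,
      inv_mul_cancel₀ (prod_ne_zero_iff.2 fun c _ => (pow_pos (h1 c) _).ne'), Complex.ofReal_one, one_mul]

lemma scal {ι : Type*} [Fintype ι] [DecidableEq ι] {c : ι → ℝ} (hc : ∀ i, 0 < c i) :
    MeasurableEmbedding (fun v : ι → ℝ => fun i => v i * c i) ∧
    Measure.map (fun v : ι → ℝ => fun i => v i * c i) volume = oR (∏ i, c i)⁻¹ • volume := by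
  refine ⟨(Homeomorph.piCongrRight fun i => Homeomorph.mulRight₀ (c i) (hc i).ne').measurableEmbedding, ?_⟩
  have hp : 0 < ∏ i, c i := prod_pos fun i _ => hc i
  have h1 := Real.smul_map_diagonal_volume_pi (D := c) (by rw [det_diagonal]; exact hp.ne')
  have h2 : (⇑(toLin' (diagonal c))) = fun (v : ι → ℝ) i => v i * c i := by
    funext v i
    rw [toLin'_apply, mulVec_diagonal, mul_comm]
  rw [h2, det_diagonal, abs_of_pos hp] at h1
  conv_rhs => rw [← h1]
  rw [smul_smul, ← ENNReal.ofReal_mul (inv_nonneg.2 hp.le), inv_mul_cancel₀ hp.ne', ENNReal.ofReal_one, one_smul]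

lemma lscal {ι : Type*} [Fintype ι] [DecidableEq ι] {c : ι → ℝ} (hc : ∀ i, 0 < c i) (f : (ι → ℝ) → ENNReal) :
    ∫⁻ v : ι → ℝ, f (fun i => v i * c i) = oR (∏ i, c i)⁻¹ * ∫⁻ b, f b := by
  rw [← (scal hc).1.lintegral_map (f := f), (scal hc).2, lintegral_smul_measure, smul_eq_mul]

lemma iscal {ι : Type*} [Fintype ι] [DecidableEq ι] {c : ι → ℝ} (hc : ∀ i, 0 < c i) (f : (ι → ℝ) → ℝ) :
    ∫ v : ι → ℝ, f (fun i => v i * c i) = (∏ i, c i)⁻¹ * ∫ b, f b := by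
  have hp : 0 < ∏ i, c i := prod_pos fun i _ => hc i
  rw [← (scal hc).1.integral_map (g := f), (scal hc).2, integral_smul_measure, toReal_ofReal (inv_nonneg.2 hp.le), smul_eq_mul]

lemma cont0 {ι : Type*} [Fintype ι] [DecidableEq ι] {G Φ : (ι → ℝ) → ℝ} (hG : Continuous G) (hGc : HasCompactSupport G) (hΦ : Measurable Φ) {C : ℝ} (hC : ∀ v, |Φ v| ≤ C) :
    ContinuousOn (fun c : ι → ℝ => ∫ v, G v * Φ fun i => v i * c i) {c | ∀ i, 0 < c i} := by
  have key : ContinuousOn (fun c : ι → ℝ => (∏ i, c i)⁻¹ * ∫ b : ι → ℝ, G (fun i => b i / c i) * Φ b) {c | ∀ i, 0 < c i} := by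
    refine ContinuousOn.mul ?_ ?_
    · exact ContinuousOn.inv₀ (by fun_prop) fun c hc => (prod_pos fun i _ => hc i).ne'
    · intro c0 hc0
      refine ContinuousAt.continuousWithinAt ?_
      obtain ⟨R, hR⟩ := hGc.isBounded.exists_norm_le
      obtain ⟨M, hM⟩ := hGc.exists_bound_of_continuous hG
      have hM0 : 0 ≤ M := (norm_nonneg _).trans (hM 0)
      have hC0 : 0 ≤ C := (abs_nonneg _).trans (hC 0)
      set B : Set (ι → ℝ) := Set.Icc (fun i => - (|R| * (2 * c0 i))) (fun i => |R| * (2 * c0 i)) with hB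
      have hnb : ∀ᶠ c in nhds c0, ∀ i, 0 < c i ∧ c i < 2 * c0 i := by
        rw [Filter.eventually_all]
        intro i
        have h0 := hc0 i
        exact (continuous_apply i).continuousAt.eventually_mem (Ioo_mem_nhds h0 (by linarith))
      refine continuousAt_of_dominated (bound := B.indicator fun _ => M * C) ?_ ?_ ?_ ?_
      · refine Filter.Eventually.of_forall fun c => (Measurable.mul ?_ hΦ).aestronglyMeasurable
        exact hG.measurable.comp (measurable_pi_lambda _ fun i => (measurable_pi_apply i).div_const _)
      · filter_upwards [hnb] with c hc
        refine ae_of_all _ fun b => ?_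
        by_cases hb : G (fun i => b i / c i) = 0
        · rw [hb, zero_mul, norm_zero]; exact indicator_nonneg (fun _ _ => mul_nonneg hM0 hC0) _
        · have h1 := hR _ (subset_tsupport _ hb)
          have h2 : b ∈ B := by
            have : ∀ i, |b i| ≤ |R| * (2 * c0 i) := fun i => by
              have h3 := (norm_le_pi_norm (fun i => b i / c i) i).trans (h1.trans (le_abs_self R))
              rw [Real.norm_eq_abs, abs_div, abs_of_pos (hc i).1, div_le_iff₀ (hc i).1] at h3
              exact h3.trans (mul_le_mul_of_nonneg_left (hc i).2.le (abs_nonneg _))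
            exact ⟨fun i => (abs_le.1 (this i)).1, fun i => (abs_le.1 (this i)).2⟩
          rw [indicator_of_mem h2, norm_mul]
          exact mul_le_mul (hM _) (hC _) (norm_nonneg _) hM0
      · rw [integrable_indicator_iff measurableSet_Icc]
        exact integrableOn_const isCompact_Icc.measure_lt_top.ne
      · refine ae_of_all _ fun b => ContinuousAt.mul ?_ continuousAt_const
        refine ContinuousAt.comp (g := G) hG.continuousAt (continuousAt_pi.2 fun i => ?_)
        exact continuousAt_const.div (continuous_apply i).continuousAt (hc0 i).ne'
  refine key.congr fun c hc => ?_
  refine Eq.trans ?_ (iscal hc fun b => G (fun i => b i / c i) * Φ b)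
  refine integral_congr_ae (ae_of_all _ fun v => ?_)
  simp only [mul_div_cancel_right₀ _ (hc _).ne']

lemma cont1 {ι : Type*} [Fintype ι] [DecidableEq ι] {G Φ : (ι → ℝ) → ℝ} (hG : Integrable G) (hΦ : Measurable Φ) {C : ℝ} (hC : ∀ v, |Φ v| ≤ C) :
    ContinuousOn (fun c : ι → ℝ => ∫ v, G v * Φ fun i => v i * c i) {c | ∀ i, 0 < c i} := by
  have hC0 : 0 ≤ C := (abs_nonneg _).trans (hC 0)
  refine continuousOn_of_uniform_approx_of_continuousOn fun u hu => ?_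
  obtain ⟨ε, hε, hu'⟩ := Metric.mem_uniformity_dist.1 hu
  obtain ⟨G', hc, hle, hcont, hint⟩ := hG.exists_hasCompactSupport_integral_sub_le (show 0 < ε / (C + 1) by positivity)
  refine ⟨_, cont0 hcont hc hΦ hC, fun c _ => hu' ?_⟩
  have hm : AEStronglyMeasurable (fun v : ι → ℝ => Φ fun i => v i * c i) volume :=
    (hΦ.comp (measurable_pi_lambda _ fun i => (measurable_pi_apply i).mul_const _)).aestronglyMeasurable
  have hb : ∀ᵐ v : ι → ℝ, ‖Φ fun i => v i * c i‖ ≤ C := ae_of_all _ fun v => hC _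
  rw [Real.dist_eq, ← integral_sub (hG.mul_bdd hm hb) (hint.mul_bdd hm hb), ← Real.norm_eq_abs]
  calc _ ≤ ∫ v, ‖G v - G' v‖ * C := by
        refine norm_integral_le_of_norm_le ((hG.sub hint).norm.mul_const C) (ae_of_all _ fun v => ?_)
        rw [← sub_mul, norm_mul]
        exact mul_le_mul_of_nonneg_left (hC _) (norm_nonneg _)
    _ ≤ ε / (C + 1) * C := by rw [integral_mul_const]; exact mul_le_mul_of_nonneg_right hle hC0
    _ < ε := by
      rw [div_mul_eq_mul_div, div_lt_iff₀ (by linarith)]; nlinarith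

def Hs (h : ℝ → ℝ) (s : Perm (Fin n)) (b t : Vc n) : ℝ := ∏ c, h (b c / t (s c)) / t (s c)

lemma chg {h : ℝ → ℝ} (s : Perm (Fin n)) {t : Vc n} (ht : ∀ c, 0 < t c) {f : Vc n → ENNReal} :
    ∫⁻ x : Vc n, oR (∏ c, h (x c)) * f (fun c => x c * t (s c)) = ∫⁻ b, oR (Hs h s b t) * f b := by
  have hp : 0 < ∏ c, t (s c) := prod_pos fun c _ => ht _
  have := lscal (fun c => ht (s c)) fun b => oR (∏ c, h (b c / t (s c))) * f b
  simp only [mul_div_cancel_right₀ _ (ht _).ne'] at this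
  rw [this, ← lintegral_const_mul' _ _ ofReal_ne_top]
  refine lintegral_congr fun b => ?_
  rw [← mul_assoc, ← ENNReal.ofReal_mul (inv_nonneg.2 hp.le), Hs, Finset.prod_div_distrib, div_eq_inv_mul]

lemma Hs_meas {h : ℝ → ℝ} (hh : Measurable h) (s : Perm (Fin n)) : Measurable fun p : Vc n × Vc n => Hs h s p.2 p.1 := by
  refine measurable_prod _ fun c _ => ?_
  have h1 : Measurable fun p : Vc n × Vc n => p.1 (s c) := (measurable_pi_apply _).comp measurable_fst
  have h2 : Measurable fun p : Vc n × Vc n => p.2 c := (measurable_pi_apply _).comp measurable_snd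
  exact (hh.comp (h2.div h1)).div h1

def Vs (h : ℝ → ℝ) (μ : Measure Vc n) (s : Perm (Fin n)) (b : Vc n) : ENNReal := ∫⁻ t, oR (Hs h s b t) ∂μ

lemma Vs_meas {h : ℝ → ℝ} (hh : Measurable h) (μ : Measure Vc n) [SFinite μ] (s : Perm (Fin n)) : Measurable (Vs h μ s) :=
  (Hs_meas hh s).ennreal_ofReal.lintegral_prod_left' (μ := μ)

lemma Vs_lint {h : ℝ → ℝ} (hh : Measurable h) (μ : Measure Vc n) [SFinite μ] (hμ : ∀ᵐ t ∂μ, ∀ c, 0 < t c) (s : Perm (Fin n))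
    {f : Vc n → ENNReal} (hf : Measurable f) :
    ∫⁻ t, (∫⁻ x : Vc n, oR (∏ c, h (x c)) * f (fun c => x c * t (s c))) ∂μ = ∫⁻ b, Vs h μ s b * f b := by
  have e1 : ∫⁻ t, (∫⁻ x : Vc n, oR (∏ c, h (x c)) * f (fun c => x c * t (s c))) ∂μ = ∫⁻ t, (∫⁻ b, oR (Hs h s b t) * f b) ∂μ := by
    refine lintegral_congr_ae ?_
    filter_upwards [hμ] with t ht
    exact chg s ht
  rw [e1, lintegral_lintegral_swap]
  · refine lintegral_congr fun b => ?_
    rw [Vs, lintegral_mul_const]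
    exact Measurable.comp (g := fun p : Vc n × Vc n => oR (Hs h s p.2 p.1)) (f := fun t => (t, b))
      (Hs_meas hh s).ennreal_ofReal (measurable_id.prodMk measurable_const)
  · exact ((Hs_meas hh s).ennreal_ofReal.mul (hf.comp measurable_snd)).aemeasurable

lemma Core.hp {P σ h} (H : Core n P σ h) : Integrable fun x : Vc n => ∏ c, h (x c) :=
  Integrable.fintype_prod (f := fun _ => h) (fun _ => H.int0)

lemma Vs_fin {P σ h} (H : Core n P σ h) (μ : Measure Vc n) [IsFiniteMeasure μ] (hμ : ∀ᵐ t ∂μ, ∀ c, 0 < t c) (s : Perm (Fin n)) :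
    ∫⁻ b, Vs h μ s b ≠ ⊤ := by
  have := Vs_lint H.hm μ hμ s (f := fun _ => 1) measurable_const
  simp only [mul_one, lintegral_const] at this
  rw [← this]
  exact mul_ne_top H.hp.lintegral_lt_top.ne (measure_ne_top _ _)

lemma Vs_int {P σ h} (H : Core n P σ h) (μ : Measure Vc n) [IsFiniteMeasure μ] (hμ : ∀ᵐ t ∂μ, ∀ c, 0 < t c) (s : Perm (Fin n)) :
    Integrable fun b => (Vs h μ s b).toReal :=
  integrable_toReal_of_lintegral_ne_top (Vs_meas H.hm μ s).aemeasurable (Vs_fin H μ hμ s)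

def ms (s : Perm (Fin n)) (p : Vc n × Vc n) : Vc n := fun c => p.1 c * p.2 (s c)
lemma ms_meas (s : Perm (Fin n)) : Measurable (ms s) :=
  measurable_pi_lambda _ fun c => ((measurable_pi_apply c).comp measurable_fst).mul ((measurable_pi_apply (s c)).comp measurable_snd)

lemma pushV {P σ h} (H : Core n P σ h) (μ : Measure Vc n) [SFinite μ] (hμ : ∀ᵐ t ∂μ, ∀ c, 0 < t c) (s : Perm (Fin n))
    {f : Vc n → ENNReal} (hf : Measurable f) :
    ∫⁻ p, oR (∏ c, p.1 c ^ (2 * c.val))⁻¹ * f (ms s p) ∂((Hm n h).prod μ) = ∫⁻ b, Vs h μ s b * f b := by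
  have hm1 : Measurable fun x : Vc n => oR (∏ c, x c ^ (2 * c.val))⁻¹ :=
    (measurable_prod _ fun c _ => (measurable_pi_apply c).pow_const _).inv.ennreal_ofReal
  rw [← Vs_lint H.hm μ hμ s hf]
  refine (lintegral_prod_symm' _ ((hm1.comp measurable_fst).mul (hf.comp (ms_meas s)))).trans ?_
  refine lintegral_congr fun t => ?_
  have hm2 : Measurable fun x : Vc n => oR (∏ c, x c ^ (2 * c.val))⁻¹ * f (ms s (x, t)) :=
    hm1.mul (Measurable.comp (g := fun p => f (ms s p)) (f := fun x => (x, t)) (hf.comp (ms_meas s)) (measurable_id.prodMk measurable_const))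
  refine (lintegral_withDensity_eq_lintegral_mul _ (Hm_meas H).ennreal_ofReal hm2).trans ?_
  refine lintegral_congr fun x => ?_
  rw [Pi.mul_apply, ← mul_assoc, ← ENNReal.ofReal_mul (prod_nonneg fun c _ => mul_nonneg (H.nn _) ((even_two_mul _).pow_nonneg _))]
  congr 2
  by_cases hx : ∀ c, x c ≠ 0
  · rw [prod_mul_distrib, mul_assoc, mul_inv_cancel₀ (prod_ne_zero_iff.2 fun c _ => pow_ne_zero _ (hx c)), mul_one]
  · push Not at hx
    obtain ⟨c, hc⟩ := hx
    rw [prod_eq_zero (Finset.mem_univ c) (by rw [hc, H.neg 0 le_rfl, zero_mul]), zero_mul,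
      prod_eq_zero (Finset.mem_univ c) (by rw [hc, H.neg 0 le_rfl])]

lemma pushI {P σ h} (H : Core n P σ h) (μ : Measure Vc n) [IsFiniteMeasure μ] (hμ : ∀ᵐ t ∂μ, ∀ c, 0 < t c) (s : Perm (Fin n))
    {g : Vc n → ℝ} (hg : Continuous g) (hgc : HasCompactSupport g) :
    Integrable (fun p => (∏ c, p.1 c ^ (2 * c.val))⁻¹ * g (ms s p)) ((Hm n h).prod μ) ∧
    ∫ p, (∏ c, p.1 c ^ (2 * c.val))⁻¹ * g (ms s p) ∂((Hm n h).prod μ) = ∫ b, (Vs h μ s b).toReal * g b := by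
  set ρ : Vc n × Vc n → ENNReal := fun p => oR (∏ c, p.1 c ^ (2 * c.val))⁻¹ with hρ
  have hm1 : Measurable ρ := (measurable_prod _ fun c _ => ((measurable_pi_apply c).comp measurable_fst).pow_const _).inv.ennreal_ofReal
  have hρt : ∀ p, (ρ p).toReal = (∏ c, p.1 c ^ (2 * c.val))⁻¹ := fun p =>
    toReal_ofReal (inv_nonneg.2 (prod_nonneg fun c _ => (even_two_mul _).pow_nonneg _))
  have hM : Measure.map (ms s) (((Hm n h).prod μ).withDensity ρ) = volume.withDensity (Vs h μ s) := by
    refine ext_of_lintegral _ fun f hf => ?_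
    rw [lintegral_map hf (ms_meas s), lintegral_withDensity_eq_lintegral_mul _ (Vs_meas H.hm μ s) hf]
    exact (lintegral_withDensity_eq_lintegral_mul _ hm1 (hf.comp (ms_meas s))).trans (pushV H μ hμ s hf)
  haveI : IsFiniteMeasure (volume.withDensity (Vs h μ s)) := isFiniteMeasure_withDensity (Vs_fin H μ hμ s)
  obtain ⟨M, hMb⟩ := hgc.exists_bound_of_continuous hg
  have hgi : Integrable g (volume.withDensity (Vs h μ s)) := Integrable.of_bound hg.aestronglyMeasurable M (ae_of_all _ hMb)
  have h2 : Integrable (g ∘ ms s) (((Hm n h).prod μ).withDensity ρ) := by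
    rw [← hM] at hgi
    exact (integrable_map_measure hg.aestronglyMeasurable (ms_meas s).aemeasurable).1 hgi
  have hρf : ∀ᵐ p ∂((Hm n h).prod μ), ρ p < ⊤ := ae_of_all _ fun p => ofReal_lt_top
  constructor
  · rw [integrable_withDensity_iff_integrable_smul' hm1 hρf] at h2
    refine h2.congr (ae_of_all _ fun p => ?_)
    simp only [hρt, Function.comp, smul_eq_mul]
  · have e1 : ∫ b, g b ∂(volume.withDensity (Vs h μ s)) = ∫ b, (Vs h μ s b).toReal * g b :=
      integral_withDensity_eq_integral_toReal_smul (Vs_meas H.hm μ s) (ae_lt_top (Vs_meas H.hm μ s) (Vs_fin H μ hμ s)) _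
    rw [← e1, ← hM, integral_map (ms_meas s).aemeasurable hg.aestronglyMeasurable]
    refine Eq.trans ?_ (integral_withDensity_eq_integral_toReal_smul hm1 hρf _).symm
    refine integral_congr_ae (ae_of_all _ fun p => ?_)
    simp only [hρt, smul_eq_mul]

lemma Ch_open (n : ℕ) : IsOpen (Ch n) := by
  have : Ch n = (⋂ j, {a : Vc n | 0 < a j}) ∩ ⋂ i : Fin n, ⋂ j : Fin n, ⋂ _ : i < j, {a : Vc n | a i < a j} := by
    ext a
    simp only [Ch, StrictMono, mem_setOf_eq, mem_inter_iff, mem_iInter]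
  rw [this]
  refine (isOpen_iInter_of_finite fun j => isOpen_lt continuous_const (continuous_apply j)).inter
    (isOpen_iInter_of_finite fun i => isOpen_iInter_of_finite fun j => isOpen_iInter_of_finite fun _ => isOpen_lt (continuous_apply i) (continuous_apply j))

lemma Dl_cont : Continuous (Dl (n := n)) := by
  unfold Dl vdm; fun_prop

lemma Wm_ae {w : Mz n → ENNReal} (hw : Measurable w) (hD : Integrable (Dl (n := n)) (Wm w)) :
    (∀ᵐ b ∂(volume.restrict (Ch n)), w (Dmat b) * oR (Dl b) < ⊤) ∧
    LocallyIntegrableOn (fun b => (w (Dmat b) * oR (Dl b)).toReal) (Ch n) := by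
  have h1 : ∫⁻ b in Ch n, w (Dmat b) * oR (Dl b) * oR (Dl b) ≠ ⊤ := by
    rw [← Wm_lint hw Dl_meas.ennreal_ofReal]
    exact hD.lintegral_lt_top.ne
  have hm := (wD_meas hw).mul (Dl_meas (n := n)).ennreal_ofReal
  constructor
  · filter_upwards [ae_lt_top hm h1, ae_restrict_mem (Ch_meas n)] with b hb hc
    exact lt_top_of_mul_ne_top_left hb.ne (ofReal_pos.2 (Dl_pos hc)).ne'
  · have h2 : IntegrableOn (fun b => (w (Dmat b) * oR (Dl b) * oR (Dl b)).toReal) (Ch n) :=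
      integrable_toReal_of_lintegral_ne_top hm.aemeasurable h1
    have h3 := h2.locallyIntegrableOn.mul_continuousOn (g := fun b => (Dl b)⁻¹) (Dl_cont.continuousOn.inv₀ fun b hb => (Dl_pos hb).ne') (Ch_open n).isLocallyClosed
    refine h3.congr ?_
    filter_upwards [ae_restrict_mem (Ch_meas n)] with b hc
    rw [toReal_mul, toReal_ofReal (Dl_pos hc).le, mul_assoc, mul_inv_cancel₀ (Dl_pos hc).ne', mul_one]

lemma dens {P σ h} (H : Core n P σ h) {w : Mz n → ENNReal} (hw : Measurable w) (hK : KInv w)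
    (hi : ∫⁻ X, w X ∂(lam (2*n)) ≠ ⊤) [IsFiniteMeasure (Wm w)] :
    ∀ᵐ b, b ∈ Ch n → (w2 P w (Dmat b) * oR (Dl b)).toReal =
      (kap n).toReal * ∑ s : Perm (Fin n), ((Perm.sign s : ℤ) : ℝ) * (Vs h (Wm w) s b).toReal := by
  have hμ : ∀ᵐ t ∂(Wm w), ∀ c, 0 < t c := (Wm_Ch w).mono fun t ht => ht.1
  obtain ⟨hf, hl⟩ := Wm_ae (w2_meas H hw) (Wm_D (w2_meas H hw) (w2_K H w) (w2_fin H hw hi))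
  have hV : Integrable fun b => (kap n).toReal * ∑ s : Perm (Fin n), ((Perm.sign s : ℤ) : ℝ) * (Vs h (Wm w) s b).toReal :=
    (integrable_finsetSum _ fun s _ => (Vs_int H (Wm w) hμ s).const_mul _).const_mul _
  have key := (Ch_open n).ae_eq_zero_of_integral_contDiff_smul_eq_zero (hl.sub (hV.locallyIntegrable.locallyIntegrableOn _)) ?_
  · filter_upwards [key] with b hb hc
    exact sub_eq_zero.1 (hb hc)
  intro g hg hgc hgs
  have hst := star H hw hK hi hg hgc hgs
  have hA := fun s => pushI H (Wm w) hμ s hg.continuous hgc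
  obtain ⟨M, hM⟩ := hgc.exists_bound_of_continuous hg.continuous
  have hz : ∀ b, b ∉ Ch n → g b = 0 := fun b hb => image_eq_zero_of_notMem_tsupport fun h => hb (hgs h)
  have e1 : ∫ a, g a ∂(Wm (w2 P w)) = ∫ b, (w2 P w (Dmat b) * oR (Dl b)).toReal * g b := by
    refine (integral_withDensity_eq_integral_toReal_smul (wD_meas (w2_meas H hw)) hf _).trans ?_
    refine setIntegral_eq_integral_of_forall_compl_eq_zero fun b hb => ?_
    rw [hz b hb, smul_zero]
  have e2 : ∫ p, (∏ c, p.1 c ^ (2 * c.val))⁻¹ * AS g p.1 p.2 ∂((Hm n h).prod (Wm w)) =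
      ∑ s : Perm (Fin n), ((Perm.sign s : ℤ) : ℝ) * ∫ b, (Vs h (Wm w) s b).toReal * g b := by
    simp only [AS, mul_sum]
    rw [integral_finsetSum _ fun s _ => ?_]
    · refine Finset.sum_congr rfl fun s _ => ?_
      rw [← (hA s).2, ← integral_const_mul]
      exact integral_congr_ae (ae_of_all _ fun p => mul_left_comm _ _ _)
    · exact ((hA s).1.const_mul ((Perm.sign s : ℤ) : ℝ)).congr (ae_of_all _ fun p => mul_left_comm _ _ _)
  have i1 : Integrable fun b => (w2 P w (Dmat b) * oR (Dl b)).toReal * g b := by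
    have := (hl.integrableOn_compact_subset hgs hgc).mul_continuousOn hg.continuous.continuousOn hgc
    refine (integrableOn_iff_integrable_of_support_subset fun b hb => ?_).1 this
    exact subset_tsupport _ (right_ne_zero_of_mul hb)
  have i2 : ∀ s, Integrable fun b => (Vs h (Wm w) s b).toReal * g b := fun s =>
    (Vs_int H (Wm w) hμ s).mul_bdd hg.continuous.aestronglyMeasurable (ae_of_all _ hM)
  have e3 : ∀ b, g b • ((fun b => (w2 P w (Dmat b) * oR (Dl b)).toReal) - fun b => (kap n).toReal * ∑ s : Perm (Fin n), ((Perm.sign s : ℤ) : ℝ) * (Vs h (Wm w) s b).toReal) b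
      = (w2 P w (Dmat b) * oR (Dl b)).toReal * g b - (kap n).toReal * ∑ s : Perm (Fin n), ((Perm.sign s : ℤ) : ℝ) * ((Vs h (Wm w) s b).toReal * g b) := fun b => by
    simp only [Pi.sub_apply, smul_eq_mul, ← mul_assoc, ← sum_mul]; ring
  simp only [e3]
  rw [integral_sub i1 ((integrable_finsetSum _ fun s _ => (i2 s).const_mul _).const_mul _), integral_const_mul,
    integral_finsetSum _ fun s _ => (i2 s).const_mul _, ← e1, hst, e2]
  simp only [integral_const_mul, sub_self]

def evk (X : Mt m) (k : ℕ) : ℝ := ((k : ℝ) • (1 : Mt m) + X).det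

lemma evk_meas : Measurable (evk (m := m)) := by
  refine measurable_pi_lambda _ fun k => ?_
  have h1 : Measurable fun X : Mt m => (k : ℝ) • (1 : Mt m) + X := meas_mat fun i j => (meas_entry i j).const_add _
  exact Measurable.comp (g := fun X : Mt m => X.det) (f := fun X : Mt m => (k : ℝ) • (1 : Mt m) + X) det_meas h1

lemma evk_K : KInv (evk (m := m)) := by
  intro X _ k hk
  funext j
  have h1 : (j : ℝ) • (1 : Mt m) + k * X * kᵀ = k * ((j : ℝ) • (1 : Mt m) + X) * kᵀ := by
    rw [Matrix.mul_add, Matrix.add_mul, Matrix.mul_smul, Matrix.mul_one, smul_mul, (mem_orth_iff k).1 hk]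
  have h2 : k.det * k.det = 1 := by
    have := congrArg det ((mem_orth_iff k).1 hk)
    rwa [det_mul, det_transpose, det_one] at this
  rw [evk, evk, h1, det_mul, det_mul, det_transpose, mul_right_comm, h2, one_mul]

lemma evk_D (a : Vc n) (k : ℕ) : evk (Dmat a) k = ∏ j, ((k : ℝ) ^ 2 + a j ^ 2) := by
  have : ((k : ℝ) • (1 : Mz n) + Dmat a).submatrix (e2 n) (e2 n) =
      (blockDiagonal fun j => !![(k : ℝ), a j; -a j, (k : ℝ)]).submatrix (prodComm _ _) (prodComm _ _) := by
    ext ⟨i, p⟩ ⟨j, q⟩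
    simp only [submatrix_apply, Matrix.add_apply, Matrix.smul_apply, Matrix.one_apply, (e2 n).apply_eq_iff_eq, Prod.mk.injEq, Dmat_e2, blockDiagonal_apply, prodComm_apply, Prod.swap]
    fin_cases p <;> fin_cases q <;> by_cases h : i = j <;> simp [h]
  rw [evk, ← det_submatrix_equiv_self (e2 n), this, det_submatrix_equiv_self, det_blockDiagonal]
  refine prod_congr rfl fun j _ => ?_
  simp [det_fin_two]; ring

lemma evk_inj : InjOn (fun a : Vc n => evk (Dmat a)) (Ch n) := by
  intro a ha b hb hab
  refine poly_inj ha.2 hb.2 ha.1 hb.1 fun x => ?_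
  let p : Vc n → Polynomial ℝ := fun a => ∏ i, (Polynomial.X + Polynomial.C (a i ^ 2))
  have hp : p a = p b := by
    refine Polynomial.eq_of_infinite_eval_eq _ _ ?_
    refine (infinite_range_of_injective (f := fun k : ℕ => (k : ℝ) ^ 2) ?_).mono ?_
    · intro i j hij
      exact_mod_cast (pow_left_inj₀ (Nat.cast_nonneg i) (Nat.cast_nonneg j) two_ne_zero).1 hij
    · rintro _ ⟨k, rfl⟩
      have := congrFun hab k
      simp only [evk_D] at this
      simpa [p, Polynomial.eval_prod] using this
  have h1 := congrArg (Polynomial.eval (-x)) hp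
  simp only [p, Polynomial.eval_prod, Polynomial.eval_add, Polynomial.eval_X, Polynomial.eval_C] at h1
  have h2 : ∀ c : Vc n, ∏ i, (x - c i ^ 2) = (-1) ^ n * ∏ i, (-x + c i ^ 2) := fun c => by
    have : (-1 : ℝ) ^ n = ∏ _i : Fin n, (-1 : ℝ) := by simp
    rw [this, ← prod_mul_distrib]
    exact prod_congr rfl fun i _ => by ring
  rw [h2, h2, h1]

lemma ex_w {E : Set Vc n} (hE : MeasurableSet E) (hEC : E ⊆ Ch n) :
    ∃ w : Mz n → ENNReal, Measurable w ∧ KInv w ∧ ∀ a ∈ Ch n, w (Dmat a) = E.indicator 1 a := by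
  have hc : Continuous fun a : Vc n => evk (Dmat a) := continuous_pi fun k => by simp only [evk_D]; fun_prop
  have hS : MeasurableSet ((fun a : Vc n => evk (Dmat a)) '' E) := hE.image_of_continuousOn_injOn hc.continuousOn (evk_inj.mono hEC)
  set S := (fun a : Vc n => evk (Dmat a)) '' E with hSd
  refine ⟨fun X => S.indicator 1 (evk X), (measurable_one.indicator hS).comp evk_meas, fun X hX k hk => ?_, fun a ha => ?_⟩
  · simp only [evk_K X hX k hk]
  · have : evk (Dmat a) ∈ S ↔ a ∈ E := (evk_inj.mem_image_iff hEC ha)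
    by_cases h : a ∈ E
    · simp [this.2 h, h]
    · simp [mt this.1 h, h]

lemma gright {k : Mt m} (hk : k ∈ orthogonalGroup (Fin m) ℝ) (Q : Mt m → ENNReal) :
    ∫⁻ u : Um m, Q (of u * k) = ∫⁻ u : Um m, Q (of u) := by
  have hd : kᵀ.det ≠ 0 := fun h => by have := orth_det hk; rw [det_transpose] at h; simp [h] at this
  have h1 : MeasurePreserving (toLin' kᵀ) (volume : Measure Vc m) volume := by
    refine ⟨(LinearMap.continuous_of_finiteDimensional _).measurable, ?_⟩
    rw [Real.map_matrix_volume_pi_eq_smul_volume_pi hd, det_transpose, abs_inv, orth_det hk]; simp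
  have h2 := volume_preserving_pi (fun _ : Fin m => h1)
  have he : MeasurableEmbedding (fun (u : Um m) i => toLin' kᵀ (u i)) := by
    refine Continuous.measurableEmbedding (continuous_pi fun i => (LinearMap.continuous_of_finiteDimensional _).comp (continuous_apply i)) ?_
    intro u v huv
    funext i
    have := congrFun huv i
    have h3 : Function.Injective (toLin' kᵀ) := by
      rw [toLin'_apply', ]
      exact mulVec_injective_of_isUnit ((isUnit_iff_isUnit_det _).2 (isUnit_iff_ne_zero.2 hd))
    exact h3 this
  refine Eq.trans (lintegral_congr fun u => ?_) (h2.lintegral_comp_emb he fun u => Q (of u))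
  congr 1
  ext i j
  simp [Matrix.mul_apply, mulVec, dotProduct, mul_comm]

def PX (P : Mz n → ℝ) (φ : Mz n → ENNReal) (X : Mz n) : ENNReal :=
  ∫⁻ u : Uz n, oR (P (of u)) * φ (of u * X * (of u)ᵀ)

lemma PX_in {φ : Mz n → ENNReal} (hφ : Measurable φ) :
    Measurable fun p : Mz n × Uz n => φ (of p.2 * p.1 * (of p.2)ᵀ) := by
  have h2 : Measurable fun p : Mz n × Mz n => (p.2, p.1) := measurable_snd.prodMk measurable_fst
  have h3 := Measurable.comp (g := fun p : Mz n × Mz n => p.1 * p.2 * p.1ᵀ) (f := fun p : Mz n × Mz n => (p.2, p.1)) conj_meas h2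
  have h4 : Measurable fun p : Mz n × Mz n => φ (p.2 * p.1 * p.2ᵀ) := hφ.comp h3
  exact h4

lemma PX_meas {P σ h} (H : Core n P σ h) {φ : Mz n → ENNReal} (hφ : Measurable φ) : Measurable (PX P φ) := by
  have e : PX P φ = fun Y => ∫⁻ u : Uz n, H.Pm.mk _ u * φ (of u * Y * (of u)ᵀ) := by
    funext Y
    refine lintegral_congr_ae ?_
    filter_upwards [H.Pm.ae_eq_mk] with u hu
    rw [hu]
  rw [e]
  refine Measurable.lintegral_prod_right' (ν := volume) (f := fun p : Mz n × Uz n => H.Pm.mk _ p.2 *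
    φ (of p.2 * p.1 * (of p.2)ᵀ)) ?_
  exact (H.Pm.measurable_mk.comp measurable_snd).mul (PX_in hφ)

lemma PX_KK {P σ h} (H : Core n P σ h) (φ : Mz n → ENNReal) (X : Mz n) {k : Mz n} (hk : k ∈ orthogonalGroup (Fz n) ℝ) :
    PX P φ (k * X * kᵀ) = PX P φ X := by
  have := gright hk fun g => oR (P g) * φ (g * X * gᵀ)
  rw [PX, PX, ← this]
  refine lintegral_congr fun u => ?_
  have hr := H.rk (of u) k hk
  simp only at hr
  rw [hr, transpose_mul]
  simp only [Matrix.mul_assoc]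

lemma idB {P σ h} (H : Core n P σ h) {w φ : Mz n → ENNReal} (hw : Measurable w) (hφ : Measurable φ) :
    ∫⁻ Y, φ Y * w2 P w Y ∂(lam (2*n)) = ∫⁻ X, w X * PX P φ X ∂(lam (2*n)) := by
  rw [idA H hw hφ]
  have hin : ∀ Y, Measurable fun u : Uz n => φ (of u * Y * (of u)ᵀ) :=
    fun Y => Measurable.comp (g := fun p : Mz n × Uz n => φ (of p.2 * p.1 * (of p.2)ᵀ)) (f := fun u => (Y, u))
      (PX_in hφ) (measurable_const.prodMk measurable_id)
  have hin' : ∀ u : Uz n, Measurable fun Y : Mz n => φ (of u * Y * (of u)ᵀ) :=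
    fun u => Measurable.comp (g := fun p : Mz n × Uz n => φ (of p.2 * p.1 * (of p.2)ᵀ)) (f := fun Y => (Y, u))
      (PX_in hφ) (measurable_id.prodMk measurable_const)
  have e : ∀ Y, w Y * PX P φ Y = ∫⁻ u : Uz n, w Y * (H.Pm.mk _ u * φ (of u * Y * (of u)ᵀ)) := fun Y => by
    refine Eq.trans ?_ (lintegral_const_mul (w Y) (H.Pm.measurable_mk.mul (hin Y))).symm
    congr 1
    refine lintegral_congr_ae ?_
    filter_upwards [H.Pm.ae_eq_mk] with u hu
    rw [hu]; rfl
  simp only [e]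
  refine Eq.symm ((lintegral_lintegral_swap ?_).trans ?_)
  · exact ((hw.comp measurable_fst).mul ((H.Pm.measurable_mk.comp measurable_snd).mul (PX_in hφ))).aemeasurable
  · refine lintegral_congr_ae ?_
    filter_upwards [H.Pm.ae_eq_mk] with u hu
    rw [← hu]
    refine Eq.trans ?_ (lintegral_const_mul _ (hw.mul (hin' u)))
    exact lintegral_congr fun Y => by ring

lemma idCh {P σ h} (H : Core n P σ h) {w φ : Mz n → ENNReal} (hw : Measurable w) (hK : KInv w) (hφ : Measurable φ) (hφK : KInv φ) :
    ∫⁻ b in Ch n, φ (Dmat b) * w2 P w (Dmat b) * oR (Dl b ^ 2) =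
    ∫⁻ b in Ch n, w (Dmat b) * PX P φ (Dmat b) * oR (Dl b ^ 2) := by
  have := idB H hw hφ
  rw [Weyl n (fun X => φ X * w2 P w X) (hφ.mul (w2_meas H hw)) fun X hX k hk => by simp only []; rw [hφK X hX k hk, w2_K H w X hX k hk],
    Weyl n (fun X => w X * PX P φ X) (hw.mul (PX_meas H hφ)) fun X hX k hk => by simp only []; rw [hK X hX k hk, PX_KK H φ X hk]] at this
  exact (ENNReal.mul_right_inj (cW_ne n) (cW_fin n)).1 this

def pw (s : Perm (Fin n)) : ENNReal := if Perm.sign s = 1 then 1 else 0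
def nw (s : Perm (Fin n)) : ENNReal := if Perm.sign s = 1 then 0 else 1
lemma pw_fin (s : Perm (Fin n)) : pw s ≠ ⊤ := by unfold pw; split_ifs <;> simp
lemma nw_fin (s : Perm (Fin n)) : nw s ≠ ⊤ := by unfold nw; split_ifs <;> simp
lemma pnw (s : Perm (Fin n)) : ((Perm.sign s : ℤ) : ℝ) = (pw s).toReal - (nw s).toReal := by
  rcases Int.units_eq_one_or (Perm.sign s) with h | h <;> simp [pw, nw, h]

lemma pn_iff {A k : ENNReal} (hA : A ≠ ⊤) (hk : k ≠ ⊤) {V : Perm (Fin n) → ENNReal} (hV : ∀ s, V s ≠ ⊤) :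
    A + k * ∑ s, nw s * V s = k * ∑ s, pw s * V s ↔ A.toReal = k.toReal * ∑ s, ((Perm.sign s : ℤ) : ℝ) * (V s).toReal := by
  have h1 : ∑ s, nw s * V s ≠ ⊤ := sum_ne_top.2 fun s _ => mul_ne_top (nw_fin s) (hV s)
  have h2 : ∑ s, pw s * V s ≠ ⊤ := sum_ne_top.2 fun s _ => mul_ne_top (pw_fin s) (hV s)
  rw [← toReal_eq_toReal_iff' (add_ne_top.2 ⟨hA, mul_ne_top hk h1⟩) (mul_ne_top hk h2),
    toReal_add hA (mul_ne_top hk h1), toReal_mul, toReal_mul,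
    toReal_sum fun s _ => mul_ne_top (nw_fin s) (hV s), toReal_sum fun s _ => mul_ne_top (pw_fin s) (hV s)]
  simp only [pnw, sub_mul, sum_sub_distrib, toReal_mul, mul_sub]
  constructor <;> intro h <;> linarith

lemma dens2 {P σ h} (H : Core n P σ h) {w : Mz n → ENNReal} (hw : Measurable w) (hK : KInv w)
    (hi : ∫⁻ X, w X ∂(lam (2*n)) ≠ ⊤) [IsFiniteMeasure (Wm w)] :
    ∀ᵐ b, b ∈ Ch n → w2 P w (Dmat b) * oR (Dl b) + kap n * ∑ s, nw s * Vs h (Wm w) s b = kap n * ∑ s, pw s * Vs h (Wm w) s b := by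
  have hμ : ∀ᵐ t ∂(Wm w), ∀ c, 0 < t c := (Wm_Ch w).mono fun t ht => ht.1
  obtain ⟨hf, -⟩ := Wm_ae (w2_meas H hw) (Wm_D (w2_meas H hw) (w2_K H w) (w2_fin H hw hi))
  rw [ae_restrict_iff' (Ch_meas n)] at hf
  have hV : ∀ᵐ b, ∀ s, Vs h (Wm w) s b < ⊤ := ae_all_iff.2 fun s => ae_lt_top (Vs_meas H.hm (Wm w) s) (Vs_fin H (Wm w) hμ s)
  filter_upwards [dens H hw hK hi, hf, hV] with b h1 h2 h3 hc
  exact (pn_iff (h2 hc).ne (kap_fin n) fun s => (h3 s).ne).2 (h1 hc)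

def fφ (φ : Mz n → ENNReal) : Vc n → ENNReal := (Ch n).indicator fun b => φ (Dmat b) * oR (Dl b)

lemma fφ_meas {φ : Mz n → ENNReal} (hφ : Measurable φ) : Measurable (fφ φ) :=
  ((hφ.comp Dmat_meas).mul Dl_meas.ennreal_ofReal).indicator (Ch_meas n)

def Qs (h : ℝ → ℝ) (f : Vc n → ENNReal) (s : Perm (Fin n)) (t : Vc n) : ENNReal :=
  ∫⁻ x : Vc n, oR (∏ c, h (x c)) * f (fun c => x c * t (s c))

lemma Qs_meas {h : ℝ → ℝ} (hh : Measurable h) {f : Vc n → ENNReal} (hf : Measurable f) (s : Perm (Fin n)) : Measurable (Qs h f s) := by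
  refine Measurable.lintegral_prod_left' (μ := volume) (f := fun p : Vc n × Vc n => oR (∏ c, h (p.1 c)) * f (ms s p)) ?_
  have h1 : Measurable fun x : Vc n => oR (∏ c, h (x c)) :=
    (measurable_prod _ fun c _ => hh.comp (measurable_pi_apply c)).ennreal_ofReal
  exact (h1.comp measurable_fst).mul (hf.comp (ms_meas s))

lemma intW {P σ h} (H : Core n P σ h) {w φ : Mz n → ENNReal} (hw : Measurable w) (hK : KInv w)
    (hi : ∫⁻ X, w X ∂(lam (2*n)) ≠ ⊤) [IsFiniteMeasure (Wm w)] (hφ : Measurable φ) (hφK : KInv φ) :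
    ∫⁻ t, (PX P φ (Dmat t) * oR (Dl t) + kap n * ∑ s, nw s * Qs h (fφ φ) s t) ∂(Wm w) =
    ∫⁻ t, (kap n * ∑ s, pw s * Qs h (fφ φ) s t) ∂(Wm w) := by
  have hμ : ∀ᵐ t ∂(Wm w), ∀ c, 0 < t c := (Wm_Ch w).mono fun t ht => ht.1
  have hm := fφ_meas hφ
  have hP : Measurable fun t : Vc n => PX P φ (Dmat t) * oR (Dl t) := ((PX_meas H hφ).comp Dmat_meas).mul Dl_meas.ennreal_ofReal
  have hS : ∀ r : Perm (Fin n) → ENNReal, ∫⁻ t, (kap n * ∑ s, r s * Qs h (fφ φ) s t) ∂(Wm w) =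
      ∫⁻ b, fφ φ b * (kap n * ∑ s, r s * Vs h (Wm w) s b) := fun r => by
    rw [lintegral_const_mul _ (measurable_sum _ fun s _ => (Qs_meas H.hm hm s).const_mul _),
      lintegral_finsetSum _ fun s _ => (Qs_meas H.hm hm s).const_mul _]
    have : ∀ b, fφ φ b * (kap n * ∑ s, r s * Vs h (Wm w) s b) = kap n * ∑ s, r s * (Vs h (Wm w) s b * fφ φ b) := fun b => by
      simp only [mul_sum]
      refine Finset.sum_congr rfl fun s _ => by ring
    simp only [this]
    have hVm : ∀ s, Measurable fun b => Vs h (Wm w) s b * fφ φ b := fun s => (Vs_meas H.hm (Wm w) s).mul hm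
    rw [lintegral_const_mul _ (measurable_sum _ fun s _ => (hVm s).const_mul _),
      lintegral_finsetSum _ fun s _ => (hVm s).const_mul _]
    congr 1
    refine Finset.sum_congr rfl fun s _ => ?_
    rw [lintegral_const_mul _ (Qs_meas H.hm hm s)]
    rw [lintegral_const_mul _ (hVm s)]
    congr 1
    exact Vs_lint H.hm (Wm w) hμ s hm
  rw [lintegral_add_left hP, hS, hS, Wm_lint hw hP]
  have e : ∫⁻ a in Ch n, w (Dmat a) * oR (Dl a) * (PX P φ (Dmat a) * oR (Dl a)) =
      ∫⁻ b, fφ φ b * (w2 P w (Dmat b) * oR (Dl b)) := by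
    have h1 : ∫⁻ a in Ch n, w (Dmat a) * oR (Dl a) * (PX P φ (Dmat a) * oR (Dl a)) =
        ∫⁻ b in Ch n, w (Dmat b) * PX P φ (Dmat b) * oR (Dl b ^ 2) := by
      refine setLIntegral_congr_fun (Ch_meas n) fun a ha => ?_
      rw [pow_two, ENNReal.ofReal_mul (Dl_pos ha).le]; ring
    rw [h1, ← idCh H hw hK hφ hφK, ← lintegral_indicator (Ch_meas n)]
    refine lintegral_congr fun b => ?_
    by_cases hb : b ∈ Ch n
    · simp only [fφ, indicator_of_mem hb]
      rw [pow_two, ENNReal.ofReal_mul (Dl_pos hb).le]; ring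
    · simp only [fφ, indicator_of_notMem hb, zero_mul]
  rw [e, ← lintegral_add_left]
  · refine lintegral_congr_ae ?_
    filter_upwards [dens2 H hw hK hi] with b hb
    by_cases hc : b ∈ Ch n
    · rw [← hb hc]; ring
    · simp only [fφ, indicator_of_notMem hc, zero_mul, add_zero]
  · exact hm.mul (((w2_meas H hw).comp Dmat_meas).mul Dl_meas.ennreal_ofReal)

lemma aeid {P σ h} (H : Core n P σ h) {φ : Mz n → ENNReal} (hφ : Measurable φ) (hφK : KInv φ) :
    ∀ᵐ t, t ∈ Ch n → PX P φ (Dmat t) * oR (Dl t) + kap n * ∑ s, nw s * Qs h (fφ φ) s t = kap n * ∑ s, pw s * Qs h (fφ φ) s t := by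
  have hm := fφ_meas hφ
  have hP : Measurable fun t : Vc n => PX P φ (Dmat t) * oR (Dl t) := ((PX_meas H hφ).comp Dmat_meas).mul Dl_meas.ennreal_ofReal
  have hS : ∀ r : Perm (Fin n) → ENNReal, Measurable fun t => kap n * ∑ s, r s * Qs h (fφ φ) s t := fun r =>
    (measurable_sum _ fun s _ => (Qs_meas H.hm hm s).const_mul _).const_mul _
  have key : ∀ R : ℕ, ∀ᵐ t ∂(volume.restrict (Ch n ∩ Metric.closedBall 0 R)),
      oR (Dl t) * (PX P φ (Dmat t) * oR (Dl t) + kap n * ∑ s, nw s * Qs h (fφ φ) s t) = oR (Dl t) * (kap n * ∑ s, pw s * Qs h (fφ φ) s t) := by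
    intro R
    have hB : MeasurableSet (Ch n ∩ Metric.closedBall (0 : Vc n) R) := (Ch_meas n).inter measurableSet_closedBall
    refine ae_eq_of_forall_setLIntegral_eq_of_sigmaFinite (Dl_meas.ennreal_ofReal.mul (hP.add (hS _))) (Dl_meas.ennreal_ofReal.mul (hS _)) fun S hSm _ => ?_
    rw [restrict_restrict hSm]
    have hE := hSm.inter hB
    have hEC : S ∩ (Ch n ∩ Metric.closedBall (0 : Vc n) R) ⊆ Ch n := fun x hx => hx.2.1
    set E := S ∩ (Ch n ∩ Metric.closedBall (0 : Vc n) R) with hEd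
    obtain ⟨w, hw, hK, hwE⟩ := ex_w hE hEC
    have hW : ∀ F : Vc n → ENNReal, ∫⁻ a in Ch n, w (Dmat a) * F a = ∫⁻ a in E, F a := fun F => by
      rw [← lintegral_indicator hE, ← lintegral_indicator (Ch_meas n)]
      refine lintegral_congr fun a => ?_
      by_cases ha : a ∈ Ch n
      · rw [indicator_of_mem ha, hwE a ha]
        by_cases hc : a ∈ E
        · simp [hc]
        · simp [hc]
      · rw [indicator_of_notMem ha, indicator_of_notMem fun h => ha (hEC h)]
    have hfin : ∀ q : Vc n → ℝ, Continuous q → ∫⁻ a in E, oR (q a) ≠ ⊤ := fun q hq => by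
      have : IntegrableOn q E := (hq.continuousOn.integrableOn_compact (isCompact_closedBall (0 : Vc n) R)).mono_set fun x hx => hx.2.2
      exact this.lintegral_lt_top.ne
    have hi : ∫⁻ X, w X ∂(lam (2*n)) ≠ ⊤ := by
      rw [Weyl n w hw hK]
      refine mul_ne_top (cW_fin n) ?_
      rw [hW]
      exact hfin (fun a => Dl a ^ 2) (Dl_cont.pow 2)
    have : IsFiniteMeasure (Wm w) := by
      constructor
      have := Wm_lint hw (f := fun _ => 1) measurable_const
      simp only [mul_one, lintegral_const, one_mul] at this
      rw [this, hW]
      exact (hfin _ Dl_cont).lt_top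
    have := intW H hw hK hi hφ hφK
    have h5 : Measurable fun t : Vc n => PX P φ (Dmat t) * oR (Dl t) + kap n * ∑ s, nw s * Qs h (fφ φ) s t := hP.add (hS _)
    rw [Wm_lint hw h5, Wm_lint hw (hS _)] at this
    simp only [mul_assoc (w _)] at this
    rwa [hW, hW] at this
  have k2 : ∀ᵐ t, ∀ R : ℕ, t ∈ Ch n ∩ Metric.closedBall (0 : Vc n) R →
      oR (Dl t) * (PX P φ (Dmat t) * oR (Dl t) + kap n * ∑ s, nw s * Qs h (fφ φ) s t) = oR (Dl t) * (kap n * ∑ s, pw s * Qs h (fφ φ) s t) :=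
    ae_all_iff.2 fun R => (ae_restrict_iff' ((Ch_meas n).inter measurableSet_closedBall)).1 (key R)
  filter_upwards [k2] with t ht hc
  obtain ⟨R, hR⟩ := exists_nat_ge ‖t‖
  refine (ENNReal.mul_right_inj (ofReal_pos.2 (Dl_pos hc)).ne' ofReal_ne_top).1 (ht R ⟨hc, ?_⟩)
  simpa using hR

def dv (i : Fz n) : Fin n := ⟨i.val / 2, by have := i.isLt; omega⟩

lemma scaleD {t : Vc n} (ht : ∀ c, 0 < t c) (u : Uz n) :
    (of fun i j => u i j * √(t (dv j))) * Dmat (fun _ : Fin n => (1:ℝ)) * (of fun i j => u i j * √(t (dv j)))ᵀ =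
      of u * Dmat t * (of u)ᵀ := by
  have h1 : (of fun i j => u i j * √(t (dv j)) : Mz n) = of u * Matrix.diagonal fun j => √(t (dv j)) := by
    ext i j; simp [mul_diagonal]
  have h2 : (Matrix.diagonal fun j => √(t (dv j))) * Dmat (fun _ : Fin n => (1:ℝ)) * (Matrix.diagonal fun j => √(t (dv j))) = Dmat t := by
    ext i j
    rw [mul_diagonal, diagonal_mul]
    simp only [Dmat, of_apply]
    split_ifs with h
    · have : dv j = dv i := Fin.ext h.symm
      rw [this]
      have h3 := Real.mul_self_sqrt (ht (dv i)).le
      change _ = t (dv i) * _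
      linear_combination h3
    · change _ = t (dv i) * _
      have : dv j = dv i := Fin.ext h.symm
      rw [this]
      have h3 := Real.mul_self_sqrt (ht (dv i)).le
      linear_combination -h3
    · simp
    · simp
  rw [h1, ← h2, transpose_mul, diagonal_transpose]
  simp only [Matrix.mul_assoc]

lemma uDu_meas {φ : Mz n → ℝ} (hφ : Measurable φ) (X : Mz n) : Measurable fun u : Uz n => φ (of u * X * (of u)ᵀ) := by
  have h1 := Measurable.comp (g := fun p : Mz n × Mz n => p.1 * p.2 * p.1ᵀ) (f := fun u : Mz n => (u, X))
        conj_meas (measurable_id.prodMk measurable_const)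
  have h2 : Measurable fun u : Mz n => φ (u * X * uᵀ) := hφ.comp h1
  exact h2

def LP (P φ : Mz n → ℝ) (t : Vc n) : ℝ := ∫ u : Uz n, P (of u) * φ (of u * Dmat t * (of u)ᵀ)

lemma LP_cont {P σ h} (H : Core n P σ h) {φ : Mz n → ℝ} (hφ : Measurable φ) {C : ℝ} (hC : ∀ X, |φ X| ≤ C) :
    ContinuousOn (LP P φ) {t | ∀ c, 0 < t c} := by
  have e : ∀ t : Vc n, (∀ c, 0 < t c) → LP P φ t = ∫ v : Fz n × Fz n → ℝ, P (of fun i j => v (i, j)) *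
      φ ((of fun i j => v (i, j) * √(t (dv j))) * Dmat (fun _ : Fin n => (1:ℝ)) * (of fun i j => v (i, j) * √(t (dv j)))ᵀ) := fun t ht => by
    have e2 : ∀ v : Fz n × Fz n → ℝ, φ ((of fun i j => v (i, j) * √(t (dv j))) * Dmat (fun _ : Fin n => (1:ℝ)) * (of fun i j => v (i, j) * √(t (dv j)))ᵀ) =
      φ ((of fun i j => v (i, j)) * Dmat t * (of fun i j => v (i, j))ᵀ) := fun v => by
      rw [← scaleD ht]
    simp only [e2]
    have he : MeasurableEmbedding fun (y : Fz n × Fz n → ℝ) (i : Fz n) (j : Fz n) => y (i, j) := by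
      refine Continuous.measurableEmbedding (by fun_prop) fun x y hxy => ?_
      funext p; exact congrFun (congrFun hxy p.1) p.2
    exact (mp_curry.integral_comp he (fun u : Uz n => P (of u) * φ (of u * Dmat t * (of u)ᵀ))).symm
  have hG : Integrable fun v : Fz n × Fz n → ℝ => P (of fun i j => v (i, j)) :=
    mp_curry.integrable_comp_of_integrable (g := fun u : Uz n => P (of u)) H.fac.integrable
  have hm : Measurable fun v : Fz n × Fz n → ℝ => φ ((of fun i j => v (i, j)) * Dmat (fun _ : Fin n => (1:ℝ)) * (of fun i j => v (i, j))ᵀ) :=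
    Measurable.comp (g := fun u : Uz n => φ (of u * Dmat (fun _ : Fin n => (1:ℝ)) * (of u)ᵀ)) (f := fun (y : Fz n × Fz n → ℝ) (i : Fz n) (j : Fz n) => y (i, j))
      (uDu_meas hφ _) (by fun_prop)
  have hc := cont1 hG hm (C := C) fun v => hC _
  have hq : Continuous fun (t : Vc n) (p : Fz n × Fz n) => √(t (dv p.2)) := by fun_prop
  have := hc.comp (t := {c : Fz n × Fz n → ℝ | ∀ i, 0 < c i}) hq.continuousOn (s := {t : Vc n | ∀ c, 0 < t c}) fun t ht p => Real.sqrt_pos.2 (ht _)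
  exact this.congr fun t ht => e t ht

lemma Dl_exp (b : Vc n) : Dl b = ∑ τ : Perm (Fin n), ((Perm.sign τ : ℤ) : ℝ) * ∏ c, b c ^ (2 * (τ c).val) := by
  rw [Dl, vdm_eq_det, ← det_transpose, det_apply']
  refine Finset.sum_congr rfl fun τ _ => ?_
  congr 1
  refine prod_congr rfl fun c _ => ?_
  rw [transpose_apply, vandermonde_apply, ← pow_mul]

lemma Core.G {P σ h} (H : Core n P σ h) (τ : Perm (Fin n)) : Integrable fun x : Vc n => ∏ c, h (x c) * x c ^ (2 * (τ c).val) :=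
  Integrable.fintype_prod (f := fun c t => h t * t ^ (2 * (τ c).val)) fun c => H.int (τ c)

lemma Rs_exp (h : ℝ → ℝ) (Φ : Vc n → ℝ) (t : Vc n) (x : Vc n) :
    (∏ c, h (x c)) * (Φ (fun c => x c * t c) * Dl (fun c => x c * t c)) =
    ∑ τ : Perm (Fin n), (((Perm.sign τ : ℤ) : ℝ) * ∏ c, t c ^ (2 * (τ c).val)) * ((∏ c, h (x c) * x c ^ (2 * (τ c).val)) * Φ (fun c => x c * t c)) := by
  rw [Dl_exp, mul_sum, mul_sum]
  refine Finset.sum_congr rfl fun τ _ => ?_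
  simp only [mul_pow, prod_mul_distrib]
  ring

lemma sc_meas (t : Vc n) : Measurable fun (x : Vc n) (c : Fin n) => x c * t c :=
  measurable_pi_lambda _ fun c => (measurable_pi_apply c).mul_const _

lemma Rs_int {P σ h} (H : Core n P σ h) {Φ : Vc n → ℝ} (hΦ : Measurable Φ) {C : ℝ} (hC : ∀ b, |Φ b| ≤ C) (t : Vc n) (τ : Perm (Fin n)) :
    Integrable fun x : Vc n => (((Perm.sign τ : ℤ) : ℝ) * ∏ c, t c ^ (2 * (τ c).val)) * ((∏ c, h (x c) * x c ^ (2 * (τ c).val)) * Φ (fun c => x c * t c)) :=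
  ((H.G τ).mul_bdd (c := C) (hΦ.comp (sc_meas t)).aestronglyMeasurable (ae_of_all _ fun x => hC _)).const_mul _

lemma Rs_int2 {P σ h} (H : Core n P σ h) {Φ : Vc n → ℝ} (hΦ : Measurable Φ) {C : ℝ} (hC : ∀ b, |Φ b| ≤ C) (t : Vc n) :
    Integrable fun x : Vc n => (∏ c, h (x c)) * (Φ (fun c => x c * t c) * Dl (fun c => x c * t c)) := by
  simp only [Rs_exp]
  exact integrable_finsetSum _ fun τ _ => Rs_int H hΦ hC t τ

def Rs (h : ℝ → ℝ) (Φ : Vc n → ℝ) (t : Vc n) : ℝ := ∫ x : Vc n, (∏ c, h (x c)) * (Φ (fun c => x c * t c) * Dl (fun c => x c * t c))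

lemma Rs_cont {P σ h} (H : Core n P σ h) {Φ : Vc n → ℝ} (hΦ : Measurable Φ) {C : ℝ} (hC : ∀ b, |Φ b| ≤ C) :
    ContinuousOn (Rs h Φ) {t | ∀ c, 0 < t c} := by
  have e : Rs h Φ = fun t => ∑ τ : Perm (Fin n), (((Perm.sign τ : ℤ) : ℝ) * ∏ c, t c ^ (2 * (τ c).val)) * ∫ x : Vc n, ((∏ c, h (x c) * x c ^ (2 * (τ c).val)) * Φ (fun c => x c * t c)) := by
    funext t
    rw [Rs]
    simp only [Rs_exp]
    rw [integral_finsetSum _ fun τ _ => Rs_int H hΦ hC t τ]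
    simp only [integral_const_mul]
  rw [e]
  refine continuousOn_finset_sum _ fun τ _ => ContinuousOn.mul (by fun_prop) ?_
  exact cont1 (H.G τ) hΦ hC

def Φc (φ : Mz n → ℝ) : Vc n → ℝ := (Ch n).indicator fun b => φ (Dmat b)

lemma Φc_meas {φ : Mz n → ℝ} (hφ : Measurable φ) : Measurable (Φc φ) := (hφ.comp Dmat_meas).indicator (Ch_meas n)

lemma Φc_le {φ : Mz n → ℝ} {C : ℝ} (hC : ∀ X, |φ X| ≤ C) (b : Vc n) : |Φc φ b| ≤ C := by
  by_cases hb : b ∈ Ch n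
  · rw [Φc, indicator_of_mem hb]; exact hC _
  · rw [Φc, indicator_of_notMem hb, abs_zero]; exact (abs_nonneg _).trans (hC 0)

lemma ev1 {P σ h} (H : Core n P σ h) {φ : Mz n → ℝ} (hφ : Measurable φ) (hφK : KInv φ) (h0 : ∀ X, 0 ≤ φ X) {C : ℝ} (hC : ∀ X, |φ X| ≤ C)
    {t : Vc n} (ht : t ∈ Ch n) :
    LP P φ t * Dl t = (kap n).toReal * ∑ s : Perm (Fin n), ((Perm.sign s : ℤ) : ℝ) * Rs h (Φc φ) (fun c => t (s c)) := by
  have hsub : Ch n ⊆ {t : Vc n | ∀ c, 0 < t c} := fun t ht => ht.1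
  refine eqOn_open_of_ae_eq (μ := volume) (f := fun t => LP P φ t * Dl t) (g := fun t => (kap n).toReal * ∑ s : Perm (Fin n), ((Perm.sign s : ℤ) : ℝ) * Rs h (Φc φ) (fun c => t (s c))) ?_ (Ch_open n) ?_ ?_ ht
  · rw [Filter.EventuallyEq, ae_restrict_iff' (Ch_meas n)]
    filter_upwards [aeid H (φ := fun X => oR (φ X)) hφ.ennreal_ofReal fun X hX k hk => by simp only []; rw [hφK X hX k hk]] with t ha ht
    have e1 : PX P (fun X => oR (φ X)) (Dmat t) = oR (LP P φ t) := by
      rw [PX, LP, ofReal_integral_eq_lintegral_ofReal]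
      · refine lintegral_congr fun u => ?_
        rw [ENNReal.ofReal_mul (H.fac.nonneg _)]
      · exact H.fac.integrable.mul_bdd (c := C) (uDu_meas hφ _).aestronglyMeasurable (ae_of_all _ fun u => hC _)
      · exact ae_of_all _ fun u => mul_nonneg (H.fac.nonneg _) (h0 _)
    have e2 : ∀ s, Qs h (fφ fun X => oR (φ X)) s t = oR (Rs h (Φc φ) (fun c => t (s c))) := fun s => by
      have hz : ∀ b : Vc n, 0 ≤ Φc φ b * Dl b := fun b => by
        by_cases hb : b ∈ Ch n
        · rw [Φc, indicator_of_mem hb]; exact mul_nonneg (h0 _) (Dl_pos hb).le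
        · rw [Φc, indicator_of_notMem hb, zero_mul]
      have hH : ∀ x : Vc n, 0 ≤ ∏ c, h (x c) := fun x => prod_nonneg fun c _ => H.nn _
      rw [Qs, Rs, ofReal_integral_eq_lintegral_ofReal (Rs_int2 H (Φc_meas hφ) (Φc_le hC) _) (ae_of_all _ fun x => mul_nonneg (hH x) (hz _))]
      refine lintegral_congr fun x => ?_
      rw [ENNReal.ofReal_mul (hH x)]
      congr 1
      by_cases hb : (fun c => x c * t (s c)) ∈ Ch n
      · rw [Φc, fφ, indicator_of_mem hb, indicator_of_mem hb, ENNReal.ofReal_mul (h0 _)]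
      · rw [Φc, fφ, indicator_of_notMem hb, indicator_of_notMem hb]; simp
    have e3 : ∀ s : Perm (Fin n), 0 ≤ Rs h (Φc φ) (fun c => t (s c)) := fun s => by
      refine integral_nonneg fun x => mul_nonneg (prod_nonneg fun c _ => H.nn _) ?_
      by_cases hb : (fun c => x c * t (s c)) ∈ Ch n
      · rw [Φc, indicator_of_mem hb]; exact mul_nonneg (h0 _) (Dl_pos hb).le
      · rw [Φc, indicator_of_notMem hb, zero_mul]
    have e4 : 0 ≤ LP P φ t := integral_nonneg fun u => mul_nonneg (H.fac.nonneg _) (h0 _)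
    have := ha ht
    simp only [e1, e2] at this
    rw [pn_iff (mul_ne_top ofReal_ne_top ofReal_ne_top) (kap_fin n) fun s => ofReal_ne_top, toReal_mul,
      toReal_ofReal e4, toReal_ofReal (Dl_pos ht).le] at this
    simp only [toReal_ofReal (e3 _)] at this
    exact this
  · exact ((LP_cont H hφ hC).mono hsub).mul Dl_cont.continuousOn
  · refine continuousOn_const.mul (continuousOn_finset_sum _ fun s _ => continuousOn_const.mul ?_)
    have hq : Continuous fun (t : Vc n) (c : Fin n) => t (s c) := by fun_prop
    exact (Rs_cont H (Φc_meas hφ) (Φc_le hC)).comp hq.continuousOn fun t ht c => ht.1 _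

def hdt (h : ℝ → ℝ) (t b : Vc n) : ℝ := (of fun i c => (1 / t c) * h (b i / t c)).det

lemma hdt_exp (h : ℝ → ℝ) (t b : Vc n) : hdt h t b = ∑ s : Perm (Fin n), ((Perm.sign s : ℤ) : ℝ) * Hs h s b t := by
  rw [hdt, ← det_transpose, det_apply']
  refine Finset.sum_congr rfl fun s _ => ?_
  congr 1
  refine prod_congr rfl fun c _ => ?_
  simp only [transpose_apply, of_apply]
  ring

lemma Rs_chg {P σ h} (H : Core n P σ h) {Φ : Vc n → ℝ} (hΦ : Measurable Φ) {C : ℝ} (hC : ∀ b, |Φ b| ≤ C) {t : Vc n} (ht : ∀ c, 0 < t c) (s : Perm (Fin n)) :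
    Integrable (fun b => Hs h s b t * (Φ b * Dl b)) ∧ Rs h Φ (fun c => t (s c)) = ∫ b, Hs h s b t * (Φ b * Dl b) := by
  have hp : 0 < ∏ c, t (s c) := prod_pos fun c _ => ht _
  have e : ∀ x : Vc n, (∏ c, h (x c)) * (Φ (fun c => x c * t (s c)) * Dl (fun c => x c * t (s c))) =
      (fun b : Vc n => (∏ c, h (b c / t (s c))) * (Φ b * Dl b)) (fun c => x c * t (s c)) := fun x => by
    simp only [mul_div_cancel_right₀ _ (ht _).ne']
  have e2 : ∀ b, Hs h s b t * (Φ b * Dl b) = (∏ c, t (s c))⁻¹ * ((∏ c, h (b c / t (s c))) * (Φ b * Dl b)) := fun b => by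
    simp only [Hs, Finset.prod_div_distrib]; ring
  constructor
  · simp only [e2]
    refine Integrable.const_mul ?_ _
    have h1 := Rs_int2 H hΦ hC (fun c => t (s c))
    simp only [e] at h1
    have h2 := ((scal (c := fun c => t (s c)) fun c => ht (s c)).1.integrable_map_iff (μ := volume) (g := fun b : Vc n => (∏ c, h (b c / t (s c))) * (Φ b * Dl b))).2 h1
    rw [(scal (c := fun c => t (s c)) fun c => ht (s c)).2] at h2
    exact (integrable_smul_measure (by simpa using hp) (by simp)).1 h2
  · rw [Rs]
    simp only [e, e2]
    rw [integral_const_mul]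
    exact iscal (c := fun c => t (s c)) (fun c => ht (s c)) (fun b : Vc n => (∏ c, h (b c / t (s c))) * (Φ b * Dl b))

lemma ev2 {P σ h} (H : Core n P σ h) {φ : Mz n → ℝ} (hφ : Measurable φ) {C : ℝ} (hC : ∀ X, |φ X| ≤ C)
    {t : Vc n} (ht : t ∈ Ch n) : IntegrableOn (fun b => φ (Dmat b) * Dl b * hdt h t b) (Ch n) ∧
    ∑ s : Perm (Fin n), ((Perm.sign s : ℤ) : ℝ) * Rs h (Φc φ) (fun c => t (s c)) = ∫ b in Ch n, φ (Dmat b) * Dl b * hdt h t b := by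
  have hR := Rs_chg H (Φc_meas hφ) (Φc_le hC) ht.1
  have e : (Ch n).indicator (fun b => φ (Dmat b) * Dl b * hdt h t b) = fun b => ∑ s : Perm (Fin n), ((Perm.sign s : ℤ) : ℝ) * (Hs h s b t * (Φc φ b * Dl b)) := by
    funext b
    by_cases hb : b ∈ Ch n
    · rw [indicator_of_mem hb]
      simp only [Φc, indicator_of_mem hb]
      rw [hdt_exp, mul_sum]
      exact Finset.sum_congr rfl fun s _ => by ring
    · rw [indicator_of_notMem hb]
      simp only [Φc, indicator_of_notMem hb, zero_mul, mul_zero, sum_const_zero]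
  have hi : ∀ s : Perm (Fin n), Integrable fun b => ((Perm.sign s : ℤ) : ℝ) * (Hs h s b t * (Φc φ b * Dl b)) := fun s => (hR s).1.const_mul _
  constructor
  · rw [← integrable_indicator_iff (Ch_meas n), e]
    exact integrable_finsetSum _ fun s _ => hi s
  · rw [← integral_indicator (Ch_meas n), e, integral_finsetSum _ fun s _ => hi s]
    exact Finset.sum_congr rfl fun s _ => by rw [integral_const_mul, (hR s).2]

lemma ev3 {P σ h} (H : Core n P σ h) {φ : Mz n → ℝ} (hφ : Measurable φ) (hφK : KInv φ) {C : ℝ} (hC : ∀ X, |φ X| ≤ C)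
    {t : Vc n} (ht : t ∈ Ch n) : LP P φ t * Dl t = (kap n).toReal * ∫ b in Ch n, φ (Dmat b) * Dl b * hdt h t b := by
  have hC0 : 0 ≤ C := (abs_nonneg _).trans (hC 0)
  have hp : ∀ X, 0 ≤ φ X + C := fun X => by linarith [neg_abs_le (φ X), hC X]
  have hb : ∀ X, |φ X + C| ≤ C + C := fun X => (abs_add_le _ _).trans (by rw [abs_of_nonneg hC0]; linarith [hC X])
  have hc : ∀ _ : Mz n, |C| ≤ C := fun _ => (abs_of_nonneg hC0).le
  have a1 := ev1 H (φ := fun X => φ X + C) (hφ.add_const C) (fun X hX k hk => by simp only []; rw [hφK X hX k hk]) hp hb ht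
  have a2 := ev1 H (φ := fun _ => C) measurable_const (fun X hX k hk => rfl) (fun _ => hC0) hc ht
  rw [(ev2 H (φ := fun X => φ X + C) (hφ.add_const C) hb ht).2] at a1
  rw [(ev2 H (φ := fun _ => C) measurable_const hc ht).2] at a2
  have i1 : Integrable fun u : Uz n => P (of u) * φ (of u * Dmat t * (of u)ᵀ) :=
    H.fac.integrable.mul_bdd (c := C) (uDu_meas hφ _).aestronglyMeasurable (ae_of_all _ fun u => hC _)
  have i2 : Integrable fun u : Uz n => P (of u) * C := H.fac.integrable.mul_const C
  have e1 : LP P (fun X => φ X + C) t = LP P φ t + LP P (fun _ => C) t := by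
    simp only [LP, mul_add]
    exact integral_add i1 i2
  have e2 : ∫ b in Ch n, (φ (Dmat b) + C) * Dl b * hdt h t b = (∫ b in Ch n, φ (Dmat b) * Dl b * hdt h t b) + ∫ b in Ch n, C * Dl b * hdt h t b := by
    simp only [add_mul]
    exact integral_add (ev2 H hφ hC ht).1 (ev2 H (φ := fun _ => C) measurable_const hc ht).1
  rw [e1, e2, add_mul, a2, mul_add] at a1
  exact add_right_cancel a1

lemma kapM {P σ h} (H : Core n P σ h) : (kap n).toReal * ∏ c : Fin n, ∫ t, h t * t ^ (2 * c.val) = 1 := by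
  have h1 := H.QRm 0 (Ψ := fun _ => 1) measurable_const (fun _ => one_ne_top)
  simp only [mul_one] at h1
  have hi := H.G (Equiv.refl _)
  simp only [refl_apply] at hi
  have hn : ∀ (t : ℝ) (c : Fin n), 0 ≤ h t * t ^ (2 * c.val) := fun t c => mul_nonneg (H.nn t) (by rw [pow_mul]; positivity)
  rw [H.one, ← ofReal_integral_eq_lintegral_ofReal hi (ae_of_all _ fun x => prod_nonneg fun c _ => hn _ _)] at h1
  have h2 : ∫ x : Vc n, ∏ c, h (x c) * x c ^ (2 * c.val) = ∏ c : Fin n, ∫ t, h t * t ^ (2 * c.val) :=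
    integral_fintype_prod_eq_prod (fun (c : Fin n) t => h t * t ^ (2 * c.val))
  have h3 := congrArg ENNReal.toReal h1
  rw [toReal_mul, toReal_ofReal (integral_nonneg fun x => prod_nonneg fun c _ => hn _ _), h2] at h3
  simpa using h3.symm

lemma Dperm (a : Vc n) (π : Perm (Fin n)) : ∃ k ∈ orthogonalGroup (Fz n) ℝ, Dmat (fun c => a (π c)) = k * Dmat a * kᵀ := by
  let ρ : Perm (Fz n) := (e2 n).symm.trans ((π.prodCongr (Equiv.refl _)).trans (e2 n))
  have hs : ∀ X : Mz n, (1 : Mz n).submatrix ρ id * X * ((1 : Mz n).submatrix ρ id)ᵀ = X.submatrix ρ ρ := fun X => by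
    ext i j
    simp [Matrix.mul_apply, Matrix.one_apply]
  refine ⟨(1 : Mz n).submatrix ρ id, (mem_orth_iff _).2 ?_, ?_⟩
  · have := hs 1
    rw [Matrix.mul_one] at this
    rw [this]; simp
  · rw [hs]
    ext i j
    obtain ⟨⟨i, b⟩, rfl⟩ := (e2 n).surjective i
    obtain ⟨⟨j, c⟩, rfl⟩ := (e2 n).surjective j
    have e1 : ∀ p : Fin n × Fin 2, ρ (e2 n p) = e2 n (π p.1, p.2) := fun p => by simp [ρ]; rfl
    rw [submatrix_apply, e1, e1, Dmat_e2, Dmat_e2]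
    simp

lemma Dl_perm (a : Vc n) (π : Perm (Fin n)) : Dl (fun c => a (π c)) = ((Perm.sign π : ℤ) : ℝ) * Dl a := by
  rw [Dl, Dl, vdm_eq_det, vdm_eq_det, ← det_permute]; rfl

lemma hdt_pt (h : ℝ → ℝ) (t b : Vc n) (π : Perm (Fin n)) : hdt h (fun c => t (π c)) b = ((Perm.sign π : ℤ) : ℝ) * hdt h t b := by
  rw [hdt, hdt, ← det_permute']; rfl

lemma hdt_pb (h : ℝ → ℝ) (t b : Vc n) (π : Perm (Fin n)) : hdt h t (fun c => b (π c)) = ((Perm.sign π : ℤ) : ℝ) * hdt h t b := by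
  rw [hdt, hdt, ← det_permute]; rfl

lemma sgsq (π : Perm (Fin n)) : ((Perm.sign π : ℤ) : ℝ) * ((Perm.sign π : ℤ) : ℝ) = 1 := by
  rcases Int.units_eq_one_or (Perm.sign π) with h | h <;> simp [h]

lemma D_skew (a : Vc n) : (Dmat a)ᵀ = -Dmat a := Dmat_transpose a

lemma LP_perm {P σ h} (H : Core n P σ h) {φ : Mz n → ℝ} (hφ : Measurable φ) {C : ℝ} (hC : ∀ X, |φ X| ≤ C)
    (t : Vc n) (π : Perm (Fin n)) : LP P φ (fun c => t (π c)) = LP P φ t := by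
  obtain ⟨k, hk, e⟩ := Dperm t π
  have hi : ∀ X : Mz n, Integrable fun u : Uz n => P (of u) * φ (of u * X * (of u)ᵀ) := fun X =>
    H.fac.integrable.mul_bdd (c := C) (uDu_meas hφ _).aestronglyMeasurable (ae_of_all _ fun u => hC _)
  have hq : ∀ u : Uz n, P (of u) * φ (of u * (k * Dmat t * kᵀ) * (of u)ᵀ) =
      P (of u * k) * φ ((of u * k) * Dmat t * (of u * k)ᵀ) := fun u => by
    have := H.fac.invariant (of u) 1 (Submonoid.one_mem _) k hk
    rw [Matrix.one_mul] at this
    rw [this, transpose_mul]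
    simp only [Matrix.mul_assoc]
  rw [LP, LP, e, integral_eq_lintegral_pos_part_sub_lintegral_neg_part (hi _), integral_eq_lintegral_pos_part_sub_lintegral_neg_part (hi _)]
  simp only [hq]
  rw [gright hk fun g => oR (P g * φ (g * Dmat t * gᵀ)), gright hk fun g => oR (-(P g * φ (g * Dmat t * gᵀ)))]

lemma srt {t : Vc n} (hi : Function.Injective t) : StrictMono fun c => t (Tuple.sort t c) :=
  (Tuple.monotone_sort t).strictMono_of_injective (hi.comp (Tuple.sort t).injective)

lemma ae_inj (n : ℕ) : ∀ᵐ a : Vc n, Function.Injective a := by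
  have : ∀ i j : Fin n, i ≠ j → ∀ᵐ a : Vc n, a i ≠ a j := fun i j hij => by
    have := addHaar_submodule (volume : Measure Vc n) (LinearMap.ker ((LinearMap.proj i : Vc n →ₗ[ℝ] ℝ) - LinearMap.proj j)) fun h => by
      have h1 : (Pi.single i 1 : Vc n) ∈ LinearMap.ker ((LinearMap.proj i : Vc n →ₗ[ℝ] ℝ) - LinearMap.proj j) := h ▸ Submodule.mem_top
      simp [Pi.single_apply, hij.symm] at h1
    rw [ae_iff]
    refine measure_mono_null (fun a ha => ?_) this
    simp only [ne_eq, not_not, mem_setOf_eq] at ha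
    simp [ha]
  have h2 : ∀ᵐ a : Vc n, ∀ i j : Fin n, i ≠ j → a i ≠ a j := by
    simp only [ae_all_iff, Filter.eventually_imp_distrib_left]
    exact this
  filter_upwards [h2] with a ha i j hij
  by_contra hne
  exact ha i j hne hij

lemma symm_int {F : Vc n → ℝ} (hF : IntegrableOn F (Ch n)) (hs : ∀ (π : Perm (Fin n)) a, F (fun c => a (π c)) = F a) :
    ∫ a in {a : Vc n | ∀ j, 0 < a j}, F a = (n.factorial : ℝ) * ∫ a in Ch n, F a := by
  have hp : MeasurableSet {a : Vc n | ∀ j, 0 < a j} := by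
    have : {a : Vc n | ∀ j, 0 < a j} = ⋂ j, {a | 0 < a j} := by ext; simp
    rw [this]
    exact MeasurableSet.iInter fun j => measurableSet_lt measurable_const (measurable_pi_apply j)
  have he : ∀ π : Perm (Fin n), MeasurableEmbedding fun (x : Vc n) (i : Fin n) => x (π i) := fun π => by
    refine Continuous.measurableEmbedding (by fun_prop) fun x y hxy => ?_
    funext i
    simpa using congrFun hxy (π.symm i)
  have hI := (integrable_indicator_iff (Ch_meas n)).2 hF
  have hi : ∀ π : Perm (Fin n), Integrable fun a : Vc n => (Ch n).indicator F fun c => a (π c) := fun π =>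
    (mp_reindex π).integrable_comp_of_integrable hI
  have e : ∀ᵐ a : Vc n, {a : Vc n | ∀ j, 0 < a j}.indicator F a = ∑ π : Perm (Fin n), (Ch n).indicator F fun c => a (π c) := by
    filter_upwards [ae_inj n] with a ha
    by_cases hpos : ∀ j, 0 < a j
    · rw [indicator_of_mem (by exact hpos), sum_eq_single (Tuple.sort a)]
      · rw [indicator_of_mem, hs]
        exact ⟨fun j => hpos _, srt ha⟩
      · intro π _ hne
        refine indicator_of_notMem (fun hc => hne ?_) _
        have h3 := Tuple.unique_monotone (f := a) hc.2.monotone (srt ha).monotone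
        exact Equiv.ext fun i => ha (congrFun h3 i)
      · intro h; exact absurd (Finset.mem_univ _) h
    · rw [indicator_of_notMem (by exact hpos)]
      refine (Finset.sum_eq_zero fun π _ => indicator_of_notMem (fun hc => hpos fun j => ?_) _).symm
      simpa using hc.1 (π.symm j)
  rw [← integral_indicator hp, integral_congr_ae e, integral_finsetSum _ fun π _ => hi π]
  have : ∀ π : Perm (Fin n), ∫ a : Vc n, (Ch n).indicator F (fun c => a (π c)) = ∫ a in Ch n, F a := fun π => by
    rw [← integral_indicator (Ch_meas n)]
    exact (mp_reindex π).integral_comp (he π) _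
  simp only [this, Finset.sum_const, card_univ, Fintype.card_perm, Fintype.card_fin, nsmul_eq_mul]

lemma coreThm {P σ h} (H : Core n P σ h) {φ : Mz n → ℝ} (hφ : Measurable φ) (hφK : KInv φ) {C : ℝ} (hC : ∀ X, |φ X| ≤ C)
    {t : Vc n} (ht : ∀ c, 0 < t c) (hi : Function.Injective t) :
    LP P φ t = ∫ a in {a : Vc n | ∀ j, 0 < a j}, φ (Dmat a) * ((1 / ((n.factorial : ℝ) * ∏ c : Fin n, ∫ t, h t * t ^ (2 * c.val))) * (Dl a / Dl t) * hdt h t a) := by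
  set π := Tuple.sort t
  have hc : (fun c => t (π c)) ∈ Ch n := ⟨fun c => ht _, srt hi⟩
  have h1 := ev3 H hφ hφK hC hc
  have h2 := (ev2 H hφ hC hc).1
  have hs := symm_int h2 fun ρ a => by
    obtain ⟨k, hk, e⟩ := Dperm a ρ
    rw [e, hφK _ (D_skew a) k hk, Dl_perm, hdt_pb]
    linear_combination (φ (Dmat a) * Dl a * hdt h (fun c => t (π c)) a) * sgsq ρ
  have hD : Dl (fun c => t (π c)) ≠ 0 := (Dl_pos hc).ne'
  have hD2 := hD
  rw [Dl_perm] at hD2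
  have hD3 : Dl t ≠ 0 := right_ne_zero_of_mul hD2
  have hsg : ((Perm.sign π : ℤ) : ℝ) ≠ 0 := left_ne_zero_of_mul hD2
  have hM := kapM H
  set M := ∏ c : Fin n, ∫ t, h t * t ^ (2 * c.val)
  have hM0 : M ≠ 0 := right_ne_zero_of_mul (hM.trans_ne one_ne_zero)
  have hn0 : (n.factorial : ℝ) ≠ 0 := by exact_mod_cast n.factorial_ne_zero
  have e : ∀ a : Vc n, φ (Dmat a) * ((1 / ((n.factorial : ℝ) * M)) * (Dl a / Dl t) * hdt h t a) =
      (1 / ((n.factorial : ℝ) * M * Dl (fun c => t (π c)))) * (φ (Dmat a) * Dl a * hdt h (fun c => t (π c)) a) := fun a => by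
    rw [Dl_perm, hdt_pt]
    field_simp
  simp only [e]
  rw [integral_const_mul, hs, ← LP_perm H hφ hC t π]
  have hk : (kap n).toReal = 1 / M := by field_simp; exact hM
  rw [hk] at h1
  field_simp at h1 ⊢
  linear_combination h1

lemma ae_div {h g : ℝ → ℝ} (hg : ∀ᵐ t, 0 < t → h t = g t) {n : ℕ} {t : Vc n} (ht : ∀ c, 0 < t c) :
    ∀ᵐ a : Vc n, ∀ b c, 0 < a b → h (a b / t c) = g (a b / t c) := by
  simp only [ae_all_iff]
  intro b c
  have h1 : QuasiMeasurePreserving (fun x : ℝ => x * (t c)⁻¹) := by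
    refine ⟨measurable_id.mul_const _, ?_⟩
    have := Real.map_volume_mul_right (inv_ne_zero (ht c).ne')
    change Measure.map (fun x => x * (t c)⁻¹) volume ≪ volume
    rw [this]
    exact smul_absolutelyContinuous
  have h2 := h1.comp (quasiMeasurePreserving_eval (fun _ : Fin n => (volume : Measure ℝ)) b)
  have h3 := h2.ae hg
  filter_upwards [h3] with a ha hb
  have := ha (mul_pos hb (inv_pos.2 (ht c)))
  simpa [div_eq_mul_inv] using this

lemma mkCore (hn : 1 ≤ n) {P σw h} (hfac : IsFactorizing n P σw) (hdet : IsDetDensity σw h)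
    (hmp : ∀ j : Fin n, 0 < mellH h (2 * ((j : ℕ) + 1 : ℝ) - 1))
    (hmi : ∀ j : Fin n, IntegrableOn (fun t : ℝ => h t * t ^ (2 * ((j : ℕ) + 1 : ℝ) - 1 - 1)) (Set.Ioi 0)) :
    ∃ g : ℝ → ℝ, Core n P σw g ∧ (∀ᵐ t, 0 < t → h t = g t) ∧ ∀ j : Fin n, mellH h (2 * ((j : ℕ) + 1 : ℝ) - 1) = ∫ t, g t * t ^ (2 * j.val) := by
  have ex : ∀ (j : Fin n) (t : ℝ), t ^ (2 * ((j : ℕ) + 1 : ℝ) - 1 - 1) = t ^ (2 * j.val) := fun j t => by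
    rw [← Real.rpow_natCast]; congr 1; push_cast; ring
  obtain ⟨j0, hj0⟩ : ∃ j0 : Fin n, j0.val = 0 := ⟨⟨0, hn⟩, rfl⟩
  have hI : IntegrableOn h (Set.Ioi 0) := by
    have := hmi j0
    simp only [ex] at this
    simp only [hj0, mul_zero, pow_zero, mul_one] at this
    exact this
  have hI0 : 0 < ∫ t in Set.Ioi 0, h t := by
    have := hmp j0
    simp only [mellH, ex] at this
    simp only [hj0, mul_zero, pow_zero, mul_one] at this
    exact this
  let g : ℝ → ℝ := (Set.Ioi 0).indicator fun t => max (hI.1.mk h t) 0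
  have gm : Measurable g := (hI.1.stronglyMeasurable_mk.measurable.max measurable_const).indicator measurableSet_Ioi
  have g0 : ∀ t, 0 ≤ g t := fun t => indicator_nonneg (fun t _ => le_max_right _ _) t
  have gh : ∀ᵐ t, 0 < t → h t = g t := by
    have := (ae_restrict_iff' (measurableSet_Ioi (a := (0:ℝ)))).1 hI.1.ae_eq_mk
    filter_upwards [this] with t ht hp
    have hp' : t ∈ Set.Ioi (0:ℝ) := hp
    simp only [g, indicator_of_mem hp']
    rw [← ht hp, max_eq_left (hdet.1 t hp)]
  have gz : ∀ t, t ≤ 0 → g t = 0 := fun t ht => indicator_of_notMem (by simpa using ht) _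
  have gi : ∀ q : ℝ → ℝ, (fun t => g t * q t) =ᵐ[volume] (Set.Ioi 0).indicator fun t => h t * q t := fun q => by
    filter_upwards [gh] with t ht
    by_cases hp : t ∈ Set.Ioi (0:ℝ)
    · rw [indicator_of_mem hp, ht hp]
    · rw [indicator_of_notMem hp, gz t (by simpa using hp), zero_mul]
  have gI : ∀ q : ℝ → ℝ, ∫ t, g t * q t = ∫ t in Set.Ioi 0, h t * q t := fun q => by
    rw [integral_congr_ae (gi q), integral_indicator measurableSet_Ioi]
  have gint : ∀ q : ℝ → ℝ, IntegrableOn (fun t => h t * q t) (Set.Ioi 0) → Integrable fun t => g t * q t := fun q hq =>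
    ((integrable_indicator_iff measurableSet_Ioi).2 hq).congr (gi q).symm
  have gint0 : Integrable g := by
    have := gint (fun _ => 1) (by simpa using hI)
    simpa using this
  have hs : Integrable fun z : Fin 2 → Vc 2 => σw (of z) := by
    by_contra hc
    have := hdet.2 (fun _ => 1) measurable_const ⟨1, fun _ => by simp⟩
    simp only [mul_one] at this
    rw [integral_undef hc] at this
    exact hI0.ne this
  have dm : Measurable fun z : Fin 2 → Vc 2 => |(of z).det| := by
    simp only [det_fin_two, of_apply]
    fun_prop
  refine ⟨g, ⟨hfac, gm, g0, gz, gint0, fun j => ?_, hs, ?_⟩, gh, fun j => ?_⟩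
  · refine gint (fun t => t ^ (2 * j.val)) ?_
    have := hmi j
    simpa only [ex] using this
  · ext S hS
    have hI1 : Measurable (S.indicator fun _ => (1:ℝ)) := measurable_const.indicator hS
    have hb : ∀ t, |S.indicator (fun _ => (1:ℝ)) t| ≤ 1 := fun t => by
      by_cases h : t ∈ S <;> simp [h]
    have hi0 : ∀ t, 0 ≤ S.indicator (fun _ => (1:ℝ)) t := fun t => indicator_nonneg (fun _ _ => zero_le_one) t
    have k := hdet.2 _ hI1 ⟨1, hb⟩
    rw [← gI] at k
    rw [Measure.map_apply dm hS, withDensity_apply _ (dm hS), withDensity_apply _ hS, ← lintegral_indicator (dm hS), ← lintegral_indicator hS]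
    have e1 : ∀ z : Fin 2 → Vc 2, ((fun z : Fin 2 → Vc 2 => |(of z).det|) ⁻¹' S).indicator (fun z => oR (σw (of z))) z =
        oR (σw (of z) * S.indicator (fun _ => (1:ℝ)) |(of z).det|) := fun z => by
      by_cases h : |(of z).det| ∈ S
      · rw [indicator_of_mem (by exact h), indicator_of_mem h, mul_one]
      · rw [indicator_of_notMem (by exact h), indicator_of_notMem h]; simp
    have e2 : ∀ t, S.indicator (fun t => oR (g t)) t = oR (g t * S.indicator (fun _ => (1:ℝ)) t) := fun t => by
      by_cases h : t ∈ S
      · rw [indicator_of_mem h, indicator_of_mem h, mul_one]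
      · rw [indicator_of_notMem h, indicator_of_notMem h]; simp
    simp only [e1, e2]
    rw [← ofReal_integral_eq_lintegral_ofReal, ← ofReal_integral_eq_lintegral_ofReal, k]
    · exact gint0.mul_bdd (c := 1) hI1.aestronglyMeasurable (ae_of_all _ hb)
    · exact ae_of_all _ fun t => mul_nonneg (g0 t) (hi0 t)
    · exact hs.mul_bdd (c := 1) (hI1.comp dm).aestronglyMeasurable (ae_of_all _ fun z => hb _)
    · exact ae_of_all _ fun z => mul_nonneg (hfac.wnonneg _) (hi0 _)
  · rw [gI fun t => t ^ (2 * j.val)]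
    simp only [mellH, ex]

end

/-- Theorem 3.4: jPDF of the singular values of `g D(ã) gᵀ` for a
factorizing ensemble `g`. -/
theorem factorizing_times_fixed_matrix (n : ℕ) (hn : 1 ≤ n)
    (P : Matrix (Fin (2 * n)) (Fin (2 * n)) ℝ → ℝ)
    (σw : Matrix (Fin 2) (Fin 2) ℝ → ℝ) (hfac : IsFactorizing n P σw)
    (h : ℝ → ℝ) (hdet : IsDetDensity σw h)
    (hmellpos : ∀ j : Fin n, 0 < mellH h (2 * ((j : ℕ) + 1 : ℝ) - 1))
    (hmellint : ∀ j : Fin n,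
      IntegrableOn (fun t : ℝ => h t * t ^ (2 * ((j : ℕ) + 1 : ℝ) - 1 - 1)) (Set.Ioi 0))
    (ta : Fin n → ℝ) (hta : ∀ j, 0 < ta j) (hta' : Function.Injective ta) :
    ∀ φ : Matrix (Fin (2 * n)) (Fin (2 * n)) ℝ → ℝ, IsInvTest (2 * n) φ →
      (∫ u : Fin (2 * n) → Fin (2 * n) → ℝ,
          P (Matrix.of u) * φ (Matrix.of u * Dmat ta * (Matrix.of u)ᵀ)) =
        ∫ a in {a : Fin n → ℝ | ∀ j, 0 < a j},
          φ (Dmat a) *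
            ((1 / ((Nat.factorial n : ℝ) *
                ∏ j : Fin n, mellH h (2 * ((j : ℕ) + 1 : ℝ) - 1))) *
              ((vdm fun j => (a j) ^ 2) / (vdm fun j => (ta j) ^ 2)) *
                (Matrix.of fun b c : Fin n => (1 / ta c) * h (a b / ta c)).det) := by
  intro φ hφ
  obtain ⟨hφm, ⟨C, hC⟩, hφK⟩ := hφ
  obtain ⟨g, H, hg, hM⟩ := mkCore hn hfac hdet hmellpos hmellint
  have main := coreThm H hφm hφK hC hta hta'
  refine main.trans ?_
  simp only [← hM]
  refine integral_congr_ae ?_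
  have hp : MeasurableSet {a : Fin n → ℝ | ∀ j, 0 < a j} := by
    have : {a : Fin n → ℝ | ∀ j, 0 < a j} = ⋂ j, {a | 0 < a j} := by ext; simp
    rw [this]
    exact MeasurableSet.iInter fun j => measurableSet_lt measurable_const (measurable_pi_apply j)
  rw [Filter.EventuallyEq, ae_restrict_iff' hp]
  filter_upwards [ae_div hg hta] with a ha hpos
  have : hdt g ta a = (Matrix.of fun b c : Fin n => (1 / ta c) * h (a b / ta c)).det := by
    rw [hdt]
    congr 1
    ext b c
    simp only [Matrix.of_apply, ha b c (hpos b)]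
  rw [this]; rfl

end
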